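/- Let U ⊆ ℝⁿ be an open connected neighbourhood of 0 and let f : U → ℝ be a real-analytic function, not identically zero, with f(0) = 0. Assume there exists a nonzero polynomial P ∈ ℝ[x₁,…,xₙ,y] such that P(x, f(x)) = 0 and ∂P/∂y(x, f(x)) ≠ 0 for all x ∈ U; let d = deg P, let Z = {x ∈ U : f(x) = 0}, and set k = d(3d−2)ⁿ + 1. Then for any two C^k functions f₁ : U₁ → ℝ and f₂ : U₂ → ℝ on open neighbourhoods U₁, U₂ of 0 that are both C^k-Z-realizations of the k-Z-jet of f, there exist open neighbourhoods Ω₁, Ω₂ ⊆ ℝⁿ of 0 and a homeomorphism φ : Ω₁ → Ω₂ such that f₁(φ(x)) = f₂(x) for all x ∈ Ω₁. -/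

import Mathlib

open Filter Topology

theorem MvPolynomial.totalDegree_pderiv_le {σ R : Type*} [CommRing R] (i : σ)
    (p : MvPolynomial σ R) : (pderiv i p).totalDegree ≤ p.totalDegree - 1 := by
  classical
  conv_lhs => rw [p.as_sum, map_sum]
  refine totalDegree_finsetSum_le fun s hs => ?_
  rw [pderiv_monomial]
  by_cases hsi : s i = 0
  · simp [hsi]
  refine (totalDegree_monomial_le _ _).trans ?_
  have h1 : (s - Finsupp.single i 1).sum (fun _ e => e) + 1 = s.sum (fun _ e => e) := by
    have h1 : s = (s - Finsupp.single i 1) + Finsupp.single i 1 := by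
      ext j
      by_cases hj : j = i
      · subst hj; simp; omega
      · simp [Ne.symm hj]
    conv_rhs => rw [h1]
    rw [Finsupp.sum_add_index' (by simp) (by simp)]
    simp
  have h2 := le_totalDegree hs
  change (s - Finsupp.single i 1).sum (fun _ e => e) ≤ _
  omega

theorem MvPolynomial.totalDegree_map_le' {σ R S : Type*} [CommRing R] [CommRing S] (f : R →+* S)
    (p : MvPolynomial σ R) : (map f p).totalDegree ≤ p.totalDegree :=
  Finset.sup_mono (support_map_subset f p)

theorem MvPolynomial.mk_mem_span_monomials {σ R : Type*} [Finite σ] [CommRing R] (e : ℕ)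
    (g : σ → MvPolynomial σ R) (hg : ∀ i, (g i).totalDegree < e) (I : Ideal (MvPolynomial σ R))
    (hI : ∀ i, X i ^ e - g i ∈ I) (m : ℕ) (p : MvPolynomial σ R) (hp : p.totalDegree ≤ m) :
    Ideal.Quotient.mk I p ∈ Submodule.span R
      (Set.range fun a : σ → Fin e =>
        Ideal.Quotient.mk I (monomial (Finsupp.equivFunOnFinite.symm fun i => (a i : ℕ)) 1)) := by
  classical
  induction m using Nat.strong_induction_on generalizing p with
  | _ m ih =>
  rw [p.as_sum, map_sum]
  refine Submodule.sum_mem _ fun s hs => ?_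
  have hsd : s.sum (fun _ e => e) ≤ m := (le_totalDegree hs).trans hp
  have hmon : Ideal.Quotient.mk I (monomial s (coeff s p)) =
      coeff s p • Ideal.Quotient.mk I (monomial s (1 : R)) := by
    rw [← Ideal.Quotient.mkₐ_eq_mk R, ← map_smul, smul_monomial, smul_eq_mul, mul_one]
  rw [hmon]
  refine Submodule.smul_mem _ _ ?_
  by_cases hlt : ∀ i, s i < e
  · refine Submodule.subset_span ⟨fun i => ⟨s i, hlt i⟩, ?_⟩
    have h1 : (Finsupp.equivFunOnFinite.symm fun i => s i) = s :=
      Finsupp.equivFunOnFinite.symm_apply_apply s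
    change Ideal.Quotient.mk I (monomial (Finsupp.equivFunOnFinite.symm fun i => s i) 1) = _
    rw [h1]
  · push Not at hlt
    obtain ⟨i, hi⟩ := hlt
    have h1 : s = (s - Finsupp.single i e) + Finsupp.single i e := by
      ext j
      by_cases hj : j = i
      · subst hj; simp; omega
      · simp [Ne.symm hj]
    have hsplit : (monomial s (1 : R)) = X i ^ e * monomial (s - Finsupp.single i e) 1 := by
      rw [X_pow_eq_monomial, monomial_mul, one_mul, add_comm, ← h1]
    have hsub : (s - Finsupp.single i e).sum (fun _ e => e) + e = s.sum (fun _ e => e) := by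
      conv_rhs => rw [h1]
      rw [Finsupp.sum_add_index' (by simp) (by simp)]
      simp
    have heq : Ideal.Quotient.mk I (monomial s (1 : R)) =
        Ideal.Quotient.mk I (g i * monomial (s - Finsupp.single i e) 1) := by
      rw [Ideal.Quotient.eq, hsplit, ← sub_mul]
      exact I.mul_mem_right _ (hI i)
    have hdeg : (g i * monomial (s - Finsupp.single i e) (1 : R)).totalDegree < m := by
      refine (totalDegree_mul _ _).trans_lt ?_
      have h2 : _ ≤ (s - Finsupp.single i e).sum (fun _ e => e) :=
        totalDegree_monomial_le (s - Finsupp.single i e) (1 : R)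
      have := hg i
      omega
    rw [heq]
    exact ih _ hdeg _ le_rfl

theorem MvPolynomial.exists_monic_eval₂_eq_zero {σ R : Type*} [Fintype σ] [CommRing R] (e : ℕ)
    (g : σ → MvPolynomial σ R) (hg : ∀ i, (g i).totalDegree < e) (h : MvPolynomial σ R) :
    ∃ χ : Polynomial R, χ.Monic ∧ χ.natDegree ≤ e ^ Fintype.card σ ∧
      ∀ (ρ : R →+* ℝ) (x : σ → ℝ), (∀ i, x i ^ e = eval₂ ρ x (g i)) →
        χ.eval₂ ρ (eval₂ ρ x h) = 0 := by
  classical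
  set I : Ideal (MvPolynomial σ R) := Ideal.span (Set.range fun i => X i ^ e - g i) with hIdef
  have hI : ∀ i, X i ^ e - g i ∈ I := fun i => Ideal.subset_span ⟨i, rfl⟩
  set S : Set (MvPolynomial σ R ⧸ I) := Set.range fun a : σ → Fin e =>
        Ideal.Quotient.mk I (monomial (Finsupp.equivFunOnFinite.symm fun i => (a i : ℕ)) 1)
    with hS
  have hSfin : S.Finite := Set.finite_range _
  have hspan : Submodule.span R S = ⊤ := by
    rw [eq_top_iff]
    intro q _
    obtain ⟨p, rfl⟩ := Ideal.Quotient.mk_surjective q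
    exact mk_mem_span_monomials e g hg I hI _ p le_rfl
  have : Module.Finite R (MvPolynomial σ R ⧸ I) := ⟨⟨hSfin.toFinset, by simpa using hspan⟩⟩
  obtain ⟨χ, hm, hdeg, hχ⟩ := LinearMap.exists_monic_and_natDegree_eq_and_aeval_eq_zero R
    (Algebra.lmul R _ (Ideal.Quotient.mk I h))
  refine ⟨χ, hm, ?_, ?_⟩
  · rw [hdeg, ← hspan]
    refine (Submodule.spanFinrank_span_le_ncard_of_finite hSfin).trans ?_
    rw [hS, ← Set.image_univ]
    refine (Set.ncard_image_le Set.finite_univ).trans ?_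
    rw [Set.ncard_univ, Nat.card_eq_fintype_card]
    simp
  · intro ρ x hx
    rw [Polynomial.aeval_algHom_apply] at hχ
    have h1 : Polynomial.aeval (Ideal.Quotient.mk I h) χ = 0 :=
      Algebra.lmul_injective (R := R) <| by simpa using hχ
    rw [← Ideal.Quotient.mkₐ_eq_mk R, Polynomial.aeval_algHom_apply, Ideal.Quotient.mkₐ_eq_mk,
      Ideal.Quotient.eq_zero_iff_mem] at h1
    have hker : I ≤ RingHom.ker (eval₂Hom ρ x) := by
      rw [hIdef, Ideal.span_le]
      rintro _ ⟨i, rfl⟩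
      simp [RingHom.mem_ker, hx i]
    have h2 := hker h1
    rw [RingHom.mem_ker, Polynomial.aeval_def, Polynomial.hom_eval₂] at h2
    have h3 : (eval₂Hom ρ x).comp (algebraMap R (MvPolynomial σ R)) = ρ := by
      ext r
      simp [algebraMap_eq]
    rwa [h3] at h2

/-- `x` is a limit of solutions of the equations `x i ^ e = c * ∂Φ/∂x i` as `c → ∞`, where the
coefficients of `Φ` are evaluated at `t`. -/
def PerturbedCritical {n : ℕ} (Φ : MvPolynomial (Fin n) (Polynomial ℝ)) (e : ℕ) (t : ℝ)
    (x : Fin n → ℝ) : Prop :=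
  ∃ (c : ℕ → ℝ) (y : ℕ → Fin n → ℝ), Tendsto c atTop atTop ∧ Tendsto y atTop (𝓝 x) ∧
    ∀ j i, y j i ^ e =
      c j * (MvPolynomial.pderiv i Φ).eval₂ (Polynomial.evalRingHom t) (y j)

theorem MvPolynomial.continuous_eval₂_real {n : ℕ} {R : Type*} [CommRing R] (ρ : R →+* ℝ)
    (h : MvPolynomial (Fin n) R) : Continuous fun x : Fin n → ℝ => h.eval₂ ρ x := by
  simp_rw [← eval_map]
  exact continuous_eval _

theorem Polynomial.tendsto_eval₂_div_pow {ρ : Polynomial ℝ →+* ℝ} (q : Polynomial (Polynomial ℝ))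
    (K : ℕ) (hK : q.natDegree ≤ K) (c : ℕ → ℝ) (hc : Tendsto c atTop atTop) :
    Tendsto (fun j => q.eval₂ ρ (c j) / c j ^ K) atTop (𝓝 (ρ (q.coeff K))) := by
  have h1 : ∀ᶠ j in atTop, c j ≠ 0 := (hc.eventually_gt_atTop 0).mono fun j h => h.ne'
  have h2 : Tendsto (fun j => ∑ m ∈ Finset.range (K + 1), ρ (q.coeff m) * ((c j)⁻¹) ^ (K - m))
      atTop (𝓝 (∑ m ∈ Finset.range (K + 1), ρ (q.coeff m) * (0 : ℝ) ^ (K - m))) :=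
    tendsto_finsetSum _ fun m _ => (((tendsto_inv_atTop_zero.comp hc).pow _).const_mul _)
  have h3 : (∑ m ∈ Finset.range (K + 1), ρ (q.coeff m) * (0 : ℝ) ^ (K - m)) = ρ (q.coeff K) := by
    rw [Finset.sum_range_succ, Finset.sum_eq_zero]
    · simp
    · intro m hm
      have : K - m ≠ 0 := by have := Finset.mem_range.1 hm; omega
      simp [this]
  rw [h3] at h2
  refine h2.congr' ?_
  filter_upwards [h1] with j hj
  rw [Polynomial.eval₂_eq_sum_range' ρ (Nat.lt_succ_of_le hK), Finset.sum_div]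
  refine Finset.sum_congr rfl fun m hm => ?_
  have hm' : m ≤ K := by have := Finset.mem_range.1 hm; omega
  rw [mul_div_assoc]
  congr 1
  rw [eq_div_iff (pow_ne_zero _ hj), inv_pow, inv_mul_eq_div, pow_sub₀ _ hj hm']
  field_simp

theorem PerturbedCritical.exists_polynomial {n : ℕ} (Φ : MvPolynomial (Fin n) (Polynomial ℝ))
    (e : ℕ) (he : Φ.totalDegree ≤ e) (he1 : 1 ≤ e) (h : MvPolynomial (Fin n) (Polynomial ℝ)) :
    ∃ G : Polynomial (Polynomial ℝ), G ≠ 0 ∧ G.natDegree ≤ e ^ n ∧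
      ∀ t x, PerturbedCritical Φ e t x →
        (G.map (Polynomial.evalRingHom t)).eval (h.eval₂ (Polynomial.evalRingHom t) x) = 0 := by
  classical
  obtain ⟨χ, hmonic, hdeg, hχ⟩ := MvPolynomial.exists_monic_eval₂_eq_zero
    (R := Polynomial (Polynomial ℝ)) e
    (fun i : Fin n => MvPolynomial.C Polynomial.X *
      MvPolynomial.map Polynomial.C (MvPolynomial.pderiv i Φ)) (fun i => by
        refine (MvPolynomial.totalDegree_mul _ _).trans_lt ?_
        have h1 : (MvPolynomial.map (Polynomial.C (R := Polynomial ℝ))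
            (MvPolynomial.pderiv i Φ)).totalDegree ≤ (MvPolynomial.pderiv i Φ).totalDegree :=
          MvPolynomial.totalDegree_map_le' _ _
        have h2 := MvPolynomial.totalDegree_pderiv_le i Φ
        simp only [MvPolynomial.totalDegree_C, zero_add]
        omega) (MvPolynomial.map Polynomial.C h)
  have hne : χ.support.Nonempty := by
    rw [Finset.nonempty_iff_ne_empty, Ne, Polynomial.support_eq_empty]
    exact hmonic.ne_zero
  obtain ⟨k₀, hk₀, hmax⟩ := χ.support.exists_max_image (fun k => (χ.coeff k).natDegree) hne
  set K := (χ.coeff k₀).natDegree with hKdef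
  have hK : ∀ k, (χ.coeff k).natDegree ≤ K := by
    intro k
    by_cases hk : k ∈ χ.support
    · exact hmax k hk
    · rw [Polynomial.notMem_support_iff.1 hk]; simp
  set N := χ.natDegree
  let G : Polynomial (Polynomial ℝ) :=
    ∑ k ∈ Finset.range (N + 1), Polynomial.monomial k ((χ.coeff k).coeff K)
  have hk₀N : k₀ ≤ N := Polynomial.le_natDegree_of_mem_supp _ hk₀
  refine ⟨G, ?_, ?_, ?_⟩
  · intro hG
    have h1 : G.coeff k₀ = (χ.coeff k₀).coeff K := by
      simp only [G, Polynomial.finsetSum_coeff, Polynomial.coeff_monomial]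
      rw [Finset.sum_ite_eq']
      simp [Nat.lt_succ_of_le hk₀N]
    rw [hG, Polynomial.coeff_zero, hKdef, Polynomial.coeff_natDegree] at h1
    exact Polynomial.mem_support_iff.1 hk₀ (Polynomial.leadingCoeff_eq_zero.1 h1.symm)
  · refine Polynomial.natDegree_sum_le_of_forall_le _ _ fun k hk => ?_
    refine (Polynomial.natDegree_monomial_le _).trans ?_
    have := Finset.mem_range.1 hk
    have : e ^ Fintype.card (Fin n) = e ^ n := by simp
    omega
  · rintro t x ⟨c, y, hc, hy, hcy⟩
    set ρ := Polynomial.evalRingHom t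
    have hcomp : ∀ c : ℝ, (Polynomial.eval₂RingHom ρ c).comp Polynomial.C = ρ := by
      intro c; ext <;> simp
    have hh : ∀ j, ∑ k ∈ Finset.range (N + 1),
        ((χ.coeff k).eval₂ ρ (c j) / c j ^ K) * (h.eval₂ ρ (y j)) ^ k = 0 := by
      intro j
      have h1 := hχ (Polynomial.eval₂RingHom ρ (c j)) (y j) (by
        intro i
        rw [MvPolynomial.eval₂_mul, MvPolynomial.eval₂_C, MvPolynomial.eval₂_map, hcomp]
        simpa using hcy j i)
      rw [MvPolynomial.eval₂_map, hcomp, Polynomial.eval₂_eq_sum_range] at h1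
      calc _ = (∑ k ∈ Finset.range (N + 1),
            (Polynomial.eval₂RingHom ρ (c j)) (χ.coeff k) * (h.eval₂ ρ (y j)) ^ k) / c j ^ K := by
            rw [Finset.sum_div]
            refine Finset.sum_congr rfl fun k _ => ?_
            simp only [Polynomial.coe_eval₂RingHom]
            ring
        _ = 0 := by rw [h1, zero_div]
    have hlim : Tendsto (fun j => ∑ k ∈ Finset.range (N + 1),
        ((χ.coeff k).eval₂ ρ (c j) / c j ^ K) * (h.eval₂ ρ (y j)) ^ k) atTop
        (𝓝 (∑ k ∈ Finset.range (N + 1), ρ ((χ.coeff k).coeff K) * (h.eval₂ ρ x) ^ k)) := by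
      refine tendsto_finsetSum _ fun k _ => ?_
      refine (Polynomial.tendsto_eval₂_div_pow _ K (hK k) c hc).mul (Tendsto.pow ?_ k)
      exact ((MvPolynomial.continuous_eval₂_real ρ h).tendsto x).comp hy
    have h0 := tendsto_nhds_unique (hlim.congr hh) tendsto_const_nhds
    simp only [G, Polynomial.map_sum, Polynomial.map_monomial, Polynomial.eval_finsetSum,
      Polynomial.eval_monomial]
    exact h0

theorem MvPolynomial.hasDerivAt_eval {σ : Type*} [Fintype σ] (q : MvPolynomial σ ℝ)
    (u : ℝ → σ → ℝ) (u' : σ → ℝ) (s : ℝ) (hu : ∀ i, HasDerivAt (fun r => u r i) (u' i) s) :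
    HasDerivAt (fun r => eval (u r) q) (∑ i, eval (u s) (pderiv i q) * u' i) s := by
  classical
  induction q using MvPolynomial.induction_on with
  | C a => simpa using hasDerivAt_const s a
  | add p q hp hq =>
    simp only [map_add, add_mul, Finset.sum_add_distrib]
    exact hp.add hq
  | mul_X p j hp =>
    have h := hp.mul (hu j)
    simp only [map_mul, eval_X]
    refine h.congr_deriv ?_
    simp only [pderiv_mul, map_add, map_mul, eval_X, add_mul, Finset.sum_add_distrib, pderiv_X]
    congr 1
    · rw [Finset.sum_mul]
      exact Finset.sum_congr rfl fun i _ => by ring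
    · rw [Finset.sum_eq_single j]
      · simp
      · intro b _ hb
        simp [Ne.symm hb]
      · simp

theorem MvPolynomial.exists_taylor_bound {σ : Type*} [Fintype σ] (q : MvPolynomial σ ℝ) (B : ℝ) :
    ∃ C, 0 ≤ C ∧ ∀ x y : σ → ℝ, ‖x‖ ≤ B → ‖y‖ ≤ B →
      |eval x q| ≤ C ∧ |eval x q - eval y q| ≤ C * ‖x - y‖ ∧
      |eval x q - eval y q - ∑ i, eval y (pderiv i q) * (x i - y i)| ≤ C * ‖x - y‖ ^ 2 := by
  classical
  induction q using MvPolynomial.induction_on with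
  | C a => exact ⟨|a|, abs_nonneg a, fun x y _ _ => by
      refine ⟨by simp, ?_, ?_⟩ <;> simp <;> positivity⟩
  | add p q hp hq =>
    obtain ⟨C₁, h₁, hp⟩ := hp
    obtain ⟨C₂, h₂, hq⟩ := hq
    refine ⟨C₁ + C₂, by positivity, fun x y hx hy => ?_⟩
    obtain ⟨a1, a2, a3⟩ := hp x y hx hy
    obtain ⟨b1, b2, b3⟩ := hq x y hx hy
    simp only [map_add, add_mul, Finset.sum_add_distrib]
    refine ⟨(abs_add_le _ _).trans (add_le_add a1 b1), ?_, ?_⟩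
    · rw [add_sub_add_comm]
      exact (abs_add_le _ _).trans (add_le_add a2 b2)
    · rw [add_sub_add_comm, add_sub_add_comm]
      exact (abs_add_le _ _).trans (add_le_add a3 b3)
  | mul_X p j hp =>
    obtain ⟨C, h, hp⟩ := hp
    refine ⟨C * |B| + C, by positivity, fun x y hx hy => ?_⟩
    obtain ⟨a1, a2, a3⟩ := hp x y hx hy
    have hB : B ≤ |B| := le_abs_self B
    have hxj : |x j| ≤ |B| := by
      have := norm_le_pi_norm x j
      rw [Real.norm_eq_abs] at this
      linarith
    have hyj : |y j| ≤ |B| := by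
      have := norm_le_pi_norm y j
      rw [Real.norm_eq_abs] at this
      linarith
    have hdj : |x j - y j| ≤ ‖x - y‖ := by
      simpa using norm_le_pi_norm (x - y) j
    have b1 := (hp y x hy hx).1
    have hsum : ∑ i, eval y (pderiv i (p * X j)) * (x i - y i) =
        (∑ i, eval y (pderiv i p) * (x i - y i)) * y j + eval y p * (x j - y j) := by
      simp only [pderiv_mul, map_add, map_mul, eval_X, add_mul, Finset.sum_add_distrib, pderiv_X]
      congr 1
      · rw [Finset.sum_mul]
        exact Finset.sum_congr rfl fun i _ => by ring
      · rw [Finset.sum_eq_single j]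
        · simp
        · intro b _ hb
          simp [Ne.symm hb]
        · simp
    rw [hsum]
    simp only [map_mul, eval_X]
    refine ⟨?_, ?_, ?_⟩
    · rw [abs_mul]
      have := mul_le_mul a1 hxj (abs_nonneg _) h
      linarith
    · have : eval x p * x j - eval y p * y j =
        (eval x p - eval y p) * x j + eval y p * (x j - y j) := by ring
      rw [this]
      refine (abs_add_le _ _).trans ?_
      rw [abs_mul, abs_mul]
      have e1 := mul_le_mul a2 hxj (abs_nonneg _) (by positivity)
      have e2 := mul_le_mul b1 hdj (abs_nonneg _) h
      nlinarith
    · have : eval x p * x j - eval y p * y j -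
          ((∑ i, eval y (pderiv i p) * (x i - y i)) * y j + eval y p * (x j - y j)) =
        (eval x p - eval y p - ∑ i, eval y (pderiv i p) * (x i - y i)) * y j +
          (eval x p - eval y p) * (x j - y j) := by ring
      rw [this]
      refine (abs_add_le _ _).trans ?_
      rw [abs_mul, abs_mul]
      have e1 := mul_le_mul a3 hyj (abs_nonneg _) (by positivity)
      have e2 := mul_le_mul a2 hdj (abs_nonneg _) (by positivity)
      nlinarith

/-- The closed Euclidean ball, as a subset of `Fin n → ℝ`. -/
def euclideanBall (n : ℕ) (R : ℝ) : Set (Fin n → ℝ) := {x | ∑ i, x i ^ 2 ≤ R ^ 2}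

theorem norm_le_of_sum_sq_le {n : ℕ} {R : ℝ} (hR : 0 ≤ R) {x : Fin n → ℝ}
    (hx : ∑ i, x i ^ 2 ≤ R ^ 2) : ‖x‖ ≤ R := by
  rw [pi_norm_le_iff_of_nonneg hR]
  intro i
  rw [Real.norm_eq_abs]
  refine abs_le_of_sq_le_sq ?_ hR
  exact (Finset.single_le_sum (f := fun i => x i ^ 2) (fun i _ => sq_nonneg _)
    (Finset.mem_univ i)).trans hx

theorem continuous_sum_sq (n : ℕ) : Continuous fun x : Fin n → ℝ => ∑ i, x i ^ 2 := by fun_prop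

theorem isCompact_euclideanBall (n : ℕ) (R : ℝ) : IsCompact (euclideanBall n R) := by
  refine Metric.isCompact_of_isClosed_isBounded ?_ ?_
  · exact isClosed_le (continuous_sum_sq n) continuous_const
  · refine (Metric.isBounded_closedBall (x := (0 : Fin n → ℝ)) (r := |R|)).subset fun x hx => ?_
    rw [mem_closedBall_zero_iff]
    refine norm_le_of_sum_sq_le (abs_nonneg R) ?_
    rw [sq_abs]
    exact hx

theorem MvPolynomial.eval_pderiv_eq_zero_of_isMaxOn {n : ℕ} {R : ℝ} {y : Fin n → ℝ}
    (hy : ∑ i, y i ^ 2 < R ^ 2) (p : MvPolynomial (Fin n) ℝ)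
    (hmax : ∀ z ∈ euclideanBall n R, eval z p ≤ eval y p) (i : Fin n) :
    eval y (pderiv i p) = 0 := by
  classical
  have hd := hasDerivAt_eval p (fun r => y + r • Pi.single i 1) (Pi.single i 1) 0 (fun j => by
    simpa using ((hasDerivAt_id (0 : ℝ)).mul_const ((Pi.single i 1 : Fin n → ℝ) j)).const_add (y j))
  have hcont : Continuous fun r : ℝ => ∑ j, (y + r • (Pi.single i 1 : Fin n → ℝ)) j ^ 2 :=
    (continuous_sum_sq n).comp (by fun_prop)
  have hloc : IsLocalMax (fun r : ℝ => eval (y + r • (Pi.single i 1 : Fin n → ℝ)) p) 0 := by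
    have h1 : ∀ᶠ r in 𝓝 (0 : ℝ), ∑ j, (y + r • (Pi.single i 1 : Fin n → ℝ)) j ^ 2 < R ^ 2 :=
      hcont.tendsto 0 |>.eventually_lt_const (by simpa using hy)
    filter_upwards [h1] with r hr
    simpa using hmax _ hr.le
  have h := hloc.hasDerivAt_eq_zero hd
  rw [Finset.sum_eq_single i] at h
  · simpa using h
  · intro b _ hb
    simp [hb]
  · simp

theorem PerturbedCritical.exists_of_isMax {n : ℕ} (Φ : MvPolynomial (Fin n) (Polynomial ℝ))
    (e : ℕ) (t R : ℝ) (x₀ : Fin n → ℝ) (hx₀ : x₀ ∈ euclideanBall n R)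
    (hsph : ∀ x : Fin n → ℝ, ∑ i, x i ^ 2 = R ^ 2 →
      Φ.eval₂ (Polynomial.evalRingHom t) x < Φ.eval₂ (Polynomial.evalRingHom t) x₀) :
    ∃ x : Fin n → ℝ, ∑ i, x i ^ 2 < R ^ 2 ∧
      (∀ z ∈ euclideanBall n R,
        Φ.eval₂ (Polynomial.evalRingHom t) z ≤ Φ.eval₂ (Polynomial.evalRingHom t) x) ∧
      PerturbedCritical Φ e t x := by
  classical
  set q : MvPolynomial (Fin n) ℝ := MvPolynomial.map (Polynomial.evalRingHom t) Φ with hq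
  have hqe : ∀ x, Φ.eval₂ (Polynomial.evalRingHom t) x = MvPolynomial.eval x q := fun x => by
    rw [hq, MvPolynomial.eval_map]
  simp only [hqe] at hsph ⊢
  set S : MvPolynomial (Fin n) ℝ :=
    ∑ i, MvPolynomial.C ((e + 1 : ℝ)⁻¹) * MvPolynomial.X i ^ (e + 1) with hS
  have hSd : ∀ x i, MvPolynomial.eval x (MvPolynomial.pderiv i S) = x i ^ e := by
    intro x i
    rw [hS, map_sum, map_sum, Finset.sum_eq_single i]
    · have : (e + 1 : ℝ) ≠ 0 := by positivity
      simp
      field_simp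
    · intro b _ hb
      simp [hb]
    · simp
  obtain ⟨M, hM0, hM⟩ := MvPolynomial.exists_taylor_bound S |R|
  have hMK : ∀ x ∈ euclideanBall n R, |MvPolynomial.eval x S| ≤ M := fun x hx => by
    have : ‖x‖ ≤ |R| := norm_le_of_sum_sq_le (abs_nonneg R) (by rw [sq_abs]; exact hx)
    exact (hM x x this this).1
  have hex : ∀ j : ℕ, ∃ y ∈ euclideanBall n R, ∀ z ∈ euclideanBall n R,
      MvPolynomial.eval z (MvPolynomial.C (j + 1 : ℝ) * q - S) ≤
        MvPolynomial.eval y (MvPolynomial.C (j + 1 : ℝ) * q - S) := fun j => by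
    obtain ⟨y, hy, h⟩ := (isCompact_euclideanBall n R).exists_isMaxOn ⟨x₀, hx₀⟩
      (MvPolynomial.continuous_eval (MvPolynomial.C (j + 1 : ℝ) * q - S)).continuousOn
    exact ⟨y, hy, h⟩
  choose y hyK hymax using hex
  obtain ⟨x, hxK, φ, hφ, hlim⟩ := (isCompact_euclideanBall n R).tendsto_subseq hyK
  have hqx : Tendsto (fun j => MvPolynomial.eval (y (φ j)) q) atTop (𝓝 (MvPolynomial.eval x q)) :=
    ((MvPolynomial.continuous_eval q).tendsto x).comp hlim
  have hφt : Tendsto (fun j => ((φ j : ℝ) + 1)) atTop atTop :=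
    tendsto_atTop_add_const_right _ _ (tendsto_natCast_atTop_atTop.comp hφ.tendsto_atTop)
  have hmaxx : ∀ z ∈ euclideanBall n R, MvPolynomial.eval z q ≤ MvPolynomial.eval x q := by
    intro z hz
    have h1 : Tendsto (fun j => MvPolynomial.eval (y (φ j)) q + 2 * M * ((φ j : ℝ) + 1)⁻¹) atTop
        (𝓝 (MvPolynomial.eval x q + 2 * M * 0)) :=
      hqx.add ((tendsto_inv_atTop_zero.comp hφt).const_mul _)
    rw [mul_zero, add_zero] at h1
    refine ge_of_tendsto' h1 fun j => ?_
    have h2 := hymax (φ j) z hz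
    have h3 := abs_le.1 (hMK z hz)
    have h4 := abs_le.1 (hMK _ (hyK (φ j)))
    simp only [map_sub, map_mul, MvPolynomial.eval_C] at h2
    have hpos : (0 : ℝ) < (φ j : ℝ) + 1 := by positivity
    rw [← sub_nonneg]
    have : 0 ≤ ((φ j : ℝ) + 1) * (MvPolynomial.eval (y (φ j)) q +
        2 * M * ((φ j : ℝ) + 1)⁻¹ - MvPolynomial.eval z q) := by
      have : ((φ j : ℝ) + 1) * (MvPolynomial.eval (y (φ j)) q +
        2 * M * ((φ j : ℝ) + 1)⁻¹ - MvPolynomial.eval z q) =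
        ((φ j : ℝ) + 1) * MvPolynomial.eval (y (φ j)) q -
          ((φ j : ℝ) + 1) * MvPolynomial.eval z q + 2 * M := by
        field_simp
        ring
      rw [this]
      linarith
    exact nonneg_of_mul_nonneg_right this hpos
  have hxlt : ∑ i, x i ^ 2 < R ^ 2 := by
    refine lt_of_le_of_ne hxK fun h => ?_
    exact (hsph x h).not_ge (hmaxx x₀ hx₀)
  refine ⟨x, hxlt, hmaxx, ?_⟩
  have hev : ∀ᶠ j in atTop, ∑ i, y (φ j) i ^ 2 < R ^ 2 :=
    (((continuous_sum_sq n).tendsto x).comp hlim).eventually_lt_const hxlt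
  obtain ⟨N, hN⟩ := eventually_atTop.1 hev
  refine ⟨fun j => (φ (j + N) : ℝ) + 1, fun j => y (φ (j + N)),
    hφt.comp (tendsto_add_atTop_nat N), hlim.comp (tendsto_add_atTop_nat N), fun j i => ?_⟩
  have h := MvPolynomial.eval_pderiv_eq_zero_of_isMaxOn (hN (j + N) (by omega)) _
    (hymax (φ (j + N))) i
  rw [map_sub, map_sub, MvPolynomial.pderiv_C_mul, map_mul, MvPolynomial.eval_C, hSd, hq,
    MvPolynomial.pderiv_map, MvPolynomial.eval_map] at h
  linarith

namespace Polynomial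

theorem monotoneOn_of_derivative_nonneg (q : ℝ[X]) (a b : ℝ)
    (h : ∀ v ∈ Set.Icc a b, 0 ≤ q.derivative.eval v) :
    MonotoneOn (fun v => q.eval v) (Set.Icc a b) :=
  monotoneOn_of_deriv_nonneg (convex_Icc a b) q.continuous.continuousOn
    q.differentiable.differentiableOn fun v hv => by
      rw [q.deriv]; exact h v (interior_subset hv)

theorem sign_monotone_or_antitone (q : ℝ[X]) (a b : ℝ) (σ : SignType)
    (h : ∀ v ∈ Set.Icc a b, SignType.sign (q.derivative.eval v) = σ) :
    (0 ≤ σ → MonotoneOn (fun v => SignType.sign (q.eval v)) (Set.Icc a b)) ∧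
    (σ ≤ 0 → AntitoneOn (fun v => SignType.sign (q.eval v)) (Set.Icc a b)) := by
  constructor
  · intro hσ
    have := monotoneOn_of_derivative_nonneg q a b fun v hv => by
      have h1 := h v hv
      rw [← h1] at hσ
      exact sign_nonneg_iff.1 hσ
    exact fun x hx y hy hxy => SignType.sign.monotone (this hx hy hxy)
  · intro hσ
    have := monotoneOn_of_derivative_nonneg (-q) a b fun v hv => by
      have h1 := h v hv
      rw [← h1] at hσ
      simpa using sign_nonpos_iff.1 hσ
    refine fun x hx y hy hxy => SignType.sign.monotone ?_
    simpa using this hx hy hxy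

/-- Thom encodings: if all derivatives of `q` have the same signs at `a` and `b`, then `q` has
constant sign on `[a, b]`. -/
theorem sign_eval_eq_of_forall_sign_eq (m : ℕ) (q : ℝ[X]) (hm : q.natDegree ≤ m) (a b : ℝ)
    (h : ∀ j, SignType.sign ((derivative^[j] q).eval a) = SignType.sign ((derivative^[j] q).eval b))
    (v : ℝ) (hv : v ∈ Set.Icc a b) : SignType.sign (q.eval v) = SignType.sign (q.eval a) := by
  induction m generalizing q v with
  | zero =>
    rw [eq_C_of_natDegree_le_zero hm]
    simp
  | succ m ih =>
    have hab : a ≤ b := hv.1.trans hv.2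
    have h1 : ∀ v ∈ Set.Icc a b,
        SignType.sign (q.derivative.eval v) = SignType.sign (q.derivative.eval a) :=
      fun v hv => ih q.derivative ((natDegree_derivative_le q).trans (by omega))
        (fun j => h (j + 1)) v hv
    have h0 : SignType.sign (q.eval a) = SignType.sign (q.eval b) := h 0
    obtain ⟨hmono, hanti⟩ := sign_monotone_or_antitone q a b _ h1
    have ha : a ∈ Set.Icc a b := ⟨le_rfl, hab⟩
    have hb : b ∈ Set.Icc a b := ⟨hab, le_rfl⟩
    rcases le_total 0 (SignType.sign (q.derivative.eval a)) with hs | hs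
    · exact le_antisymm (h0 ▸ hmono hs hv hb hv.2) (hmono hs ha hv hv.1)
    · exact le_antisymm (hanti hs ha hv hv.1) (h0 ▸ hanti hs hv hb hv.2)

/-- Roots of polynomials with the same Thom encoding are ordered in the same way relative to
points at which the polynomials have the same sign vectors. -/
theorem not_lt_and_lt_of_sign_eq (q₁ q₂ : ℝ[X]) (hq₁ : q₁ ≠ 0) (s₁ s₂ v : ℝ)
    (h₁ : q₁.eval s₁ = 0)
    (hs : ∀ j, SignType.sign ((derivative^[j] q₁).eval s₁) =
      SignType.sign ((derivative^[j] q₂).eval s₂))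
    (hv : ∀ j, SignType.sign ((derivative^[j] q₁).eval v) =
      SignType.sign ((derivative^[j] q₂).eval v)) :
    (¬ (s₁ < v ∧ v < s₂)) ∧ ¬ (s₂ < v ∧ v < s₁) := by
  classical
  have hex : v ≠ s₁ → ∃ l, SignType.sign ((derivative^[l] q₁).eval s₁) ≠
      SignType.sign ((derivative^[l] q₁).eval v) := by
    intro hne
    by_contra hcon
    push Not at hcon
    have key : ∀ a b, a < b → (∀ j, SignType.sign ((derivative^[j] q₁).eval a) =
      SignType.sign ((derivative^[j] q₁).eval b)) → q₁.eval a = 0 → False := by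
      intro a b hlt hcon h0
      refine hq₁ (eq_zero_of_infinite_isRoot q₁ ((Set.Icc_infinite hlt).mono fun w hw => ?_))
      have h1 := sign_eval_eq_of_forall_sign_eq _ q₁ le_rfl a b hcon w hw
      rw [h0, sign_zero, sign_eq_zero_iff] at h1
      exact h1
    rcases lt_or_gt_of_ne hne with hlt | hlt
    · have h0 := hcon 0
      simp only [Function.iterate_zero, id] at h0
      rw [h₁, sign_zero, eq_comm, sign_eq_zero_iff] at h0
      exact key v s₁ hlt (fun j => (hcon j).symm) h0
    · exact key s₁ v hlt hcon h₁
  have hmax : v ≠ s₁ → ∃ l, SignType.sign ((derivative^[l] q₁).eval s₁) ≠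
      SignType.sign ((derivative^[l] q₁).eval v) ∧
      ∀ j, l < j → SignType.sign ((derivative^[j] q₁).eval s₁) =
      SignType.sign ((derivative^[j] q₁).eval v) := by
    intro hne
    obtain ⟨l₀, hl₀⟩ := hex hne
    set p : ℕ → Prop := fun l => SignType.sign ((derivative^[l] q₁).eval s₁) ≠
      SignType.sign ((derivative^[l] q₁).eval v) with hp
    have hb : ∀ l, q₁.natDegree < l → ¬ p l := fun l hl => by
      simp [hp, iterate_derivative_eq_zero hl]
    refine ⟨Nat.findGreatest p (q₁.natDegree), ?_, fun j hj => ?_⟩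
    · exact Nat.findGreatest_spec (P := p) (not_lt.1 fun h => hb l₀ h hl₀) hl₀
    · by_contra hcon
      by_cases hjn : q₁.natDegree < j
      · exact hb j hjn hcon
      · exact Nat.findGreatest_is_greatest hj (not_lt.1 hjn) hcon
  have hiter : ∀ (q : ℝ[X]) l j, derivative^[j] (derivative^[l + 1] q) = derivative^[l + 1 + j] q :=
    fun q l j => by rw [← Function.iterate_add_apply, add_comm]
  constructor
  · rintro ⟨hlt₁, hlt₂⟩
    obtain ⟨l, hl, hlj⟩ := hmax hlt₁.ne'
    have c₁ := fun w hw => sign_eval_eq_of_forall_sign_eq _ (derivative^[l + 1] q₁) le_rfl s₁ v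
      (fun j => by rw [hiter]; exact hlj _ (by omega)) w hw
    have c₂ := fun w hw => sign_eval_eq_of_forall_sign_eq _ (derivative^[l + 1] q₂) le_rfl v s₂
      (fun j => by rw [hiter, ← hs, ← hv]; exact (hlj _ (by omega)).symm) w hw
    rw [← hv, ← hlj (l + 1) (by omega)] at c₂
    simp only [Function.iterate_succ_apply'] at c₁ c₂
    obtain ⟨m₁, a₁⟩ := sign_monotone_or_antitone _ _ _ _ c₁
    obtain ⟨m₂, a₂⟩ := sign_monotone_or_antitone _ _ _ _ c₂
    have e1 : s₁ ∈ Set.Icc s₁ v := ⟨le_rfl, hlt₁.le⟩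
    have e2 : v ∈ Set.Icc s₁ v := ⟨hlt₁.le, le_rfl⟩
    have e3 : v ∈ Set.Icc v s₂ := ⟨le_rfl, hlt₂.le⟩
    have e4 : s₂ ∈ Set.Icc v s₂ := ⟨hlt₂.le, le_rfl⟩
    rcases le_total 0 (SignType.sign ((derivative (derivative^[l] q₁)).eval s₁)) with h | h
    · have i1 := m₁ h e1 e2 hlt₁.le
      have i2 := m₂ h e3 e4 hlt₂.le
      simp only [← hs, ← hv] at i1 i2
      exact hl (le_antisymm i1 i2)
    · have i1 := a₁ h e1 e2 hlt₁.le
      have i2 := a₂ h e3 e4 hlt₂.le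
      simp only [← hs, ← hv] at i1 i2
      exact hl (le_antisymm i2 i1)
  · rintro ⟨hlt₂, hlt₁⟩
    obtain ⟨l, hl, hlj⟩ := hmax hlt₁.ne
    have c₁ := fun w hw => sign_eval_eq_of_forall_sign_eq _ (derivative^[l + 1] q₁) le_rfl v s₁
      (fun j => by rw [hiter]; exact (hlj _ (by omega)).symm) w hw
    have c₂ := fun w hw => sign_eval_eq_of_forall_sign_eq _ (derivative^[l + 1] q₂) le_rfl s₂ v
      (fun j => by rw [hiter, ← hs, ← hv]; exact hlj _ (by omega)) w hw
    rw [← hs, hlj (l + 1) (by omega)] at c₂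
    simp only [Function.iterate_succ_apply'] at c₁ c₂
    obtain ⟨m₁, a₁⟩ := sign_monotone_or_antitone _ _ _ _ c₁
    obtain ⟨m₂, a₂⟩ := sign_monotone_or_antitone _ _ _ _ c₂
    have e1 : s₁ ∈ Set.Icc v s₁ := ⟨hlt₁.le, le_rfl⟩
    have e2 : v ∈ Set.Icc v s₁ := ⟨le_rfl, hlt₁.le⟩
    have e3 : v ∈ Set.Icc s₂ v := ⟨hlt₂.le, le_rfl⟩
    have e4 : s₂ ∈ Set.Icc s₂ v := ⟨le_rfl, hlt₂.le⟩
    rcases le_total 0 (SignType.sign ((derivative (derivative^[l] q₁)).eval v)) with h | h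
    · have i1 := m₁ h e2 e1 hlt₁.le
      have i2 := m₂ h e4 e3 hlt₂.le
      simp only [← hs, ← hv] at i1 i2
      exact hl (le_antisymm i2 i1)
    · have i1 := a₁ h e2 e1 hlt₁.le
      have i2 := a₂ h e4 e3 hlt₂.le
      simp only [← hs, ← hv] at i1 i2
      exact hl (le_antisymm i1 i2)

theorem exists_root_of_sign_ne (a : ℝ[X]) (u w : ℝ) (huw : u < w)
    (h : SignType.sign (a.eval u) ≠ SignType.sign (a.eval w)) :
    a ≠ 0 ∧ ∃ r ∈ Set.Icc u w, a.eval r = 0 := by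
  constructor
  · rintro rfl
    simp at h
  · have hc := a.continuous.continuousOn (s := Set.Icc u w)
    rcases le_or_gt (a.eval u) 0 with hu | hu
    · rcases le_or_gt 0 (a.eval w) with hw | hw
      · exact intermediate_value_Icc huw.le hc ⟨hu, hw⟩
      · rcases hu.lt_or_eq with hu | hu
        · exact absurd (by rw [sign_neg hu, sign_neg hw]) h
        · exact ⟨u, ⟨le_rfl, huw.le⟩, hu⟩
    · rcases le_or_gt (a.eval w) 0 with hw | hw
      · exact intermediate_value_Icc' huw.le hc ⟨hw, hu.le⟩
      · exact absurd (by rw [sign_pos hu, sign_pos hw]) h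

/-- The number of sign changes of a real polynomial along a monotone sequence is at most twice its
degree. -/
theorem card_sign_ne_le (a : ℝ[X]) (τ : ℕ → ℝ) (hτ : StrictAnti τ) (r : ℕ) :
    ((Finset.range r).filter fun q => SignType.sign (a.eval (τ q)) ≠
      SignType.sign (a.eval (τ (q + 1)))).card ≤ 2 * a.natDegree := by
  classical
  set c : ℝ → ℕ := fun t => (a.roots.toFinset.filter (· < t)).card +
    (a.roots.toFinset.filter (· ≤ t)).card with hc
  have hmono : ∀ u w, u < w → c u ≤ c w := fun u w huw =>
    add_le_add (Finset.card_le_card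
        (Finset.monotone_filter_right _ fun x _ hx => (hx : x < u).trans huw))
      (Finset.card_le_card (Finset.monotone_filter_right _ fun x _ hx => (hx : x ≤ u).trans huw.le))
  have hstrict : ∀ u w, u < w → SignType.sign (a.eval u) ≠ SignType.sign (a.eval w) →
      c u + 1 ≤ c w := by
    intro u w huw h
    obtain ⟨ha, r, ⟨hr1, hr2⟩, hr⟩ := exists_root_of_sign_ne a u w huw h
    have hmem : r ∈ a.roots.toFinset := by
      rw [Multiset.mem_toFinset, mem_roots ha]; exact hr
    rcases hr2.lt_or_eq with hr2 | rfl
    · have h1 : (a.roots.toFinset.filter (· < u)).card <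
          (a.roots.toFinset.filter (· < w)).card := by
        refine Finset.card_lt_card (Finset.ssubset_iff_of_subset
          (Finset.monotone_filter_right _ fun x _ hx => (hx : x < u).trans huw) |>.2 ⟨r, ?_, ?_⟩)
        · simpa using ⟨by simpa using hmem, hr2⟩
        · simp [not_lt.2 hr1]
      have h2 : (a.roots.toFinset.filter (· ≤ u)).card ≤ (a.roots.toFinset.filter (· ≤ w)).card :=
        Finset.card_le_card (Finset.monotone_filter_right _ fun x _ hx => (hx : x ≤ u).trans huw.le)
      simp only [hc]; omega
    · have h1 : (a.roots.toFinset.filter (· ≤ u)).card <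
          (a.roots.toFinset.filter (· ≤ r)).card := by
        refine Finset.card_lt_card (Finset.ssubset_iff_of_subset
          (Finset.monotone_filter_right _ fun x _ hx => (hx : x ≤ u).trans huw.le) |>.2 ⟨r, ?_, ?_⟩)
        · simpa using hmem
        · simp [huw]
      have h2 : (a.roots.toFinset.filter (· < u)).card ≤ (a.roots.toFinset.filter (· < r)).card :=
        Finset.card_le_card (Finset.monotone_filter_right _ fun x _ hx => (hx : x < u).trans huw)
      simp only [hc]; omega
  have hind : ((Finset.range r).filter fun q => SignType.sign (a.eval (τ q)) ≠
      SignType.sign (a.eval (τ (q + 1)))).card + c (τ r) ≤ c (τ 0) := by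
    induction r with
    | zero => simp
    | succ r ih =>
      rw [Finset.range_add_one, Finset.filter_insert]
      split_ifs with h
      · rw [Finset.card_insert_of_notMem (by simp)]
        have := hstrict _ _ (hτ (Nat.lt_add_one r)) (Ne.symm h)
        omega
      · have := hmono _ _ (hτ (Nat.lt_add_one r))
        omega
  have hle : c (τ 0) ≤ 2 * a.natDegree := by
    have h1 : a.roots.toFinset.card ≤ a.natDegree :=
      (Multiset.toFinset_card_le _).trans (card_roots' a)
    have h2 := Finset.card_filter_le a.roots.toFinset (· < τ 0)
    have h3 := Finset.card_filter_le a.roots.toFinset (· ≤ τ 0)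
    simp only [hc]
    omega
  omega

end Polynomial

namespace Polynomial

theorem iterate_derivative_eval_map (G : ℝ[X][X]) (l : ℕ) (t v : ℝ) :
    (derivative^[l] (G.map (evalRingHom t))).eval v = ((derivative^[l] G).eval (C v)).eval t := by
  rw [iterate_derivative_map, eval_map, eval₂_eq_sum_range,
    eval_eq_sum_range (p := derivative^[l] G), eval_finsetSum]
  simp

theorem exists_natDegree_eval_C_le (Q : ℝ[X][X]) : ∃ D, ∀ v, (Q.eval (C v)).natDegree ≤ D := by
  refine ⟨(Finset.range (Q.natDegree + 1)).sup fun k => (Q.coeff k).natDegree, fun v => ?_⟩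
  rw [eval_eq_sum_range]
  refine natDegree_sum_le_of_forall_le _ _ fun k hk => ?_
  rw [← C_pow]
  exact (natDegree_mul_C_le _ _).trans
    (Finset.le_sup (f := fun k => (Q.coeff k).natDegree) hk)

theorem sum_abs_sub_le_of_card_le (s : ℕ → ℝ) (R : ℝ) (hs : ∀ q, |s q| ≤ R) (c r : ℕ)
    (h : ∀ v, ((Finset.range r).filter fun q => v ∈ Set.Ioo (min (s q) (s (q + 1)))
      (max (s q) (s (q + 1)))).card ≤ c) :
    ∑ q ∈ Finset.range r, |s (q + 1) - s q| ≤ c * (2 * R) := by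
  classical
  have hR : 0 ≤ R := (abs_nonneg _).trans (hs 0)
  set I : ℕ → Set ℝ := fun q => Set.Ioo (min (s q) (s (q + 1))) (max (s q) (s (q + 1))) with hI
  have hIm : ∀ q, MeasurableSet (I q) := fun q => measurableSet_Ioo
  have hIv : ∀ q, MeasureTheory.volume (I q) = ENNReal.ofReal |s (q + 1) - s q| := fun q => by
    rw [hI, Real.volume_Ioo, max_sub_min_eq_abs]
  have hsub : ∀ q, I q ⊆ Set.Icc (-R) R := fun q v hv => by
    have h1 := abs_le.1 (hs q)
    have h2 := abs_le.1 (hs (q + 1))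
    exact ⟨(le_min h1.1 h2.1).trans hv.1.le, hv.2.le.trans (max_le h1.2 h2.2)⟩
  have key : ∑ q ∈ Finset.range r, ENNReal.ofReal |s (q + 1) - s q| ≤
      (c : ENNReal) * ENNReal.ofReal (R - -R) := by
    calc _ = ∑ q ∈ Finset.range r, ∫⁻ v, (I q).indicator 1 v := by
          refine Finset.sum_congr rfl fun q _ => ?_
          rw [MeasureTheory.lintegral_indicator_one (hIm q), hIv]
      _ = ∫⁻ v, ∑ q ∈ Finset.range r, (I q).indicator 1 v :=
          (MeasureTheory.lintegral_finsetSum _ fun q _ =>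
            (measurable_one.indicator (hIm q))).symm
      _ ≤ ∫⁻ v, (Set.Icc (-R) R).indicator (fun _ => (c : ENNReal)) v := by
          refine MeasureTheory.lintegral_mono fun v => ?_
          by_cases hv : v ∈ Set.Icc (-R) R
          · rw [Set.indicator_of_mem hv]
            simp only [Set.indicator_apply, Pi.one_apply]
            rw [← Finset.sum_filter, Finset.sum_const, nsmul_eq_mul, mul_one]
            exact_mod_cast h v
          · rw [Set.indicator_of_notMem hv]
            refine (Finset.sum_eq_zero fun q _ => ?_).le
            exact Set.indicator_of_notMem (fun hq => hv (hsub q hq)) _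
      _ = _ := by
          rw [MeasureTheory.lintegral_indicator_const measurableSet_Icc, Real.volume_Icc]
  rw [← ENNReal.ofReal_sum_of_nonneg (fun _ _ => abs_nonneg _), ← ENNReal.ofReal_natCast,
    ← ENNReal.ofReal_mul (Nat.cast_nonneg c)] at key
  have := (ENNReal.ofReal_le_ofReal_iff
    (mul_nonneg (Nat.cast_nonneg c) (by linarith))).1 key
  linarith

/-- Bounded roots of a one-parameter family of polynomials, taken along a monotone sequence of
parameters and having the same Thom encoding, form a sequence of bounded variation. -/
theorem exists_sum_abs_sub_le_of_sign_eq (G : ℝ[X][X]) (N : ℕ) (hN : G.natDegree ≤ N)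
    (R : ℝ) : ∃ V, ∀ (τ s : ℕ → ℝ), StrictAnti τ → (∀ q, G.map (evalRingHom (τ q)) ≠ 0) →
      (∀ q, (G.map (evalRingHom (τ q))).eval (s q) = 0) → (∀ q, |s q| ≤ R) →
      (∀ q q', ∀ l ≤ N, SignType.sign ((derivative^[l] (G.map (evalRingHom (τ q)))).eval (s q)) =
        SignType.sign ((derivative^[l] (G.map (evalRingHom (τ q')))).eval (s q'))) →
      ∀ r, ∑ q ∈ Finset.range r, |s (q + 1) - s q| ≤ V := by
  classical
  choose D hD using fun l => exists_natDegree_eval_C_le (derivative^[l] G)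
  refine ⟨((∑ l ∈ Finset.range (N + 1), 2 * D l : ℕ) : ℝ) * (2 * R), ?_⟩
  intro τ s hτ hne h0 hR hcode r
  refine sum_abs_sub_le_of_card_le s R hR _ r fun v => ?_
  set A : ℕ → Finset ℕ := fun l => (Finset.range r).filter fun q =>
    SignType.sign (((derivative^[l] G).eval (C v)).eval (τ q)) ≠
      SignType.sign (((derivative^[l] G).eval (C v)).eval (τ (q + 1))) with hA
  have hhigh : ∀ t v l, N < l → (derivative^[l] (G.map (evalRingHom t))).eval v = 0 := by
    intro t v l hl
    rw [iterate_derivative_eq_zero ((natDegree_map_le).trans_lt (hN.trans_lt hl)), eval_zero]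
  have hsub : ((Finset.range r).filter fun q => v ∈ Set.Ioo (min (s q) (s (q + 1)))
      (max (s q) (s (q + 1)))) ⊆ (Finset.range (N + 1)).biUnion A := by
    intro q hq
    obtain ⟨hqr, hv⟩ := Finset.mem_filter.1 hq
    by_contra hcon
    have hsame : ∀ l, SignType.sign ((derivative^[l] (G.map (evalRingHom (τ q)))).eval v) =
        SignType.sign ((derivative^[l] (G.map (evalRingHom (τ (q + 1))))).eval v) := by
      intro l
      by_cases hl : N < l
      · rw [hhigh _ _ _ hl, hhigh _ _ _ hl]
      · by_contra hne
        refine hcon (Finset.mem_biUnion.2 ⟨l, Finset.mem_range.2 (by omega), ?_⟩)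
        rw [iterate_derivative_eval_map, iterate_derivative_eval_map] at hne
        exact Finset.mem_filter.2 ⟨hqr, hne⟩
    have hs : ∀ l, SignType.sign ((derivative^[l] (G.map (evalRingHom (τ q)))).eval (s q)) =
        SignType.sign ((derivative^[l] (G.map (evalRingHom (τ (q + 1))))).eval (s (q + 1))) := by
      intro l
      by_cases hl : N < l
      · rw [hhigh _ _ _ hl, hhigh _ _ _ hl]
      · exact hcode _ _ l (not_lt.1 hl)
    obtain ⟨n1, n2⟩ := not_lt_and_lt_of_sign_eq _ _ (hne q) (s q) (s (q + 1)) v (h0 q) hs hsame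
    rcases le_total (s q) (s (q + 1)) with hle | hle
    · rw [min_eq_left hle, max_eq_right hle] at hv
      exact n1 hv
    · rw [min_eq_right hle, max_eq_left hle] at hv
      exact n2 hv
  refine (Finset.card_le_card hsub).trans (Finset.card_biUnion_le.trans ?_)
  refine Finset.sum_le_sum fun l _ => ?_
  exact (card_sign_ne_le _ τ hτ r).trans (Nat.mul_le_mul_left _ (hD l v))

end Polynomial

namespace Polynomial

theorem eventually_eval_ne_zero (a : ℝ[X]) (ha : a ≠ 0) : ∀ᶠ t in 𝓝[>] (0 : ℝ), a.eval t ≠ 0 := by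
  have hfin : {t | a.eval t = 0}.Finite := by
    have := a.roots.toFinset.finite_toSet
    refine this.subset fun t ht => ?_
    simpa [ha] using ht
  have h1 : ({t | a.eval t = 0} \ {0})ᶜ ∈ 𝓝 (0 : ℝ) :=
    (hfin.subset Set.sdiff_subset).isClosed.isOpen_compl.mem_nhds (by simp)
  filter_upwards [mem_nhdsWithin_of_mem_nhds h1, self_mem_nhdsWithin] with t ht ht0 h
  exact ht ⟨h, (ne_of_gt ht0 : t ≠ 0)⟩

theorem eventually_map_evalRingHom_ne_zero (G : ℝ[X][X]) (hG : G ≠ 0) :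
    ∀ᶠ t in 𝓝[>] (0 : ℝ), G.map (evalRingHom t) ≠ 0 := by
  filter_upwards [eventually_eval_ne_zero G.leadingCoeff (leadingCoeff_ne_zero.2 hG)] with t ht h
  apply ht
  have := congrArg (fun q => q.coeff G.natDegree) h
  simpa using this

theorem contDiff_eval_map (G : ℝ[X][X]) :
    ContDiff ℝ 1 fun z : ℝ × ℝ => (G.map (evalRingHom z.1)).eval z.2 := by
  have : (fun z : ℝ × ℝ => (G.map (evalRingHom z.1)).eval z.2) = fun z : ℝ × ℝ =>
      ∑ k ∈ Finset.range (G.natDegree + 1), (G.coeff k).eval z.1 * z.2 ^ k := by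
    ext z
    rw [eval_map, eval₂_eq_sum_range]
    simp
  rw [this]
  refine ContDiff.sum fun k _ => ?_
  have h1 : ContDiff ℝ 1 fun t => (G.coeff k).eval t := by
    simpa using (G.coeff k).contDiff_aeval (𝕜 := ℝ) 1
  exact (h1.comp contDiff_fst).mul (contDiff_snd.pow k)

/-- A continuous solution of a polynomial equation in one parameter is, near `0⁺`, either
identically zero or nowhere zero. -/
theorem eventually_eq_zero_or_ne_zero (H : ℝ[X][X]) (hH : H ≠ 0) (b : ℝ → ℝ)
    (hb : ∀ᶠ t in 𝓝[>] (0 : ℝ), ContinuousAt b t ∧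
      (b t ≠ 0 → (H.map (evalRingHom t)).eval (b t) = 0)) :
    (∀ᶠ t in 𝓝[>] (0 : ℝ), b t = 0) ∨ ∀ᶠ t in 𝓝[>] (0 : ℝ), b t ≠ 0 := by
  obtain ⟨H₁, hH₁, hdvd⟩ := exists_eq_pow_rootMultiplicity_mul_and_not_dvd H hH 0
  rw [C_0, sub_zero] at hH₁ hdvd
  have hc : H₁.coeff 0 ≠ 0 := fun h => hdvd (X_dvd_iff.2 h)
  have hall := hb.and (eventually_eval_ne_zero _ hc)
  obtain ⟨ε, hε, hsub⟩ := mem_nhdsGT_iff_exists_Ioo_subset.1 hall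
  have hε : (0 : ℝ) < ε := hε
  have hmem : Set.Ioo 0 ε ∈ 𝓝[>] (0 : ℝ) := Ioo_mem_nhdsGT hε
  set q : ℝ → ℝ := fun t => (H₁.map (evalRingHom t)).eval (b t) with hq
  have hqc : ∀ t ∈ Set.Ioo 0 ε, ContinuousAt q t := fun t ht => by
    have h1 := (contDiff_eval_map H₁).continuous.continuousAt (x := (t, b t))
    exact ContinuousAt.comp (f := fun t => (t, b t)) h1 (continuousAt_id.prodMk (hsub ht).1.1)
  have hu : IsOpen {t | t ∈ Set.Ioo 0 ε ∧ q t ≠ 0} := by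
    rw [isOpen_iff_mem_nhds]
    rintro t ⟨ht, h⟩
    exact (isOpen_Ioo.mem_nhds ht |> eventually_mem_set.2).and ((hqc t ht).eventually_ne h)
  have hv : IsOpen {t | t ∈ Set.Ioo 0 ε ∧ b t ≠ 0} := by
    rw [isOpen_iff_mem_nhds]
    rintro t ⟨ht, h⟩
    exact (isOpen_Ioo.mem_nhds ht |> eventually_mem_set.2).and ((hsub ht).1.1.eventually_ne h)
  have hdis : ∀ t ∈ Set.Ioo 0 ε, b t ≠ 0 → q t = 0 := by
    intro t ht h
    have h1 := (hsub ht).1.2 h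
    rw [hH₁, Polynomial.map_mul, eval_mul, Polynomial.map_pow, map_X, eval_pow, eval_X] at h1
    exact (mul_eq_zero.1 h1).resolve_left (pow_ne_zero _ h)
  rcases (isPreconnected_Ioo (a := (0 : ℝ)) (b := ε)).subset_or_subset hu hv
    (Set.disjoint_left.2 fun t h1 h2 => h1.2 (hdis t h1.1 h2.2)) (fun t ht => by
      by_cases h : b t = 0
      · refine Or.inl ⟨ht, ?_⟩
        have h2 := (hsub ht).2
        simp only [hq, h]
        rwa [← coeff_zero_eq_eval_zero, coeff_map]
      · exact Or.inr ⟨ht, h⟩) with h | h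
  · left
    filter_upwards [hmem] with t ht
    by_contra hcon
    exact (h ht).2 (hdis t ht hcon)
  · right
    filter_upwards [hmem] with t ht
    exact (h ht).2

theorem exists_hasDerivAt_of_lipschitz (Q : ℝ[X][X]) (μ : ℝ → ℝ) (ε L : ℝ)
    (hL : ∀ t ∈ Set.Ioo 0 ε, ∀ t' ∈ Set.Ioo 0 ε, |μ t' - μ t| ≤ L * |t' - t|)
    (h0 : ∀ t ∈ Set.Ioo 0 ε, (Q.map (evalRingHom t)).eval (μ t) = 0)
    (h1 : ∀ t ∈ Set.Ioo 0 ε, (Q.derivative.map (evalRingHom t)).eval (μ t) ≠ 0) :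
    ∃ m : ℝ → ℝ, ContinuousOn m (Set.Ioo 0 ε) ∧ ∀ t ∈ Set.Ioo 0 ε, HasDerivAt μ (m t) t := by
  set q : ℝ × ℝ → ℝ := fun z => (Q.map (evalRingHom z.1)).eval z.2 with hq
  have hqd := contDiff_eval_map Q
  have hfd : ∀ z, HasFDerivAt q (fderiv ℝ q z) z := fun z =>
    (hqd.differentiable one_ne_zero z).hasFDerivAt
  have hs : ∀ t s, fderiv ℝ q (t, s) (0, 1) = (Q.derivative.map (evalRingHom t)).eval s := by
    intro t s
    have e1 : HasDerivAt (fun r => q (t, r)) (fderiv ℝ q (t, s) (0, 1)) s :=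
      (hfd (t, s)).comp_hasDerivAt s ((hasDerivAt_const s t).prodMk (hasDerivAt_id s))
    have e2 : HasDerivAt (fun r => q (t, r)) ((Q.map (evalRingHom t)).derivative.eval s) s :=
      (Q.map (evalRingHom t)).hasDerivAt s
    rw [e1.unique e2, derivative_map]
  have hLc : ∀ t ∈ Set.Ioo 0 ε, (fun t' => μ t' - μ t) =O[𝓝 t] fun t' => t' - t := by
    intro t ht
    refine Asymptotics.IsBigO.of_bound L ?_
    filter_upwards [isOpen_Ioo.mem_nhds ht] with t' ht'
    simpa using hL t ht t' ht'
  have hμc : ∀ t ∈ Set.Ioo 0 ε, ContinuousAt μ t := by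
    intro t ht
    have e1 : Tendsto (fun t' => t' - t) (𝓝 t) (𝓝 0) := by
      have : ContinuousAt (fun t' : ℝ => t' - t) t := by fun_prop
      simpa [ContinuousAt] using this
    have e2 := (hLc t ht).trans_tendsto e1
    exact tendsto_sub_nhds_zero_iff.1 e2
  refine ⟨fun t => -(fderiv ℝ q (t, μ t) (1, 0) / fderiv ℝ q (t, μ t) (0, 1)), ?_, ?_⟩
  · have hcf : Continuous (fderiv ℝ q) := hqd.continuous_fderiv one_ne_zero
    have hz : ContinuousOn (fun t => fderiv ℝ q (t, μ t)) (Set.Ioo 0 ε) := fun t ht =>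
      (ContinuousAt.comp (f := fun t => (t, μ t)) hcf.continuousAt
        (continuousAt_id.prodMk (hμc t ht))).continuousWithinAt
    refine (ContinuousOn.div (hz.clm_apply continuousOn_const) (hz.clm_apply continuousOn_const)
      fun t ht => ?_).neg
    rw [hs]
    exact h1 t ht
  · intro t ht
    rw [hasDerivAt_iff_isLittleO]
    set a := fderiv ℝ q (t, μ t) (1, 0) with ha
    set b := fderiv ℝ q (t, μ t) (0, 1) with hb
    have hb0 : b ≠ 0 := by rw [hb, hs]; exact h1 t ht
    have e1 := (hfd (t, μ t)).isLittleO
    have e2 : Tendsto (fun t' => (t', μ t')) (𝓝 t) (𝓝 (t, μ t)) :=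
      (continuousAt_id.prodMk (hμc t ht))
    have e3 := e1.comp_tendsto e2
    have e4 : (fun t' => (t', μ t') - (t, μ t)) =O[𝓝 t] fun t' => t' - t := by
      simp only [Prod.mk_sub_mk]
      exact (Asymptotics.isBigO_refl _ _).prod_left (hLc t ht)
    have e5 := (e3.trans_isBigO e4).const_mul_left (-b⁻¹)
    refine e5.congr' ?_ EventuallyEq.rfl
    filter_upwards [isOpen_Ioo.mem_nhds ht] with t' ht'
    have z1 : q (t', μ t') = 0 := h0 t' ht'
    have z2 : q (t, μ t) = 0 := h0 t ht
    have z3 : fderiv ℝ q (t, μ t) ((t', μ t') - (t, μ t)) = (t' - t) * a + (μ t' - μ t) * b := by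
      have : ((t', μ t') - (t, μ t) : ℝ × ℝ) =
          (t' - t) • ((1 : ℝ), (0 : ℝ)) + (μ t' - μ t) • ((0 : ℝ), (1 : ℝ)) := by
        ext <;> simp
      rw [this, map_add, map_smul, map_smul]
      rfl
    simp only [Function.comp_apply, z1, z2, z3, smul_eq_mul, ← ha, ← hb]
    field_simp
    ring

end Polynomial

/-- The squared Euclidean norm of the gradient of a polynomial. -/
noncomputable def MvPolynomial.sqGrad {n : ℕ} (P : MvPolynomial (Fin n) ℝ) :
    MvPolynomial (Fin n) ℝ := ∑ i, pderiv i P ^ 2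

theorem MvPolynomial.eval_sqGrad {n : ℕ} (P : MvPolynomial (Fin n) ℝ) (x : Fin n → ℝ) :
    eval x P.sqGrad = ∑ i, eval x (pderiv i P) ^ 2 := by
  simp [sqGrad]

theorem MvPolynomial.eval_sqGrad_nonneg {n : ℕ} (P : MvPolynomial (Fin n) ℝ) (x : Fin n → ℝ) :
    0 ≤ eval x P.sqGrad := by
  rw [eval_sqGrad]
  positivity

theorem MvPolynomial.hom_eval₂_polynomial {n : ℕ} (H : Polynomial (Polynomial ℝ))
    (F : MvPolynomial (Fin n) (Polynomial ℝ)) (t : ℝ) (x : Fin n → ℝ) :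
    (H.eval₂ C F).eval₂ (Polynomial.evalRingHom t) x =
      (H.map (Polynomial.evalRingHom t)).eval (F.eval₂ (Polynomial.evalRingHom t) x) := by
  rw [Polynomial.eval_map, ← coe_eval₂Hom, Polynomial.hom_eval₂]
  congr 1
  ext <;> simp

/-- If `b t` is the value at `x t` of a polynomial and `x t` is a limit of perturbed critical
points, then `b` is eventually zero or eventually nonzero. -/
theorem PerturbedCritical.eventually_eq_zero_or_ne_zero {n : ℕ}
    (Φ h : MvPolynomial (Fin n) (Polynomial ℝ)) (x : ℝ → Fin n → ℝ) (b : ℝ → ℝ)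
    (hb : ∀ᶠ t in 𝓝[>] (0 : ℝ), ContinuousAt b t ∧
      (b t ≠ 0 → PerturbedCritical Φ (Φ.totalDegree + 1) t (x t) ∧
        b t = h.eval₂ (Polynomial.evalRingHom t) (x t))) :
    (∀ᶠ t in 𝓝[>] (0 : ℝ), b t = 0) ∨ ∀ᶠ t in 𝓝[>] (0 : ℝ), b t ≠ 0 := by
  obtain ⟨G, hG, -, hGe⟩ := PerturbedCritical.exists_polynomial Φ (Φ.totalDegree + 1)
    (by omega) (by omega) h
  refine Polynomial.eventually_eq_zero_or_ne_zero G hG b ?_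
  filter_upwards [hb] with t ht
  refine ⟨ht.1, fun h0 => ?_⟩
  rw [(ht.2 h0).2]
  exact hGe t _ (ht.2 h0).1

theorem MvPolynomial.exists_curve_of_small_gradient {n : ℕ} (P : MvPolynomial (Fin n) ℝ) (R C : ℝ)
    (hP : ∀ x : Fin n → ℝ, ∑ i, x i ^ 2 = R ^ 2 → eval x P = 0)
    (hC : ∀ η > 0, ∃ x ∈ euclideanBall n R, 0 < eval x P ∧ eval x P < η ∧
      eval x P.sqGrad ≤ C * eval x P ^ 2) :
    ∃ (C₁ ε : ℝ) (x : ℝ → Fin n → ℝ) (G : Fin n → Polynomial (Polynomial ℝ)), 0 < ε ∧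
      ContinuousOn (fun t => eval (x t) P) (Set.Ioo 0 ε) ∧
      (∀ t ∈ Set.Ioo 0 ε, ∀ t' ∈ Set.Ioo 0 ε, eval (x t) P < eval (x t') P → t < t') ∧
      ∀ t ∈ Set.Ioo 0 ε, x t ∈ euclideanBall n R ∧ t / 2 ≤ eval (x t) P ∧
        eval (x t) P ≤ 3 * t / 2 ∧ eval (x t) P.sqGrad ≤ C₁ * t ^ 2 ∧
        ∀ i, (G i).map (Polynomial.evalRingHom t) ≠ 0 ∧
          ((G i).map (Polynomial.evalRingHom t)).eval (x t i) = 0 := by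
  classical
  set D : ℝ := |C| + 1 with hD
  have hD0 : 0 < D := by positivity
  have hCD : C < D := by have := le_abs_self C; linarith
  set A : ℝ := 4 * D with hA
  have hA0 : 0 < A := by positivity
  set F : MvPolynomial (Fin n) (Polynomial ℝ) := map Polynomial.C P.sqGrad +
    MvPolynomial.C (Polynomial.C A) * (map Polynomial.C P - MvPolynomial.C Polynomial.X) ^ 2 with hF
  have hcomp : ∀ t : ℝ, (Polynomial.evalRingHom t).comp Polynomial.C = RingHom.id ℝ := by
    intro t; ext; simp
  have hFe : ∀ t x, F.eval₂ (Polynomial.evalRingHom t) x =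
      eval x P.sqGrad + A * (eval x P - t) ^ 2 := by
    intro t x
    rw [hF]
    simp only [eval₂_add, eval₂_mul, eval₂_pow, eval₂_sub, eval₂_C, eval₂_map, hcomp, eval₂_id]
    simp
  have hex : ∀ t, ∃ x ∈ euclideanBall n R, (∀ z ∈ euclideanBall n R,
      F.eval₂ (Polynomial.evalRingHom t) x ≤ F.eval₂ (Polynomial.evalRingHom t) z) ∧
      (F.eval₂ (Polynomial.evalRingHom t) x < A * t ^ 2 →
        PerturbedCritical (-F) ((-F).totalDegree + 1) t x) := by
    intro t
    have hne : (euclideanBall n R).Nonempty := ⟨0, by simp [euclideanBall]; positivity⟩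
    obtain ⟨x, hx, hmin⟩ := (isCompact_euclideanBall n R).exists_isMinOn hne
      (continuous_eval₂_real (Polynomial.evalRingHom t) F).continuousOn
    by_cases hlt : F.eval₂ (Polynomial.evalRingHom t) x < A * t ^ 2
    · obtain ⟨y, hy, hmax, hpc⟩ := PerturbedCritical.exists_of_isMax (-F)
        ((-F).totalDegree + 1) t R x hx (fun z hz => by
          rw [eval₂_neg, eval₂_neg, neg_lt_neg_iff]
          refine hlt.trans_le ?_
          rw [hFe, hP z hz]
          have := eval_sqGrad_nonneg P z
          nlinarith)
      refine ⟨y, hy.le, fun z hz => ?_, fun _ => hpc⟩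
      have := hmax z hz
      rwa [eval₂_neg, eval₂_neg, neg_le_neg_iff] at this
    · exact ⟨x, hx, hmin, fun h => absurd h hlt⟩
  choose x hxK hxmin hxpc using hex
  set μ : ℝ → ℝ := fun t => F.eval₂ (Polynomial.evalRingHom t) (x t) with hμ
  obtain ⟨B, hB0, hB⟩ := exists_taylor_bound P |R|
  have hPB : ∀ z ∈ euclideanBall n R, |eval z P| ≤ B := fun z hz => by
    have : ‖z‖ ≤ |R| := norm_le_of_sum_sq_le (abs_nonneg R) (by rw [sq_abs]; exact hz)
    exact (hB z z this this).1
  have hlip1 : ∀ t ∈ Set.Ioo (0 : ℝ) 1, ∀ t' ∈ Set.Ioo (0 : ℝ) 1,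
      μ t' - μ t ≤ A * (2 + 2 * B) * |t' - t| := by
    intro t ht t' ht'
    have h1 := hxmin t' (x t) (hxK t)
    have h2 : μ t' - μ t ≤ A * ((t' - t) * (t' + t - 2 * eval (x t) P)) := by
      simp only [hμ]
      rw [hFe t (x t)]
      rw [hFe t' (x t)] at h1
      nlinarith
    refine h2.trans ?_
    rw [mul_assoc A]
    refine mul_le_mul_of_nonneg_left ?_ hA0.le
    refine (le_abs_self _).trans ?_
    rw [abs_mul, mul_comm]
    refine mul_le_mul_of_nonneg_right ?_ (abs_nonneg _)
    have h3 := abs_le.1 (hPB _ (hxK t))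
    rw [abs_le]
    constructor <;> linarith [ht.1, ht.2, ht'.1, ht'.2]
  have hlip : ∀ t ∈ Set.Ioo (0 : ℝ) 1, ∀ t' ∈ Set.Ioo (0 : ℝ) 1,
      |μ t' - μ t| ≤ A * (2 + 2 * B) * |t' - t| := by
    intro t ht t' ht'
    rw [abs_le]
    have h1 := hlip1 t ht t' ht'
    have h2 := hlip1 t' ht' t ht
    rw [abs_sub_comm] at h2
    constructor <;> linarith
  have hμc : ∀ t ∈ Set.Ioo (0 : ℝ) 1, ContinuousAt μ t := by
    intro t ht
    have e1 : Tendsto (fun t' => A * (2 + 2 * B) * |t' - t|) (𝓝 t) (𝓝 0) := by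
      have : ContinuousAt (fun t' : ℝ => A * (2 + 2 * B) * |t' - t|) t := by fun_prop
      simpa [ContinuousAt] using this
    refine tendsto_iff_norm_sub_tendsto_zero.2 (squeeze_zero' (by simp) ?_ e1)
    filter_upwards [isOpen_Ioo.mem_nhds ht] with t' ht'
    exact hlip t ht t' ht'
  have h01 : Set.Ioo (0 : ℝ) 1 ∈ 𝓝[>] (0 : ℝ) := Ioo_mem_nhdsGT one_pos
  have hμlt : ∀ᶠ t in 𝓝[>] (0 : ℝ), μ t < D * t ^ 2 := by
    rcases PerturbedCritical.eventually_eq_zero_or_ne_zero (-F)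
      (F - MvPolynomial.C (Polynomial.C D * Polynomial.X ^ 2)) x
      (fun t => min (μ t - D * t ^ 2) 0) (by
        filter_upwards [h01] with t ht
        refine ⟨?_, fun h0 => ?_⟩
        · have := hμc t ht
          fun_prop
        · have hneg : μ t - D * t ^ 2 < 0 := by
            by_contra hcon
            exact h0 (min_eq_right (not_lt.1 hcon))
          refine ⟨hxpc t ?_, ?_⟩
          · have := sq_nonneg t
            change μ t < _
            nlinarith
          · rw [min_eq_left hneg.le, eval₂_sub, eval₂_C]
            simp [hμ]) with h | h
    · exfalso
      obtain ⟨ε, hε, hsub⟩ := mem_nhdsGT_iff_exists_Ioo_subset.1 h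
      obtain ⟨z, hz, hz0, hzε, hzg⟩ := hC ε hε
      have h1 : min (μ (eval z P) - D * eval z P ^ 2) 0 = 0 := hsub ⟨hz0, hzε⟩
      have h2 : μ (eval z P) ≤ C * eval z P ^ 2 := by
        refine (hxmin (eval z P) z hz).trans ?_
        rw [hFe]
        simpa using hzg
      have h3 := min_eq_right_iff.1 h1
      have : 0 < eval z P ^ 2 := by positivity
      nlinarith
    · filter_upwards [h] with t ht
      by_contra hcon
      exact ht (min_eq_right (by linarith))
  have hpc : ∀ᶠ t in 𝓝[>] (0 : ℝ), PerturbedCritical (-F) ((-F).totalDegree + 1) t (x t) := by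
    filter_upwards [hμlt] with t ht
    refine hxpc t (ht.trans_le ?_)
    have := sq_nonneg t
    nlinarith
  have hdeg1 : 1 ≤ (-F).totalDegree + 1 := by omega
  obtain ⟨H, hH, -, hHe⟩ := PerturbedCritical.exists_polynomial (-F) ((-F).totalDegree + 1)
    (by omega) hdeg1 F
  have hHμ : ∀ᶠ t in 𝓝[>] (0 : ℝ), (H.map (Polynomial.evalRingHom t)).eval (μ t) = 0 :=
    hpc.mono fun t ht => hHe t _ ht
  choose G hG hGd hGe using fun i : Fin n => PerturbedCritical.exists_polynomial (-F)
    ((-F).totalDegree + 1) (by omega) hdeg1 (X i)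
  -- choice of a derivative of `H` for which `μ` is a simple root
  have hdich : ∀ l, (∀ᶠ t in 𝓝[>] (0 : ℝ),
      (((Polynomial.derivative^[l] H).map (Polynomial.evalRingHom t)).eval (μ t) = 0)) ∨
      ∀ᶠ t in 𝓝[>] (0 : ℝ),
      (((Polynomial.derivative^[l] H).map (Polynomial.evalRingHom t)).eval (μ t) ≠ 0) := by
    intro l
    refine PerturbedCritical.eventually_eq_zero_or_ne_zero (-F)
      ((Polynomial.derivative^[l] H).eval₂ MvPolynomial.C F) x _ ?_
    filter_upwards [h01, hpc] with t ht hpct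
    refine ⟨?_, fun _ => ⟨hpct, ?_⟩⟩
    · have h1 :=
        (Polynomial.contDiff_eval_map (Polynomial.derivative^[l] H)).continuous.continuousAt
        (x := (t, μ t))
      exact ContinuousAt.comp (f := fun t => (t, μ t)) h1 (continuousAt_id.prodMk (hμc t ht))
    · rw [hom_eval₂_polynomial]
  have hlast : ¬ ∀ᶠ t in 𝓝[>] (0 : ℝ),
      (((Polynomial.derivative^[H.natDegree] H).map (Polynomial.evalRingHom t)).eval (μ t) =
        0) := by
    intro hcon
    have h1 : Polynomial.derivative^[H.natDegree] H =
        Polynomial.C (H.natDegree.factorial • H.leadingCoeff) := by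
      rw [Polynomial.eq_C_of_natDegree_le_zero (p := Polynomial.derivative^[H.natDegree] H)
        ((Polynomial.natDegree_iterate_derivative _ _).trans (by omega)),
        Polynomial.coeff_iterate_derivative]
      simp [Nat.descFactorial_self]
    have h2 := Polynomial.eventually_eval_ne_zero (H.natDegree.factorial • H.leadingCoeff) (by
      rw [nsmul_eq_mul]
      exact mul_ne_zero (Nat.cast_ne_zero.2 (Nat.factorial_ne_zero _))
        (Polynomial.leadingCoeff_ne_zero.2 hH))
    obtain ⟨t, ht1, ht2⟩ := (hcon.and h2).exists
    rw [h1, Polynomial.map_C, Polynomial.eval_C] at ht1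
    exact ht2 ht1
  obtain ⟨l, hl0, hl1⟩ : ∃ l, (∀ᶠ t in 𝓝[>] (0 : ℝ),
      (((Polynomial.derivative^[l] H).map (Polynomial.evalRingHom t)).eval (μ t) = 0)) ∧
      ¬ ∀ᶠ t in 𝓝[>] (0 : ℝ),
      (((Polynomial.derivative^[l + 1] H).map (Polynomial.evalRingHom t)).eval (μ t) = 0) := by
    by_contra hcon
    push Not at hcon
    refine hlast ?_
    generalize H.natDegree = m
    induction m with
    | zero => exact hHμ
    | succ m ih => exact hcon m ih
  have hl1 := (hdich (l + 1)).resolve_left hl1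
  have hall := ((hl0.and hl1).and (hμlt.and hpc)).and
    ((eventually_all.2 fun i => Polynomial.eventually_map_evalRingHom_ne_zero (G i) (hG i)).and h01)
  obtain ⟨ε, hε, hsub⟩ := mem_nhdsGT_iff_exists_Ioo_subset.1 hall
  have hε : (0 : ℝ) < ε := hε
  obtain ⟨m, hmc, hm⟩ := Polynomial.exists_hasDerivAt_of_lipschitz (Polynomial.derivative^[l] H) μ ε
    (A * (2 + 2 * B)) (fun t ht t' ht' => hlip t (hsub ht).2.2 t' (hsub ht').2.2)
    (fun t ht => (hsub ht).1.1.1) (fun t ht => by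
      have := (hsub ht).1.1.2
      rwa [Function.iterate_succ_apply'] at this)
  have hπ : ∀ t ∈ Set.Ioo 0 ε, eval (x t) P = t - m t / (2 * A) := by
    intro t ht
    have hF1 : HasDerivAt (fun t' => F.eval₂ (Polynomial.evalRingHom t') (x t))
        (A * (2 * (eval (x t) P - t) * (-1))) t := by
      simp only [hFe]
      have h1 : HasDerivAt (fun t' : ℝ => eval (x t) P - t') (-1) t := by
        simpa using (hasDerivAt_id t).const_sub (eval (x t) P)
      have h2 := ((h1.pow 2).const_mul A).const_add (eval (x t) P.sqGrad)
      refine h2.congr_deriv ?_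
      simp
    have hmin : IsLocalMin (fun t' => F.eval₂ (Polynomial.evalRingHom t') (x t) - μ t') t := by
      refine Eventually.of_forall fun t' => ?_
      simp only [hμ, sub_self]
      exact sub_nonneg.2 (hxmin t' _ (hxK t))
    have h0 := hmin.hasDerivAt_eq_zero (hF1.sub (hm t ht))
    field_simp
    linarith
  refine ⟨D, ε, x, G, hε, ?_, ?_, ?_⟩
  · have : ContinuousOn (fun t => t - m t / (2 * A)) (Set.Ioo 0 ε) :=
      continuousOn_id.sub (hmc.div_const _)
    exact this.congr hπ
  · intro t _ t' _ hlt
    have h1 := hxmin t (x t') (hxK t')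
    have h2 := hxmin t' (x t) (hxK t)
    rw [hFe, hFe] at h1 h2
    rcases lt_trichotomy t t' with h | h | h
    · exact h
    · rw [h] at hlt; exact absurd hlt (lt_irrefl _)
    · exfalso
      nlinarith [mul_pos (mul_pos hA0 (sub_pos.2 hlt)) (sub_pos.2 h)]
  · intro t ht
    obtain ⟨⟨-, hlt, hpct⟩, hne, -⟩ := hsub ht
    have ht0 : 0 < t := ht.1
    simp only [hμ, hFe] at hlt
    have hg := eval_sqGrad_nonneg P (x t)
    have hsq : (eval (x t) P - t) ^ 2 ≤ (t / 2) ^ 2 := by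
      have : A * (eval (x t) P - t) ^ 2 ≤ A * (t / 2) ^ 2 := by rw [hA]; nlinarith
      exact le_of_mul_le_mul_left this hA0
    have habs := abs_le.1 (abs_le_of_sq_le_sq hsq (by positivity))
    refine ⟨hxK t, by linarith, by linarith, ?_, fun i => ⟨hne i, ?_⟩⟩
    · have : 0 ≤ A * (eval (x t) P - t) ^ 2 := by positivity
      linarith
    · simpa using hGe i t _ hpct

theorem exists_strictMono_not_summable {κ : Type*} [Finite κ] (a : ℕ → ℝ) (ha : ¬ Summable a)
    (lab : ℕ → κ) :
    ∃ e : ℕ → ℕ, StrictMono e ∧ (∀ q q', lab (e q) = lab (e q')) ∧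
      ¬ Summable fun q => a (e q) := by
  classical
  have := Fintype.ofFinite κ
  by_contra! hcon
  refine ha ?_
  have hsum : a = fun j => ∑ l, Set.indicator {j | lab j = l} a j := by
    funext j
    simp [Set.indicator_apply]
  rw [hsum]
  refine summable_sum fun l _ => ?_
  by_cases hfin : Set.Finite {j | lab j = l}
  · exact summable_of_hasFiniteSupport (hfin.subset Set.support_indicator_subset)
  · have : Infinite {j | lab j = l} := Set.infinite_coe_iff.2 hfin
    let e := Nat.Subtype.orderIsoOfNat {j | lab j = l}
    have h := hcon (fun q => (e q : ℕ)) (fun q q' hq => e.strictMono hq)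
      (fun q q' => (e q).2.trans (e q').2.symm)
    rw [← summable_subtype_iff_indicator]
    exact (e.toEquiv.summable_iff (f := a ∘ Subtype.val)).1 h

namespace MvPolynomial

theorem exists_separation_of_gradient_le {n : ℕ} (P : MvPolynomial (Fin n) ℝ) (R K : ℝ)
    (hK : 0 ≤ K) : ∃ c, 0 < c ∧ ∀ (x y : Fin n → ℝ) (s : ℝ), x ∈ euclideanBall n R →
      y ∈ euclideanBall n R → 0 < s → (∀ i, |eval y (pderiv i P)| ≤ K * s) →
      s ^ 2 ≤ eval x P - eval y P → c * s ≤ ∑ i, |x i - y i| := by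
  obtain ⟨B, hB0, hB⟩ := exists_taylor_bound P |R|
  have hnorm : ∀ z ∈ euclideanBall n R, ‖z‖ ≤ |R| := fun z hz =>
    norm_le_of_sum_sq_le (abs_nonneg R) (by rw [sq_abs]; exact hz)
  refine ⟨1 / (K + B + 1), by positivity, fun x y s hx hy hs hg hxy => ?_⟩
  by_contra! hlt
  have h1 := (abs_le.1 (hB x y (hnorm x hx) (hnorm y hy)).2.2).2
  set D := ∑ i, |x i - y i| with hD
  have hD0 : 0 ≤ D := Finset.sum_nonneg fun i _ => abs_nonneg _
  have h2 : ∑ i, eval y (pderiv i P) * (x i - y i) ≤ K * s * D := by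
    rw [hD, Finset.mul_sum]
    refine Finset.sum_le_sum fun i _ => (le_abs_self _).trans ?_
    rw [abs_mul]
    exact mul_le_mul_of_nonneg_right (hg i) (abs_nonneg _)
  have h3 : ‖x - y‖ ≤ D := by
    refine (pi_norm_le_iff_of_nonneg hD0).2 fun i => ?_
    rw [Pi.sub_apply, Real.norm_eq_abs]
    exact Finset.single_le_sum (f := fun i => |x i - y i|) (fun i _ => abs_nonneg _)
      (Finset.mem_univ i)
  have h4 : B * ‖x - y‖ ^ 2 ≤ B * D ^ 2 := by gcongr
  have hden : 0 < K + B + 1 := by positivity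
  rw [div_mul_eq_mul_div, one_mul, lt_div_iff₀ hden] at hlt
  have h5 : D ≤ s := by nlinarith
  nlinarith [mul_nonneg hB0 hD0, mul_nonneg hK hD0, mul_pos hs hs]

/-- A polynomial vanishing on a sphere has, at small positive values inside the ball, a gradient
which is large compared with the value. -/
theorem exists_mul_sq_lt_sqGrad {n : ℕ} (P : MvPolynomial (Fin n) ℝ) (R C : ℝ)
    (hP : ∀ x : Fin n → ℝ, ∑ i, x i ^ 2 = R ^ 2 → eval x P = 0) :
    ∃ η, 0 < η ∧ ∀ x ∈ euclideanBall n R, 0 < eval x P → eval x P < η →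
      C * eval x P ^ 2 < eval x P.sqGrad := by
  by_contra! hcon
  obtain ⟨C₁, ε, x, G, hε, hcont, hmono, hx⟩ := exists_curve_of_small_gradient P R C hP hcon
  obtain ⟨J, hJ⟩ := exists_nat_gt (2 / ε)
  have hJ0 : (0 : ℝ) < J := lt_trans (by positivity) hJ
  set a : ℕ → ℝ := fun j => 1 / ((j : ℝ) + J) with ha
  have ha0 : ∀ j, 0 < a j := fun j => by positivity
  have haε : ∀ j, 2 * a j < ε := by
    intro j
    rw [div_lt_iff₀ hε] at hJ
    simp only [ha]
    rw [mul_one_div, div_lt_iff₀ (by positivity)]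
    nlinarith [(Nat.cast_nonneg j : (0 : ℝ) ≤ j)]
  have hsep : ∀ j j', j < j' → a j' ^ 2 ≤ a j - a j' := by
    intro j j' h
    have h' : (j : ℝ) + 1 ≤ j' := by exact_mod_cast h
    have hp : 0 < (j : ℝ) + J := by positivity
    have hp' : 0 < (j' : ℝ) + J := by positivity
    simp only [ha]
    rw [div_sub_div _ _ hp.ne' hp'.ne', div_pow, div_le_div_iff₀ (by positivity) (by positivity)]
    nlinarith [mul_pos hp hp', mul_pos hp' hp']
  have haS : ¬ Summable a := by
    intro h
    have h1 : a = fun j : ℕ => (fun m : ℕ => 1 / (m : ℝ)) (j + J) := by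
      funext j; simp [ha]
    rw [h1, summable_nat_add_iff (f := fun m : ℕ => 1 / (m : ℝ)) J] at h
    exact Real.not_summable_one_div_natCast h
  have hτ : ∀ j, ∃ t ∈ Set.Icc (2 * a j / 3) (2 * a j), eval (x t) P = a j := by
    intro j
    have hle : 2 * a j / 3 ≤ 2 * a j := by linarith [ha0 j]
    have hsub : Set.Icc (2 * a j / 3) (2 * a j) ⊆ Set.Ioo 0 ε := fun t ht =>
      ⟨by linarith [ha0 j, ht.1], ht.2.trans_lt (haε j)⟩
    refine intermediate_value_Icc hle (hcont.mono hsub) ⟨?_, ?_⟩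
    · have := (hx _ (hsub (Set.left_mem_Icc.2 hle))).2.2.1
      linarith
    · have := (hx _ (hsub (Set.right_mem_Icc.2 hle))).2.1
      linarith
  choose τ hτm hτv using hτ
  have hτε : ∀ j, τ j ∈ Set.Ioo 0 ε := fun j =>
    ⟨by linarith [ha0 j, (hτm j).1], (hτm j).2.trans_lt (haε j)⟩
  have hτanti : StrictAnti τ := by
    intro j j' h
    refine hmono _ (hτε j') _ (hτε j) ?_
    rw [hτv, hτv]
    nlinarith [hsep j j' h, ha0 j']
  obtain ⟨c, hc0, hc⟩ := exists_separation_of_gradient_le P R (4 * |C₁| + 1) (by positivity)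
  have hgrad : ∀ j i, |eval (x (τ j)) (pderiv i P)| ≤ (4 * |C₁| + 1) * a j := by
    intro j i
    refine abs_le_of_sq_le_sq' ?_ (by have := ha0 j; positivity) |> abs_le.2
    have h1 := (hx _ (hτε j)).2.2.2.1
    rw [eval_sqGrad] at h1
    have h2 := Finset.single_le_sum (f := fun i => eval (x (τ j)) (pderiv i P) ^ 2)
      (fun i _ => sq_nonneg _) (Finset.mem_univ i)
    have h3 : τ j ^ 2 ≤ (2 * a j) ^ 2 := by
      have := (hτm j).2
      have := (hτε j).1
      gcongr
    have h4 : C₁ * τ j ^ 2 ≤ |C₁| * (2 * a j) ^ 2 :=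
      mul_le_mul (le_abs_self _) h3 (sq_nonneg _) (abs_nonneg _)
    have h5 : |C₁| * (2 * a j) ^ 2 ≤ ((4 * |C₁| + 1) * a j) ^ 2 := by
      nlinarith [mul_nonneg (abs_nonneg C₁) (sq_nonneg (a j)), sq_nonneg (a j),
        mul_nonneg (sq_nonneg |C₁|) (sq_nonneg (a j))]
    linarith
  set N := Finset.univ.sup fun i => (G i).natDegree with hN
  have hGN : ∀ i, (G i).natDegree ≤ N := fun i =>
    Finset.le_sup (f := fun i => (G i).natDegree) (Finset.mem_univ i)
  let lab : ℕ → Fin n → Fin (N + 1) → SignType := fun j i l =>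
    SignType.sign ((Polynomial.derivative^[l]
      ((G i).map (Polynomial.evalRingHom (τ j)))).eval (x (τ j) i))
  obtain ⟨e, he, hlab, hnot⟩ := exists_strictMono_not_summable a haS lab
  choose V hV using fun i => Polynomial.exists_sum_abs_sub_le_of_sign_eq (G i) N (hGN i) |R|
  have hVb : ∀ i r, ∑ q ∈ Finset.range r, |x (τ (e (q + 1))) i - x (τ (e q)) i| ≤ V i := by
    intro i r
    refine hV i (fun q => τ (e q)) (fun q => x (τ (e q)) i) (hτanti.comp_strictMono he)
      (fun q => ((hx _ (hτε _)).2.2.2.2 i).1) (fun q => ((hx _ (hτε _)).2.2.2.2 i).2)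
      (fun q => ?_) (fun q q' l hl => ?_) r
    · have h1 := (hx _ (hτε (e q))).1
      have h2 : ‖x (τ (e q))‖ ≤ |R| :=
        norm_le_of_sum_sq_le (abs_nonneg R) (by rw [sq_abs]; exact h1)
      exact (norm_le_pi_norm (x (τ (e q))) i).trans h2
    · exact congrFun (congrFun (hlab q q') i) ⟨l, Nat.lt_succ_of_le hl⟩
  refine hnot ((summable_nat_add_iff 1).1 ?_)
  refine summable_of_sum_range_le (c := (∑ i, V i) / c) (fun q => (ha0 _).le) fun r => ?_
  rw [le_div_iff₀ hc0, mul_comm, Finset.mul_sum]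
  calc ∑ q ∈ Finset.range r, c * a (e (q + 1))
      ≤ ∑ q ∈ Finset.range r, ∑ i, |x (τ (e (q + 1))) i - x (τ (e q)) i| := by
        refine Finset.sum_le_sum fun q _ => ?_
        have h := hc (x (τ (e q))) (x (τ (e (q + 1)))) (a (e (q + 1))) (hx _ (hτε _)).1
          (hx _ (hτε _)).1 (ha0 _) (hgrad _) (by
            rw [hτv, hτv]; exact hsep _ _ (he (Nat.lt_succ_self q)))
        simpa only [abs_sub_comm] using h
    _ = ∑ i, ∑ q ∈ Finset.range r, |x (τ (e (q + 1))) i - x (τ (e q)) i| := Finset.sum_comm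
    _ ≤ ∑ i, V i := Finset.sum_le_sum fun i _ => hVb i r

end MvPolynomial

namespace Polynomial

theorem exists_pow_le_abs_eval (T : Polynomial ℝ) (hT : T ≠ 0) (N : ℕ) (hN : T.natDegree ≤ N) :
    ∃ c w₀, 0 < c ∧ 0 < w₀ ∧ ∀ w, 0 < w → w < w₀ → c * w ^ N ≤ |T.eval w| := by
  obtain ⟨q, hq, hndvd⟩ := exists_eq_pow_rootMultiplicity_mul_and_not_dvd T hT 0
  have hq0 : q.eval 0 ≠ 0 := fun h => hndvd (dvd_iff_isRoot.2 h)
  have hr : T.rootMultiplicity 0 ≤ N := by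
    refine le_trans ?_ hN
    have h1 := natDegree_le_of_dvd (pow_rootMultiplicity_dvd T 0) hT
    simpa using h1
  have hcont : ContinuousAt (fun w => |q.eval w|) 0 := by fun_prop
  have hev : ∀ᶠ w in 𝓝 (0 : ℝ), |q.eval 0| / 2 < |q.eval w| :=
    hcont.eventually_const_lt (by have := abs_pos.2 hq0; linarith)
  obtain ⟨δ, hδ, hball⟩ := Metric.eventually_nhds_iff.1 hev
  refine ⟨|q.eval 0| / 2, min δ 1, by have := abs_pos.2 hq0; linarith, lt_min hδ one_pos,
    fun w hw hw0 => ?_⟩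
  have h1 : |q.eval 0| / 2 < |q.eval w| := hball (by
    rw [Real.dist_eq, sub_zero, abs_of_pos hw]; exact hw0.trans_le (min_le_left _ _))
  have h2 : w ^ N ≤ w ^ T.rootMultiplicity 0 :=
    pow_le_pow_of_le_one hw.le (hw0.le.trans (min_le_right _ _)) hr
  rw [hq, eval_mul, eval_pow, abs_mul, abs_pow]
  simp only [C_0, sub_zero, eval_X, abs_of_pos hw]
  rw [mul_comm]
  exact mul_le_mul h2 h1.le (by positivity) (by positivity)

/-- If `s` is a root of `G(t, ·)` and `t * s` is small, then `(t * s) ^ N = O(1 / t)`. -/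
theorem exists_pow_mul_le_of_root (G : Polynomial (Polynomial ℝ)) (hG : G ≠ 0) (N : ℕ)
    (hN : G.natDegree ≤ N) :
    ∃ C w₀, 0 < w₀ ∧ ∀ t s, 1 ≤ t → 0 < s → t * s < w₀ →
      (G.map (evalRingHom t)).eval s = 0 → (t * s) ^ N * t ≤ C := by
  let K : Polynomial (Polynomial ℝ) := ∑ i ∈ Finset.range (N + 1),
    C (X ^ i) * ((G.coeff i).map C * X ^ (N - i))
  have hKcoeff : ∀ j, K.coeff j = ∑ i ∈ Finset.range (N + 1),
      X ^ i * ((G.coeff i).map C * X ^ (N - i)).coeff j := fun j => by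
    simp only [K, finsetSum_coeff, coeff_C_mul]
  have hcst : ∀ i j, ∃ b : ℝ,
      (((G.coeff i).map C * X ^ (N - i) : Polynomial (Polynomial ℝ))).coeff j = C b := by
    intro i j
    rw [coeff_mul_X_pow', coeff_map]
    split_ifs
    · exact ⟨_, rfl⟩
    · exact ⟨0, by simp⟩
  have hKdeg : ∀ j, (K.coeff j).natDegree ≤ N := by
    intro j
    rw [hKcoeff]
    refine natDegree_sum_le_of_forall_le _ _ fun i hi => ?_
    obtain ⟨b, hb⟩ := hcst i j
    rw [hb, mul_comm]
    exact (natDegree_C_mul_X_pow_le b i).trans (by have := Finset.mem_range.1 hi; omega)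
  have hK0 : K ≠ 0 := by
    intro h0
    set i₀ := G.natDegree
    set j₀ := (G.coeff i₀).natDegree
    have h1 : (K.coeff (j₀ + (N - i₀))).coeff i₀ = (G.coeff i₀).coeff j₀ := by
      rw [hKcoeff, finsetSum_coeff, Finset.sum_eq_single i₀]
      · rw [coeff_mul_X_pow, coeff_map, mul_comm, coeff_C_mul, coeff_X_pow_self, mul_one]
      · intro i _ hne
        obtain ⟨b, hb⟩ := hcst i (j₀ + (N - i₀))
        rw [hb, mul_comm, coeff_C_mul_X_pow, if_neg hne.symm]
      · intro h
        exact absurd (Finset.mem_range.2 (by omega)) h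
    rw [h0] at h1
    have h2 : (G.coeff i₀).leadingCoeff = 0 := h1.symm
    have h3 : G.leadingCoeff = 0 := leadingCoeff_eq_zero.1 h2
    exact hG (leadingCoeff_eq_zero.1 h3)
  have hKeval : ∀ t s, t ≠ 0 → (K.map (evalRingHom (t * s))).eval t =
      t ^ N * (G.map (evalRingHom t)).eval s := by
    intro t s ht
    have hdeg : (G.map (evalRingHom t)).natDegree < N + 1 :=
      Nat.lt_succ_of_le (natDegree_map_le.trans hN)
    rw [eval_eq_sum_range' hdeg, Finset.mul_sum]
    simp only [K, Polynomial.map_sum, eval_finsetSum]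
    refine Finset.sum_congr rfl fun i hi => ?_
    have hi' : i ≤ N := Nat.lt_succ_iff.1 (Finset.mem_range.1 hi)
    have hcomp : (evalRingHom (t * s)).comp (C : ℝ →+* Polynomial ℝ) = RingHom.id ℝ := by
      ext; simp
    simp only [Polynomial.map_mul, map_C, Polynomial.map_pow, map_X, Polynomial.map_map, hcomp,
      Polynomial.map_id, eval_mul, eval_C, eval_pow, eval_X, coeff_map, coe_evalRingHom]
    rw [← Nat.sub_add_cancel hi', pow_add, Nat.sub_add_cancel hi']
    ring
  set D := K.natDegree with hD
  have hT0 : K.coeff D ≠ 0 := fun h => hK0 (leadingCoeff_eq_zero.1 h)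
  obtain ⟨c, w₀, hc, hw₀, hlow⟩ := exists_pow_le_abs_eval (K.coeff D) hT0 N (hKdeg D)
  have hcont : Continuous fun w => ∑ j ∈ Finset.range D, |(K.coeff j).eval w| := by fun_prop
  obtain ⟨B, hB⟩ := (isCompact_Icc (a := (0 : ℝ)) (b := 1)).bddAbove_image hcont.continuousOn
  refine ⟨B / c, min w₀ 1, lt_min hw₀ one_pos, fun t s ht hs hts h0 => ?_⟩
  have ht0 : 0 < t := by linarith
  have hw0 : 0 < t * s := by positivity
  have hB' := hB (Set.mem_image_of_mem _ (⟨hw0.le, hts.le.trans (min_le_right _ _)⟩ :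
    t * s ∈ Set.Icc (0 : ℝ) 1))
  have hl := hlow _ hw0 (hts.trans_le (min_le_left _ _))
  have hE := hKeval t s ht0.ne'
  rw [h0, mul_zero, eval_eq_sum_range' (Nat.lt_succ_of_le natDegree_map_le :
    (K.map (evalRingHom (t * s))).natDegree < D + 1), Finset.sum_range_succ] at hE
  simp only [coeff_map, coe_evalRingHom] at hE
  have h1 : |(K.coeff D).eval (t * s)| * t ^ D * t ≤ B * t ^ D := by
    have h2 : |(K.coeff D).eval (t * s)| * t ^ D =
        |∑ j ∈ Finset.range D, (K.coeff j).eval (t * s) * t ^ j| := by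
      rw [eq_neg_of_add_eq_zero_left hE, abs_neg, abs_mul, abs_of_pos (pow_pos ht0 D)]
    rw [h2]
    calc _ ≤ (∑ j ∈ Finset.range D, |(K.coeff j).eval (t * s) * t ^ j|) * t :=
          mul_le_mul_of_nonneg_right (Finset.abs_sum_le_sum_abs _ _) ht0.le
      _ = ∑ j ∈ Finset.range D, |(K.coeff j).eval (t * s)| * t ^ (j + 1) := by
          rw [Finset.sum_mul]
          refine Finset.sum_congr rfl fun j _ => ?_
          rw [abs_mul, abs_of_pos (pow_pos ht0 j)]; ring
      _ ≤ ∑ j ∈ Finset.range D, |(K.coeff j).eval (t * s)| * t ^ D := by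
          refine Finset.sum_le_sum fun j hj => ?_
          exact mul_le_mul_of_nonneg_left
            (pow_le_pow_right₀ ht (Finset.mem_range.1 hj)) (abs_nonneg _)
      _ = (∑ j ∈ Finset.range D, |(K.coeff j).eval (t * s)|) * t ^ D := by rw [Finset.sum_mul]
      _ ≤ B * t ^ D := mul_le_mul_of_nonneg_right hB' (by positivity)
  have h3 : |(K.coeff D).eval (t * s)| * t ≤ B := by
    have : 0 < t ^ D := by positivity
    refine le_of_mul_le_mul_right ?_ this
    linarith
  rw [le_div_iff₀ hc]
  nlinarith

end Polynomial

namespace MvPolynomial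

theorem exists_mul_sq_lt_sqGrad_of_pos {n : ℕ} (p : MvPolynomial (Fin n) ℝ) (R C : ℝ)
    (hR : 0 < R) (hC : 0 ≤ C) :
    ∃ η, 0 < η ∧ ∀ x ∈ euclideanBall n R, 0 < eval x p → eval x p < η →
      C * eval x p ^ 2 < eval x p.sqGrad := by
  let W : MvPolynomial (Fin n) ℝ := MvPolynomial.C (4 * R ^ 2) - ∑ i, X i ^ 2
  have hW : ∀ x, eval x W = 4 * R ^ 2 - ∑ i, x i ^ 2 := fun x => by simp [W]
  have hWd : ∀ x i, eval x (pderiv i (W * p)) =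
      eval x W * eval x (pderiv i p) - 2 * x i * eval x p := by
    intro x i
    have h1 : pderiv i W = - (2 * X i) := by
      simp only [W, map_sub, map_sum, pderiv_C, zero_sub, Derivation.leibniz_pow, pderiv_X]
      rw [Finset.sum_eq_single i]
      · simp
      · intro j _ hj; simp [hj]
      · simp
    rw [Derivation.leibniz, h1]
    simp
    ring
  have hPz : ∀ x : Fin n → ℝ, ∑ i, x i ^ 2 = (2 * R) ^ 2 → eval x (W * p) = 0 := by
    intro x hx
    rw [eval_mul, hW, hx]; ring
  obtain ⟨η, hη, h⟩ := exists_mul_sq_lt_sqGrad (W * p) (2 * R)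
    ((32 * R ^ 4 * C + 8 * R ^ 2) / (9 * R ^ 4)) hPz
  refine ⟨η / (4 * R ^ 2), by positivity, fun x hx h0 hlt => ?_⟩
  have hx' : ∑ i, x i ^ 2 ≤ R ^ 2 := hx
  have hxn : 0 ≤ ∑ i, x i ^ 2 := Finset.sum_nonneg fun i _ => sq_nonneg _
  have hR2 : 0 < R ^ 2 := by positivity
  have hW1 : 3 * R ^ 2 ≤ eval x W := by rw [hW]; linarith
  have hW2 : eval x W ≤ 4 * R ^ 2 := by rw [hW]; linarith
  have hW0 : 0 < eval x W := by linarith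
  by_contra! hg
  rw [lt_div_iff₀ (by positivity)] at hlt
  have h1 := h x (by change ∑ i, x i ^ 2 ≤ (2 * R) ^ 2; nlinarith)
    (by rw [eval_mul]; positivity) (by
      rw [eval_mul]
      exact (mul_le_mul_of_nonneg_right hW2 h0.le).trans_lt (by linarith))
  have h2 : eval x (W * p).sqGrad ≤
      2 * eval x W ^ 2 * eval x p.sqGrad + 8 * (∑ i, x i ^ 2) * eval x p ^ 2 := by
    rw [eval_sqGrad, eval_sqGrad, Finset.mul_sum, Finset.mul_sum, Finset.sum_mul,
      ← Finset.sum_add_distrib]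
    refine Finset.sum_le_sum fun i _ => ?_
    rw [hWd]
    nlinarith [sq_nonneg (eval x W * eval x (pderiv i p) + 2 * x i * eval x p)]
  have h3 : 2 * eval x W ^ 2 * eval x p.sqGrad ≤ 32 * R ^ 4 * (C * eval x p ^ 2) := by
    have h5 : eval x W ^ 2 ≤ (4 * R ^ 2) ^ 2 := by gcongr
    have := eval_sqGrad_nonneg p x
    calc _ ≤ 2 * (4 * R ^ 2) ^ 2 * eval x p.sqGrad := by gcongr
      _ = 32 * R ^ 4 * eval x p.sqGrad := by ring
      _ ≤ _ := by gcongr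
  have h4 : 8 * (∑ i, x i ^ 2) * eval x p ^ 2 ≤ 8 * R ^ 2 * eval x p ^ 2 := by gcongr
  have h6 : (32 * R ^ 4 * C + 8 * R ^ 2) * eval x p ^ 2 ≤
      (32 * R ^ 4 * C + 8 * R ^ 2) / (9 * R ^ 4) * eval x (W * p) ^ 2 := by
    rw [div_mul_eq_mul_div, le_div_iff₀ (by positivity), mul_assoc, eval_mul]
    refine mul_le_mul_of_nonneg_left ?_ (by positivity)
    have h7 : (3 * R ^ 2) ^ 2 ≤ eval x W ^ 2 := by gcongr
    nlinarith [mul_le_mul_of_nonneg_right h7 (sq_nonneg (eval x p))]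
  linarith

end MvPolynomial

namespace MvPolynomial

theorem totalDegree_sqGrad_le {n : ℕ} (p : MvPolynomial (Fin n) ℝ) :
    p.sqGrad.totalDegree ≤ 2 * (p.totalDegree - 1) := by
  refine (totalDegree_finsetSum _ _).trans (Finset.sup_le fun i _ => ?_)
  exact (totalDegree_pow _ _).trans (Nat.mul_le_mul_left 2 (totalDegree_pderiv_le i p))

theorem eventually_nhds_zero_of_euclideanBall {n : ℕ} {q : (Fin n → ℝ) → Prop}
    (h : ∀ᶠ x in 𝓝 0, q x) : ∃ R, 0 < R ∧ R ≤ 1 ∧ ∀ x ∈ euclideanBall n R, q x := by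
  obtain ⟨δ, hδ, hball⟩ := Metric.eventually_nhds_iff.1 h
  refine ⟨min (δ / 2) 1, by positivity, min_le_right _ _, fun x hx => hball ?_⟩
  rw [dist_zero_right]
  have h1 := norm_le_of_sum_sq_le (by positivity : (0 : ℝ) ≤ min (δ / 2) 1) hx
  have h2 := min_le_left (δ / 2) 1
  linarith

/-- The bound on `λ (W p - λ |∇p|²)` at large `λ` over a small ball, where `W` is the
defining function of the ball. -/
theorem exists_pow_mul_le_of_penalized {n : ℕ} (p : MvPolynomial (Fin n) ℝ) (e : ℕ)
    (he : p.totalDegree + 2 ≤ e) (he' : 2 * (p.totalDegree - 1) ≤ e) (R : ℝ) (hR : 0 < R)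
    (hsq : ∀ x ∈ euclideanBall n R, 0 < eval x p → eval x p ^ 2 < eval x p.sqGrad) :
    ∃ B t₀, 1 ≤ t₀ ∧ ∀ t, t₀ ≤ t → ∀ x ∈ euclideanBall n R, ∀ m,
      0 < m → m ≤ (R ^ 2 - ∑ i, x i ^ 2) * eval x p - t * eval x p.sqGrad →
      (t * m) ^ (e ^ n) * t ≤ B := by
  let W : MvPolynomial (Fin n) ℝ := C (R ^ 2) - ∑ i, X i ^ 2
  have hW : ∀ x, eval x W = R ^ 2 - ∑ i, x i ^ 2 := fun x => by simp [W]
  have hWdeg : W.totalDegree ≤ 2 := by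
    refine (totalDegree_sub _ _).trans (max_le ((totalDegree_C _).trans_le zero_le_two) ?_)
    refine (totalDegree_finsetSum _ _).trans (Finset.sup_le fun i _ => ?_)
    exact (totalDegree_pow _ _).trans (by simp [totalDegree_X])
  let Φ : MvPolynomial (Fin n) (Polynomial ℝ) :=
    map Polynomial.C (W * p) - C Polynomial.X * map Polynomial.C p.sqGrad
  have hΦ : ∀ t x, Φ.eval₂ (Polynomial.evalRingHom t) x =
      (R ^ 2 - ∑ i, x i ^ 2) * eval x p - t * eval x p.sqGrad := by
    intro t x
    have hcomp : (Polynomial.evalRingHom t).comp (Polynomial.C : ℝ →+* Polynomial ℝ) =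
        RingHom.id ℝ := by ext; simp
    simp only [Φ, eval₂_sub, eval₂_mul, eval₂_C, eval₂_map, hcomp, eval₂_id,
      Polynomial.coe_evalRingHom, Polynomial.eval_X, map_mul, hW]
  have hΦdeg : Φ.totalDegree ≤ e := by
    refine (totalDegree_sub _ _).trans (max_le ?_ ?_)
    · refine (totalDegree_map_le' _ _).trans ((totalDegree_mul _ _).trans ?_)
      omega
    · refine (totalDegree_mul _ _).trans ?_
      have h1 := totalDegree_map_le' (Polynomial.C : ℝ →+* Polynomial ℝ) p.sqGrad
      have h2 := totalDegree_sqGrad_le p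
      rw [totalDegree_C]
      omega
  obtain ⟨G, hG0, hGdeg, hG⟩ := PerturbedCritical.exists_polynomial Φ e hΦdeg (by omega) Φ
  obtain ⟨B, w₀, hw₀, hB⟩ := Polynomial.exists_pow_mul_le_of_root G hG0 _ hGdeg
  obtain ⟨η, hη, hgrad⟩ := exists_mul_sq_lt_sqGrad_of_pos p R (R ^ 4 / w₀) hR (by positivity)
  refine ⟨B, max 1 (R ^ 2 / η), le_max_left _ _, fun t ht x hx m hm hmle => ?_⟩
  have ht1 : 1 ≤ t := (le_max_left _ _).trans ht
  have ht0 : 0 < t := by linarith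
  have htη : R ^ 2 ≤ t * η := by
    have := (le_max_right _ _).trans ht
    rwa [div_le_iff₀ hη] at this
  obtain ⟨y, hy, hmax, hcrit⟩ := PerturbedCritical.exists_of_isMax Φ e t R x hx fun z hz => by
    rw [hΦ, hΦ, hz, sub_self, zero_mul, zero_sub]
    have := eval_sqGrad_nonneg p z
    have : 0 ≤ t * eval z p.sqGrad := by positivity
    linarith
  have hroot := hG t y hcrit
  have hym := hmax x hx
  rw [hΦ, hΦ] at hym
  rw [hΦ] at hroot
  set M := (R ^ 2 - ∑ i, y i ^ 2) * eval y p - t * eval y p.sqGrad with hM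
  have hmM : m ≤ M := hmle.trans hym
  have hM0 : 0 < M := hm.trans_le hmM
  have hgy := eval_sqGrad_nonneg p y
  have hWy : 0 < R ^ 2 - ∑ i, y i ^ 2 := by linarith
  have hWy' : R ^ 2 - ∑ i, y i ^ 2 ≤ R ^ 2 := by
    have : 0 ≤ ∑ i, y i ^ 2 := Finset.sum_nonneg fun i _ => sq_nonneg _
    linarith
  have hpy : 0 < eval y p := by
    by_contra! h
    nlinarith [mul_nonneg ht0.le hgy]
  have hWp : M ≤ R ^ 2 * eval y p - t * eval y p.sqGrad := by
    have := mul_le_mul_of_nonneg_right hWy' hpy.le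
    linarith
  have hyK : y ∈ euclideanBall n R := hy.le
  have h1 := hsq y hyK hpy
  have h2 : t * eval y p < R ^ 2 := by
    by_contra! h
    nlinarith [mul_le_mul_of_nonneg_right h hpy.le, mul_lt_mul_of_pos_left h1 ht0]
  have h3 : eval y p < η := by
    refine lt_of_mul_lt_mul_left (h2.trans_le htη) ht0.le
  have h4 := hgrad y hyK hpy h3
  have h5 : t * M < w₀ := by
    have h6 : t * M ≤ R ^ 2 * (t * eval y p) - R ^ 4 / w₀ * (t * eval y p) ^ 2 := by
      have := mul_le_mul_of_nonneg_left hWp ht0.le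
      have := mul_le_mul_of_nonneg_left h4.le (sq_nonneg t)
      nlinarith
    set v := t * eval y p
    have h7 : w₀ * (t * M) ≤ R ^ 2 * v * w₀ - (R ^ 2 * v) ^ 2 := by
      have := mul_le_mul_of_nonneg_left h6 hw₀.le
      have e : w₀ * (R ^ 2 * v - R ^ 4 / w₀ * v ^ 2) = R ^ 2 * v * w₀ - (R ^ 2 * v) ^ 2 := by
        field_simp
      linarith
    by_contra! h
    nlinarith [sq_nonneg (R ^ 2 * v - w₀ / 2), mul_le_mul_of_nonneg_left h hw₀.le,
      mul_pos hw₀ hw₀]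
  have h8 := hB t M ht1 hM0 h5 hroot
  refine le_trans ?_ h8
  gcongr

/-- An effective gradient inequality on the positive side of a polynomial. -/
theorem exists_pow_le_sqGrad_pow_of_pos {n : ℕ} (p : MvPolynomial (Fin n) ℝ) (e : ℕ)
    (he : p.totalDegree + 2 ≤ e) (he' : 2 * (p.totalDegree - 1) ≤ e) (h0 : eval 0 p = 0) :
    ∃ C : ℝ, ∀ᶠ x : Fin n → ℝ in 𝓝 0, 0 < eval x p →
      eval x p ^ (2 * e ^ n + 1) ≤ C * eval x p.sqGrad ^ (e ^ n + 1) := by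
  obtain ⟨η, hη, h1⟩ := exists_mul_sq_lt_sqGrad_of_pos p 1 1 one_pos zero_le_one
  have hcont : ContinuousAt (fun x : Fin n → ℝ => eval x p) 0 :=
    (MvPolynomial.continuous_eval p).continuousAt
  have hlt : ∀ᶠ x : Fin n → ℝ in 𝓝 0, eval x p < min η 1 :=
    hcont.eventually_lt_const (by simp only [h0]; positivity)
  obtain ⟨R, hR, hR1, hsmall⟩ := eventually_nhds_zero_of_euclideanBall hlt
  have hsq : ∀ x ∈ euclideanBall n R, 0 < eval x p → eval x p ^ 2 < eval x p.sqGrad := by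
    intro x hx hpos
    have := h1 x (show ∑ i, x i ^ 2 ≤ 1 ^ 2 from
      le_trans (show ∑ i, x i ^ 2 ≤ R ^ 2 from hx) (by gcongr)) hpos
        ((hsmall x hx).trans_le (min_le_left _ _))
    linarith
  obtain ⟨B, t₀, ht₀, hB⟩ := exists_pow_mul_le_of_penalized p e he he' R hR hsq
  set N := e ^ n with hN
  set a := 3 * R ^ 2 / 4 with ha
  have ha0 : 0 < a := by positivity
  refine ⟨|B| / ((a ^ 2 / 4) ^ N * (a / 2)) + (2 * t₀ / a) ^ (N + 1), ?_⟩
  have hnear : ∀ᶠ x : Fin n → ℝ in 𝓝 0, ∑ i, x i ^ 2 < R ^ 2 / 4 :=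
    (continuous_sum_sq n).continuousAt.eventually_lt_const (by simp; positivity)
  filter_upwards [hnear] with x hx hpos
  have hxK : x ∈ euclideanBall n R := by
    change ∑ i, x i ^ 2 ≤ R ^ 2
    nlinarith [sq_nonneg R]
  have hg := hsq x hxK hpos
  have hg0 : 0 < eval x p.sqGrad := (sq_nonneg _).trans_lt hg
  have hp1 : eval x p ≤ 1 := (hsmall x hxK).le.trans (min_le_right _ _)
  set g := eval x p.sqGrad
  set v := eval x p
  have hc1 : 0 ≤ |B| / ((a ^ 2 / 4) ^ N * (a / 2)) := by positivity
  have hc2 : 0 ≤ (2 * t₀ / a) ^ (N + 1) := by positivity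
  rw [add_mul]
  by_cases ht : t₀ ≤ a * v / (2 * g)
  · have h2 := hB _ ht x hxK (a * v / 2) (by positivity) (by
      have h3 : a * v / (2 * g) * g = a * v / 2 := by field_simp
      have h4 : a * v ≤ (R ^ 2 - ∑ i, x i ^ 2) * v :=
        mul_le_mul_of_nonneg_right (by rw [ha]; linarith) hpos.le
      linarith)
    have h5 : a * v / (2 * g) * (a * v / 2) = a ^ 2 / 4 * v ^ 2 / g := by field_simp; ring
    have h6 : (a ^ 2 / 4 * v ^ 2 / g) ^ N * (a * v / (2 * g)) =
        ((a ^ 2 / 4) ^ N * (a / 2)) * v ^ (2 * N + 1) / g ^ (N + 1) := by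
      rw [div_pow, mul_pow, pow_succ v (2 * N), pow_mul v, pow_succ g N]
      field_simp
    rw [h5, h6, div_le_iff₀ (by positivity)] at h2
    refine le_add_of_le_of_nonneg ?_ (by positivity)
    rw [div_mul_eq_mul_div, le_div_iff₀ (by positivity), mul_comm]
    exact h2.trans (mul_le_mul_of_nonneg_right (le_abs_self B) (by positivity))
  · push Not at ht
    refine le_add_of_nonneg_of_le (by positivity) ?_
    rw [div_lt_iff₀ (by positivity)] at ht
    rw [← mul_pow]
    have h7 : v ≤ 2 * t₀ / a * g := by
      rw [div_mul_eq_mul_div, le_div_iff₀ ha0]; linarith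
    calc v ^ (2 * N + 1) ≤ v ^ (N + 1) := pow_le_pow_of_le_one hpos.le hp1 (by omega)
      _ ≤ _ := by gcongr

end MvPolynomial

theorem Matrix.IsSymm.exists_abs_dotProduct_mulVec_le {n : ℕ} {A : Matrix (Fin n) (Fin n) ℝ}
    (hA : A.IsSymm) : ∃ C : ℝ, ∀ x, |x ⬝ᵥ A.mulVec x| ≤ C * ∑ i, (A.mulVec x) i ^ 2 := by
  obtain ⟨g, hg⟩ := A.mulVecLin.rangeRestrict.exists_rightInverse_of_surjective
    A.mulVecLin.range_rangeRestrict
  let g' := LinearMap.toContinuousLinearMap g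
  refine ⟨n * ‖g'‖, fun x => ?_⟩
  set y := A.mulVec x with hy
  set z := g (A.mulVecLin.rangeRestrict x) with hz
  have hAz : A.mulVec z = y := by
    have h1 := LinearMap.congr_fun hg (A.mulVecLin.rangeRestrict x)
    exact congrArg Subtype.val h1
  have hzn : ‖z‖ ≤ ‖g'‖ * ‖y‖ := g'.le_opNorm (A.mulVecLin.rangeRestrict x)
  have h1 : x ⬝ᵥ y = y ⬝ᵥ z := by
    rw [← hAz, Matrix.dotProduct_mulVec, ← Matrix.mulVec_transpose, hA.eq, ← hy, hAz]
  have hy2 : ‖y‖ ^ 2 ≤ ∑ i, y i ^ 2 := by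
    have h0 : 0 ≤ ∑ i, y i ^ 2 := Finset.sum_nonneg fun i _ => sq_nonneg _
    have : ‖y‖ ≤ √(∑ i, y i ^ 2) :=
      norm_le_of_sum_sq_le (Real.sqrt_nonneg _)
        (show ∑ i, y i ^ 2 ≤ _ by rw [Real.sq_sqrt h0])
    calc ‖y‖ ^ 2 ≤ √(∑ i, y i ^ 2) ^ 2 := by gcongr
      _ = _ := Real.sq_sqrt h0
  rw [h1]
  calc |y ⬝ᵥ z| ≤ ∑ i, |y i * z i| := Finset.abs_sum_le_sum_abs _ _
    _ ≤ ∑ _i : Fin n, ‖y‖ * (‖g'‖ * ‖y‖) := by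
        refine Finset.sum_le_sum fun i _ => ?_
        rw [abs_mul]
        exact mul_le_mul (norm_le_pi_norm y i) ((norm_le_pi_norm z i).trans hzn)
          (abs_nonneg _) (norm_nonneg _)
    _ = n * ‖g'‖ * ‖y‖ ^ 2 := by simp; ring
    _ ≤ _ := by gcongr

namespace MvPolynomial

theorem pderiv_pderiv_comm {σ : Type*} (i j : σ) (p : MvPolynomial σ ℝ) :
    pderiv i (pderiv j p) = pderiv j (pderiv i p) := by
  classical
  have h : ⁅pderiv (R := ℝ) i, pderiv (R := ℝ) j⁆ = 0 := by
    refine derivation_ext fun l => ?_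
    rw [Derivation.commutator_apply, pderiv_X, pderiv_X]
    simp only [Pi.single_apply]
    split_ifs <;> simp
  have h1 := congrArg (fun D => D p) h
  simpa only [Derivation.commutator_apply, Derivation.zero_apply, sub_eq_zero] using h1

theorem eval_eq_of_totalDegree_le_one {n : ℕ} (q : MvPolynomial (Fin n) ℝ)
    (hq : q.totalDegree ≤ 1) (x : Fin n → ℝ) :
    eval x q = eval 0 q + ∑ j, eval 0 (pderiv j q) * x j := by
  have hconst : ∀ j y, eval y (pderiv j q) = eval 0 (pderiv j q) := by
    intro j y
    have h1 : (pderiv j q).totalDegree = 0 := by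
      have := totalDegree_pderiv_le j q; omega
    rw [totalDegree_eq_zero_iff_eq_C.1 h1, eval_C, eval_C]
  have hder : ∀ t : ℝ, HasDerivAt (fun t : ℝ => eval (fun i => t * x i) q -
      t * ∑ j, eval 0 (pderiv j q) * x j) 0 t := by
    intro t
    have h1 := hasDerivAt_eval q (fun t i => t * x i) x t fun i => by
      simpa using (hasDerivAt_id t).mul_const (x i)
    have h2 := (hasDerivAt_id t).mul_const (∑ j, eval 0 (pderiv j q) * x j)
    refine (h1.sub h2).congr_deriv ?_
    simp [hconst]
  have h := is_const_of_deriv_eq_zero (fun t => (hder t).differentiableAt)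
    (fun t => (hder t).deriv) 1 0
  simp only [one_mul, zero_mul, sub_zero] at h
  change eval x q - _ = eval 0 q at h
  linarith

theorem two_mul_eval_eq_of_totalDegree_le_two {n : ℕ} (p : MvPolynomial (Fin n) ℝ)
    (hp : p.totalDegree ≤ 2) (h0 : eval 0 p = 0) (hg : ∀ i, eval 0 (pderiv i p) = 0)
    (x : Fin n → ℝ) : 2 * eval x p = ∑ i, eval x (pderiv i p) * x i := by
  have hlin : ∀ i y, eval y (pderiv i p) = ∑ j, eval 0 (pderiv j (pderiv i p)) * y j := by
    intro i y
    rw [eval_eq_of_totalDegree_le_one (pderiv i p)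
      (by have := totalDegree_pderiv_le i p; omega) y, hg, zero_add]
  have hhom : ∀ i (t : ℝ), eval (fun i => t * x i) (pderiv i p) = t * eval x (pderiv i p) := by
    intro i t
    rw [hlin, hlin i x, Finset.mul_sum]
    exact Finset.sum_congr rfl fun j _ => by ring
  have hder : ∀ t : ℝ, HasDerivAt (fun t : ℝ => 2 * eval (fun i => t * x i) p -
      t ^ 2 * ∑ i, eval x (pderiv i p) * x i) 0 t := by
    intro t
    have h1 := hasDerivAt_eval p (fun t i => t * x i) x t fun i => by
      simpa using (hasDerivAt_id t).mul_const (x i)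
    have h2 := (hasDerivAt_pow 2 t).mul_const (∑ i, eval x (pderiv i p) * x i)
    refine ((h1.const_mul 2).sub h2).congr_deriv ?_
    simp only [hhom, Finset.mul_sum]
    rw [sub_eq_zero]
    refine Finset.sum_congr rfl fun j _ => ?_
    push_cast
    ring
  have h := is_const_of_deriv_eq_zero (fun t => (hder t).differentiableAt)
    (fun t => (hder t).deriv) 1 0
  simp only [one_mul, zero_mul, one_pow, ne_eq, OfNat.ofNat_ne_zero, not_false_eq_true,
    zero_pow, sub_zero] at h
  change 2 * eval x p - _ = 2 * eval 0 p at h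
  rw [h0] at h
  linarith

theorem exists_abs_le_mul_sqGrad_of_totalDegree_le_two {n : ℕ} (p : MvPolynomial (Fin n) ℝ)
    (hp : p.totalDegree ≤ 2) (h0 : eval 0 p = 0) (hg : ∀ i, eval 0 (pderiv i p) = 0) :
    ∃ C, ∀ x, |eval x p| ≤ C * eval x p.sqGrad := by
  let A : Matrix (Fin n) (Fin n) ℝ := Matrix.of fun i j => eval 0 (pderiv j (pderiv i p))
  have hA : A.IsSymm := by
    ext i j
    simp only [A, Matrix.transpose_apply, Matrix.of_apply]
    rw [pderiv_pderiv_comm]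
  have hAx : ∀ x, A.mulVec x = fun i => eval x (pderiv i p) := by
    intro x
    funext i
    rw [eval_eq_of_totalDegree_le_one (pderiv i p)
      (by have := totalDegree_pderiv_le i p; omega) x, hg, zero_add]
    rfl
  obtain ⟨C, hC⟩ := hA.exists_abs_dotProduct_mulVec_le
  refine ⟨C / 2, fun x => ?_⟩
  have h1 := hC x
  have h2 := two_mul_eval_eq_of_totalDegree_le_two p hp h0 hg x
  have h3 : x ⬝ᵥ A.mulVec x = 2 * eval x p := by
    rw [h2, hAx]
    exact Finset.sum_congr rfl fun i _ => mul_comm _ _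
  rw [h3, abs_mul, abs_two, hAx] at h1
  rw [eval_sqGrad]
  linarith

theorem sqGrad_neg {n : ℕ} (p : MvPolynomial (Fin n) ℝ) : (-p).sqGrad = p.sqGrad := by
  simp [sqGrad]

theorem exists_abs_pow_le_sqGrad_pow {n : ℕ} (p : MvPolynomial (Fin n) ℝ) (e : ℕ)
    (he : p.totalDegree + 2 ≤ e) (he' : 2 * (p.totalDegree - 1) ≤ e) (h0 : eval 0 p = 0) :
    ∃ C : ℝ, ∀ᶠ x : Fin n → ℝ in 𝓝 0,
      |eval x p| ^ (2 * e ^ n + 1) ≤ C * eval x p.sqGrad ^ (e ^ n + 1) := by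
  obtain ⟨C₁, h₁⟩ := exists_pow_le_sqGrad_pow_of_pos p e he he' h0
  obtain ⟨C₂, h₂⟩ := exists_pow_le_sqGrad_pow_of_pos (-p) e (by rwa [totalDegree_neg])
    (by rwa [totalDegree_neg]) (by rw [map_neg, h0, neg_zero])
  refine ⟨max 0 (max C₁ C₂), ?_⟩
  filter_upwards [h₁, h₂] with x hx₁ hx₂
  have hg : 0 ≤ eval x p.sqGrad ^ (e ^ n + 1) := pow_nonneg (eval_sqGrad_nonneg p x) _
  rcases lt_trichotomy (eval x p) 0 with h | h | h
  · have := hx₂ (by simpa using h)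
    rw [sqGrad_neg, map_neg, ← abs_of_neg h] at this
    exact this.trans (mul_le_mul_of_nonneg_right
      ((le_max_right _ _).trans (le_max_right _ _)) hg)
  · rw [h, abs_zero, zero_pow (by omega)]
    exact mul_nonneg (le_max_left _ _) hg
  · have := hx₁ h
    rw [abs_of_pos h]
    exact this.trans (mul_le_mul_of_nonneg_right
      ((le_max_left _ _).trans (le_max_right _ _)) hg)

theorem four_mul_pow_add_two_le (d n : ℕ) (hd : 3 ≤ d) (hn : 1 ≤ n) :
    4 * (max (d + 2) (2 * (d - 1))) ^ n + 2 ≤ d * (3 * d - 2) ^ n + 1 := by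
  rcases hd.eq_or_lt with rfl | hd
  · induction n, hn using Nat.le_induction with
    | base => norm_num
    | succ n hn ih =>
      norm_num [pow_succ] at ih ⊢
      omega
  · have h1 : max (d + 2) (2 * (d - 1)) < 3 * d - 2 := by omega
    have h2 := Nat.pow_lt_pow_left h1 (by omega : n ≠ 0)
    have h3 : 4 * (3 * d - 2) ^ n ≤ d * (3 * d - 2) ^ n := Nat.mul_le_mul_right _ hd
    omega

/-- An effective Łojasiewicz gradient inequality for polynomials. -/
theorem exists_effective_gradient_inequality {n : ℕ} (p : MvPolynomial (Fin n) ℝ) (d : ℕ)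
    (hd : p.totalDegree ≤ d) (hd1 : 1 ≤ d) (hn : 1 ≤ n) (h0 : eval 0 p = 0) :
    ∃ (N : ℕ) (C : ℝ), 4 * N + 2 ≤ d * (3 * d - 2) ^ n + 1 ∧ ∀ᶠ x : Fin n → ℝ in 𝓝 0,
      |eval x p| ^ (2 * N + 1) ≤ C * eval x p.sqGrad ^ (N + 1) := by
  have hN0 : 4 * 0 + 2 ≤ d * (3 * d - 2) ^ n + 1 := by
    have : 0 < d * (3 * d - 2) ^ n := Nat.mul_pos hd1 (pow_pos (by omega) n)
    omega
  by_cases hg : ∀ i, eval 0 (pderiv i p) = 0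
  · by_cases h2 : p.totalDegree ≤ 2
    · obtain ⟨C, hC⟩ := exists_abs_le_mul_sqGrad_of_totalDegree_le_two p h2 h0 hg
      exact ⟨0, C, hN0, Eventually.of_forall fun x => by simpa using hC x⟩
    · obtain ⟨C, hC⟩ := exists_abs_pow_le_sqGrad_pow p (max (d + 2) (2 * (d - 1)))
        (by omega) (by omega) h0
      exact ⟨_, C, four_mul_pow_add_two_le d n (by omega) hn, hC⟩
  · have hg0 : 0 < eval 0 p.sqGrad := by
      push Not at hg
      obtain ⟨i, hi⟩ := hg
      rw [eval_sqGrad]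
      exact Finset.sum_pos' (fun i _ => sq_nonneg _) ⟨i, Finset.mem_univ i, by positivity⟩
    refine ⟨0, 2 / eval 0 p.sqGrad, hN0, ?_⟩
    have h1 : ∀ᶠ x : Fin n → ℝ in 𝓝 0, |eval x p| < 1 :=
      (continuous_eval p).abs.continuousAt.eventually_lt_const
      (by simp only [h0, abs_zero, zero_lt_one])
    have h2 : ∀ᶠ x : Fin n → ℝ in 𝓝 0, eval 0 p.sqGrad / 2 < eval x p.sqGrad :=
      (continuous_eval p.sqGrad).continuousAt.eventually_const_lt (by linarith)
    filter_upwards [h1, h2] with x hx1 hx2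
    simp only [mul_zero, zero_add, pow_one]
    rw [div_mul_eq_mul_div, le_div_iff₀ hg0]
    nlinarith [abs_nonneg (eval x p)]

end MvPolynomial

namespace MvPolynomial

theorem totalDegree_bind₁_le {σ τ : Type*} (g : σ → MvPolynomial τ ℝ)
    (hg : ∀ i, (g i).totalDegree ≤ 1) (P : MvPolynomial σ ℝ) :
    (bind₁ g P).totalDegree ≤ P.totalDegree := by
  classical
  conv_lhs => rw [P.as_sum, map_sum]
  refine (totalDegree_finsetSum _ _).trans (Finset.sup_le fun m hm => ?_)
  rw [bind₁_monomial]
  refine (totalDegree_mul _ _).trans ?_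
  rw [totalDegree_C, zero_add]
  refine (totalDegree_finsetProd _ _).trans (le_trans ?_ (le_totalDegree hm))
  refine Finset.sum_le_sum fun i _ => (totalDegree_pow _ _).trans ?_
  simpa using Nat.mul_le_mul_left (m i) (hg i)

/-- The polynomial `P(x, 0)`. -/
noncomputable def restrictLastZero {n : ℕ} (P : MvPolynomial (Fin (n + 1)) ℝ) :
    MvPolynomial (Fin n) ℝ :=
  bind₁ (Fin.snoc (α := fun _ => MvPolynomial (Fin n) ℝ) X 0) P

theorem totalDegree_restrictLastZero_le {n : ℕ} (P : MvPolynomial (Fin (n + 1)) ℝ) :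
    P.restrictLastZero.totalDegree ≤ P.totalDegree :=
  totalDegree_bind₁_le _ (fun i => by induction i using Fin.lastCases <;> simp [totalDegree_X]) P

theorem eval_restrictLastZero {n : ℕ} (P : MvPolynomial (Fin (n + 1)) ℝ) (x : Fin n → ℝ) :
    eval x P.restrictLastZero = eval (Fin.snoc (α := fun _ => ℝ) x 0) P := by
  have h := eval₂Hom_bind₁ (RingHom.id ℝ) x
    (Fin.snoc (α := fun _ => MvPolynomial (Fin n) ℝ) X 0) P
  have h2 : (fun i => eval₂Hom (RingHom.id ℝ) x
      (Fin.snoc (α := fun _ => MvPolynomial (Fin n) ℝ) X 0 i)) =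
      Fin.snoc (α := fun _ => ℝ) x 0 := by
    funext i
    induction i using Fin.lastCases <;> simp
  rw [h2] at h
  exact h

theorem hasDerivAt_eval_snoc {n : ℕ} (P : MvPolynomial (Fin (n + 1)) ℝ) (u : ℝ → Fin n → ℝ)
    (y : ℝ → ℝ) (i : Fin n) (y' s : ℝ)
    (hu : ∀ j, HasDerivAt (fun r => u r j) ((Pi.single i 1 : Fin n → ℝ) j) s)
    (hy : HasDerivAt y y' s) :
    HasDerivAt (fun r => eval (Fin.snoc (α := fun _ => ℝ) (u r) (y r)) P)
      (eval (Fin.snoc (α := fun _ => ℝ) (u s) (y s)) (pderiv i.castSucc P) +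
        eval (Fin.snoc (α := fun _ => ℝ) (u s) (y s)) (pderiv (Fin.last n) P) * y') s := by
  have h := hasDerivAt_eval P (fun r => Fin.snoc (α := fun _ => ℝ) (u r) (y r))
    (Fin.snoc (α := fun _ => ℝ) (Pi.single i 1) y') s fun j => by
      induction j using Fin.lastCases with
      | last => simpa using hy
      | cast j => simpa using hu j
  refine h.congr_deriv ?_
  rw [Fin.sum_univ_castSucc]
  simp [Pi.single_apply]

theorem eval_pderiv_restrictLastZero {n : ℕ} (P : MvPolynomial (Fin (n + 1)) ℝ) (x : Fin n → ℝ)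
    (i : Fin n) : eval x (pderiv i P.restrictLastZero) =
      eval (Fin.snoc (α := fun _ => ℝ) x 0) (pderiv i.castSucc P) := by
  have hu : ∀ j, HasDerivAt (fun r : ℝ => (x + r • (Pi.single i 1 : Fin n → ℝ)) j)
      ((Pi.single i 1 : Fin n → ℝ) j) 0 := fun j => by
    simpa using ((hasDerivAt_id (0 : ℝ)).mul_const ((Pi.single i 1 : Fin n → ℝ) j)).const_add (x j)
  have h1 := hasDerivAt_eval P.restrictLastZero _ _ 0 hu
  have h2 := hasDerivAt_eval_snoc P _ (fun _ => 0) i 0 0 hu (hasDerivAt_const _ _)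
  simp only [← eval_restrictLastZero] at h2
  have h3 := h1.unique h2
  simp only [zero_smul, add_zero, mul_zero] at h3
  simpa [Pi.single_apply, eval_restrictLastZero] using h3

end MvPolynomial

namespace MvPolynomial

theorem norm_snoc_sub_snoc_zero {n : ℕ} (x : Fin n → ℝ) (y : ℝ) :
    ‖(Fin.snoc x 0 : Fin (n + 1) → ℝ) - Fin.snoc x y‖ = |y| := by
  refine le_antisymm ((pi_norm_le_iff_of_nonneg (abs_nonneg y)).2 fun i => ?_) ?_
  · induction i using Fin.lastCases <;> simp
  · have := norm_le_pi_norm ((Fin.snoc x 0 : Fin (n + 1) → ℝ) - Fin.snoc x y) (Fin.last n)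
    simpa using this

section Implicit

variable {n : ℕ} (f : EuclideanSpace ℝ (Fin n) → ℝ) (P : MvPolynomial (Fin (n + 1)) ℝ)

theorem continuousAt_snoc_ofLp {x : EuclideanSpace ℝ (Fin n)} (hf : ContinuousAt f x) :
    ContinuousAt (fun x : EuclideanSpace ℝ (Fin n) =>
      (Fin.snoc (fun i => x i) (f x) : Fin (n + 1) → ℝ)) x := by
  refine continuousAt_pi.2 fun i => ?_
  induction i using Fin.lastCases with
  | last => simpa using hf
  | cast j => simp only [Fin.snoc_castSucc]; fun_prop

theorem snoc_zero_zero : (Fin.snoc (fun _ => 0) 0 : Fin (n + 1) → ℝ) = 0 := by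
  funext i
  induction i using Fin.lastCases <;> simp

theorem eventually_norm_snoc_le (hf : ContinuousAt f 0) (hf0 : f 0 = 0) :
    ∀ᶠ x : EuclideanSpace ℝ (Fin n) in 𝓝 0,
      ‖(Fin.snoc (fun i => x i) (f x) : Fin (n + 1) → ℝ)‖ ≤ 1 := by
  have h := (continuousAt_snoc_ofLp f hf).norm
  refine (h.eventually_lt_const (by simp [hf0, snoc_zero_zero])).mono fun x hx => le_of_lt hx

theorem exists_abs_le_mul_abs_restrictLastZero (hf : ContinuousAt f 0) (hf0 : f 0 = 0)
    (hPf : ∀ᶠ x : EuclideanSpace ℝ (Fin n) in 𝓝 0,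
      eval (Fin.snoc (fun i => x i) (f x) : Fin (n + 1) → ℝ) P = 0)
    (hPy : eval 0 (pderiv (Fin.last n) P) ≠ 0) :
    ∃ C : ℝ, 0 ≤ C ∧ ∀ᶠ x : EuclideanSpace ℝ (Fin n) in 𝓝 0,
      |f x| ≤ C * |eval (fun i => x i) P.restrictLastZero| := by
  obtain ⟨B, hB0, hB⟩ := exists_taylor_bound P 1
  set c := |eval 0 (pderiv (Fin.last n) P)| with hc
  have hc0 : 0 < c := abs_pos.2 hPy
  have h1 : ∀ᶠ x : EuclideanSpace ℝ (Fin n) in 𝓝 0, c / 2 <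
      |eval (Fin.snoc (fun i => x i) (f x) : Fin (n + 1) → ℝ) (pderiv (Fin.last n) P)| := by
    have h := ((continuous_eval (pderiv (Fin.last n) P)).continuousAt.comp
      (continuousAt_snoc_ofLp f hf)).abs
    refine h.eventually_const_lt ?_
    simp only [Function.comp_apply, hf0, PiLp.zero_apply, snoc_zero_zero]
    linarith
  have h2 : ∀ᶠ x : EuclideanSpace ℝ (Fin n) in 𝓝 0, (B + 1) * |f x| < c / 4 :=
    (hf.abs.const_mul (B + 1)).eventually_lt_const (by simp only [hf0]; simpa using hc0)
  refine ⟨4 / c, by positivity, ?_⟩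
  filter_upwards [h1, h2, hPf, eventually_norm_snoc_le f hf hf0,
    eventually_norm_snoc_le (fun _ => 0) continuousAt_const rfl] with x hx1 hx2 hx3 hx4 hx5
  have h := (hB _ _ hx5 hx4).2.2
  rw [hx3, norm_snoc_sub_snoc_zero, Fin.sum_univ_castSucc, ← eval_restrictLastZero] at h
  simp only [Fin.snoc_castSucc, Fin.snoc_last, sub_self, mul_zero, Finset.sum_const_zero,
    zero_add, sub_zero, zero_sub, mul_neg, sub_neg_eq_add, sq_abs] at h
  set q := eval (Fin.snoc (fun i => x i) (f x) : Fin (n + 1) → ℝ) (pderiv (Fin.last n) P)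
  set v := eval (fun i => x i) P.restrictLastZero
  have h3 : |q * f x| ≤ |v| + B * f x ^ 2 := by
    have : q * f x = (v + q * f x) - v := by ring
    rw [this]
    refine (abs_sub _ _).trans ?_
    linarith
  rw [abs_mul] at h3
  have h4 : B * f x ^ 2 ≤ c / 4 * |f x| := by
    rw [← sq_abs, sq, ← mul_assoc]
    refine mul_le_mul_of_nonneg_right ?_ (abs_nonneg _)
    nlinarith [abs_nonneg (f x)]
  rw [div_mul_eq_mul_div, le_div_iff₀ hc0]
  nlinarith [mul_le_mul_of_nonneg_right hx1.le (abs_nonneg (f x))]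

theorem exists_sqGrad_restrictLastZero_le (hfd : ∀ᶠ x in 𝓝 0, DifferentiableAt ℝ f x)
    (hf0 : f 0 = 0) (hPf : ∀ᶠ x : EuclideanSpace ℝ (Fin n) in 𝓝 0,
      eval (Fin.snoc (fun i => x i) (f x) : Fin (n + 1) → ℝ) P = 0) :
    ∃ C : ℝ, 0 ≤ C ∧ ∀ᶠ x : EuclideanSpace ℝ (Fin n) in 𝓝 0,
      eval (fun i => x i) P.restrictLastZero.sqGrad ≤ C * (‖fderiv ℝ f x‖ + |f x|) ^ 2 := by
  have hf : ContinuousAt f 0 := hfd.self_of_nhds.continuousAt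
  choose B hB0 hB using fun i => exists_taylor_bound (pderiv i P) 1
  set K := ∑ i, B i with hK
  have hK0 : 0 ≤ K := Finset.sum_nonneg fun i _ => hB0 i
  have hBK : ∀ i, B i ≤ K := fun i =>
    Finset.single_le_sum (f := B) (fun i _ => hB0 i) (Finset.mem_univ i)
  refine ⟨n * K ^ 2, by positivity, ?_⟩
  filter_upwards [hfd, hPf.eventually_nhds, eventually_norm_snoc_le f hf hf0,
    eventually_norm_snoc_le (fun _ => 0) continuousAt_const rfl] with x hx1 hx2 hx3 hx4
  have hcoord : ∀ i, |eval (fun i => x i) (pderiv i P.restrictLastZero)| ≤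
      K * (‖fderiv ℝ f x‖ + |f x|) := by
    intro i
    set e : EuclideanSpace ℝ (Fin n) := EuclideanSpace.single i 1 with he
    have hline : HasDerivAt (fun r : ℝ => x + r • e) e 0 := by
      simpa using ((hasDerivAt_id (0 : ℝ)).smul_const e).const_add x
    have hfl : HasDerivAt (fun r : ℝ => f (x + r • e)) (fderiv ℝ f x e) 0 := by
      have h1 : HasFDerivAt f (fderiv ℝ f x) (x + (0 : ℝ) • e) := by
        simpa using hx1.hasFDerivAt
      exact h1.comp_hasDerivAt 0 hline
    have hu : ∀ j, HasDerivAt (fun r : ℝ => (x + r • e) j) ((Pi.single i 1 : Fin n → ℝ) j) 0 := by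
      intro j
      have := ((hasDerivAt_id (0 : ℝ)).mul_const ((Pi.single i 1 : Fin n → ℝ) j)).const_add (x j)
      simpa [he, Pi.single_apply] using this
    have h1 := hasDerivAt_eval_snoc P (fun r j => (x + r • e) j) _ i _ 0 hu hfl
    have h2 : (fun r : ℝ => eval (Fin.snoc (fun j => (x + r • e) j) (f (x + r • e)) :
        Fin (n + 1) → ℝ) P) =ᶠ[𝓝 0] fun _ => 0 := by
      have : Tendsto (fun r : ℝ => x + r • e) (𝓝 0) (𝓝 x) := by
        simpa [ContinuousAt] using hline.continuousAt
      exact this.eventually hx2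
    have h3 := h1.unique ((hasDerivAt_const (0 : ℝ) (0 : ℝ)).congr_of_eventuallyEq h2)
    simp only [zero_smul, add_zero] at h3
    have h4 := (hB i.castSucc _ _ hx4 hx3).2.1
    rw [norm_snoc_sub_snoc_zero, ← eval_pderiv_restrictLastZero] at h4
    have h5 := (hB (Fin.last n) _ _ hx3 hx3).1
    have h6 : |fderiv ℝ f x e| ≤ ‖fderiv ℝ f x‖ := by
      have := (fderiv ℝ f x).le_opNorm e
      rwa [he, PiLp.norm_single, norm_one, mul_one] at this
    set a := eval (Fin.snoc (fun i => x i) (f x) : Fin (n + 1) → ℝ) (pderiv i.castSucc P)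
    set q := eval (Fin.snoc (fun i => x i) (f x) : Fin (n + 1) → ℝ) (pderiv (Fin.last n) P)
    set v := eval (fun i => x i) (pderiv i P.restrictLastZero)
    have h7 : |a| ≤ K * ‖fderiv ℝ f x‖ := by
      rw [eq_neg_of_add_eq_zero_left h3, abs_neg, abs_mul]
      exact mul_le_mul (h5.trans (hBK _)) h6 (abs_nonneg _) hK0
    have h8 : |v - a| ≤ K * |f x| :=
      h4.trans (mul_le_mul_of_nonneg_right (hBK _) (abs_nonneg _))
    calc |v| = |(v - a) + a| := by ring_nf
      _ ≤ |v - a| + |a| := abs_add_le _ _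
      _ ≤ _ := by linarith
  rw [eval_sqGrad]
  calc ∑ i, eval (fun i => x i) (pderiv i P.restrictLastZero) ^ 2
      ≤ ∑ _i : Fin n, (K * (‖fderiv ℝ f x‖ + |f x|)) ^ 2 := by
        refine Finset.sum_le_sum fun i _ => ?_
        rw [← sq_abs]
        have := hcoord i
        gcongr
    _ = _ := by simp; ring

/-- An effective Łojasiewicz gradient inequality for Nash functions with `∂P/∂y ≠ 0`. -/
theorem exists_effective_gradient_inequality_of_implicit (hn : 1 ≤ n)
    (hfd : ∀ᶠ x in 𝓝 0, DifferentiableAt ℝ f x)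
    (hf0 : f 0 = 0) (hPf : ∀ᶠ x : EuclideanSpace ℝ (Fin n) in 𝓝 0,
      eval (Fin.snoc (fun i => x i) (f x) : Fin (n + 1) → ℝ) P = 0)
    (hPy : eval 0 (pderiv (Fin.last n) P) ≠ 0) :
    ∃ (N : ℕ) (C : ℝ), 4 * N + 2 ≤ P.totalDegree * (3 * P.totalDegree - 2) ^ n + 1 ∧
      ∀ᶠ x in 𝓝 0, |f x| ^ (2 * N + 1) ≤ C * ‖fderiv ℝ f x‖ ^ (2 * N + 2) := by
  have hf : ContinuousAt f 0 := hfd.self_of_nhds.continuousAt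
  have hd1 : 1 ≤ P.totalDegree := by
    by_contra! h
    rw [Nat.lt_one_iff, totalDegree_eq_zero_iff_eq_C] at h
    rw [h, pderiv_C, map_zero] at hPy
    exact hPy rfl
  have hp0 : eval 0 P.restrictLastZero = 0 := by
    have h := hPf.self_of_nhds
    rw [eval_restrictLastZero]
    rw [hf0] at h
    exact h
  obtain ⟨N, C, hN, hC⟩ := exists_effective_gradient_inequality P.restrictLastZero P.totalDegree
    P.totalDegree_restrictLastZero_le hd1 hn hp0
  obtain ⟨A, hA0, hA⟩ := exists_abs_le_mul_abs_restrictLastZero f P hf hf0 hPf hPy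
  obtain ⟨B, hB0, hB⟩ := exists_sqGrad_restrictLastZero_le f P hfd hf0 hPf
  set M := A ^ (2 * N + 1) * (|C| * B ^ (N + 1) * 2 ^ (2 * N + 1)) with hM
  have hM0 : 0 ≤ M := by positivity
  have hC' : ∀ᶠ x : EuclideanSpace ℝ (Fin n) in 𝓝 0,
      |eval (fun i => x i) P.restrictLastZero| ^ (2 * N + 1) ≤
        C * eval (fun i => x i) P.restrictLastZero.sqGrad ^ (N + 1) := by
    have hcont : ContinuousAt (fun (x : EuclideanSpace ℝ (Fin n)) (i : Fin n) => x i) 0 := by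
      fun_prop
    exact hcont.eventually (p := fun z : Fin n → ℝ => |eval z P.restrictLastZero| ^ (2 * N + 1) ≤
      C * eval z P.restrictLastZero.sqGrad ^ (N + 1)) hC
  have hsmall : ∀ᶠ x in 𝓝 0, M * |f x| < 1 / 2 :=
    (hf.abs.const_mul M).eventually_lt_const (by simp [hf0])
  refine ⟨N, 2 * M, hN, ?_⟩
  filter_upwards [hA, hB, hC', hsmall] with x hxA hxB hxC hxs
  set v := |eval (fun i => x i) P.restrictLastZero|
  set g := eval (fun i => x i) P.restrictLastZero.sqGrad with hgdef
  have hg0 : 0 ≤ g := eval_sqGrad_nonneg _ _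
  set D := ‖fderiv ℝ f x‖
  have hD0 : 0 ≤ D := norm_nonneg _
  have hf0' : 0 ≤ |f x| := abs_nonneg _
  have h1 : |f x| ^ (2 * N + 1) ≤ M * (D ^ (2 * N + 2) + |f x| ^ (2 * N + 2)) := by
    calc |f x| ^ (2 * N + 1) ≤ (A * v) ^ (2 * N + 1) := by gcongr
      _ = A ^ (2 * N + 1) * v ^ (2 * N + 1) := mul_pow _ _ _
      _ ≤ A ^ (2 * N + 1) * (|C| * (B * (D + |f x|) ^ 2) ^ (N + 1)) := by
          have : C * g ^ (N + 1) ≤ |C| * (B * (D + |f x|) ^ 2) ^ (N + 1) := by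
            refine mul_le_mul (le_abs_self C) (by gcongr) (by positivity) (abs_nonneg C)
          have := hxC.trans this
          gcongr
      _ = A ^ (2 * N + 1) * (|C| * B ^ (N + 1) * (D + |f x|) ^ (2 * N + 2)) := by
          rw [mul_pow, ← pow_mul, mul_assoc |C|, show 2 * (N + 1) = 2 * N + 2 by ring]
      _ ≤ A ^ (2 * N + 1) * (|C| * B ^ (N + 1) *
          (2 ^ (2 * N + 1) * (D ^ (2 * N + 2) + |f x| ^ (2 * N + 2)))) := by
          have := add_pow_le hD0 hf0' (2 * N + 2)
          simp only [Nat.add_succ_sub_one] at this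
          gcongr
      _ = _ := by rw [hM]; ring
  have h2 : M * |f x| ^ (2 * N + 2) ≤ 1 / 2 * |f x| ^ (2 * N + 1) := by
    rw [pow_succ |f x| (2 * N + 1), mul_comm (|f x| ^ (2 * N + 1)), ← mul_assoc]
    gcongr
  linarith

end Implicit

end MvPolynomial

section Descent

variable {E : Type*} [NormedAddCommGroup E] [NormedSpace ℝ E]

theorem HasFDerivAt.norm_le_of_eventually_ge {φ : E → ℝ} {φ' : E →L[ℝ] ℝ} {y : E} {K : ℝ}
    (hφ : HasFDerivAt φ φ' y) (hK : 0 ≤ K)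
    (h : ∀ᶠ z in 𝓝 y, φ y - K * ‖z - y‖ ≤ φ z) : ‖φ'‖ ≤ K := by
  have key : ∀ v, -(K * ‖v‖) ≤ φ' v := by
    intro v
    have hline : HasDerivAt (fun t : ℝ => y + t • v) v 0 := by
      simpa using ((hasDerivAt_id (0 : ℝ)).smul_const v).const_add y
    have h1 : HasFDerivAt φ φ' (y + (0 : ℝ) • v) := by simpa using hφ
    have hd : HasDerivAt (fun t : ℝ => φ (y + t • v)) (φ' v) 0 := h1.comp_hasDerivAt 0 hline
    have hs := hasDerivAt_iff_tendsto_slope_zero.1 hd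
    have hs' := hs.mono_left (nhdsGT_le_nhdsNE (0 : ℝ))
    refine ge_of_tendsto hs' ?_
    have ht : Tendsto (fun t : ℝ => y + t • v) (𝓝 0) (𝓝 y) := by
      simpa [ContinuousAt] using hline.continuousAt
    filter_upwards [nhdsWithin_le_nhds (ht.eventually h), self_mem_nhdsWithin] with t ht1 ht0
    have ht0' : 0 < t := ht0
    simp only [zero_add, zero_smul, add_zero, smul_eq_mul]
    rw [add_sub_cancel_left, norm_smul, Real.norm_of_nonneg ht0'.le] at ht1
    rw [inv_mul_eq_div, le_div_iff₀ ht0']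
    linarith
  refine φ'.opNorm_le_bound hK fun v => ?_
  rw [Real.norm_eq_abs, abs_le]
  refine ⟨key v, ?_⟩
  have := key (-v)
  rw [norm_neg, map_neg] at this
  linarith

theorem HasFDerivAt.norm_le_of_eventually_abs_ge {φ : E → ℝ} {φ' : E →L[ℝ] ℝ} {y : E} {K : ℝ}
    (hφ : HasFDerivAt φ φ' y) (hK : 0 ≤ K) (hy : φ y ≠ 0)
    (h : ∀ᶠ z in 𝓝 y, |φ y| - K * ‖z - y‖ ≤ |φ z|) : ‖φ'‖ ≤ K := by
  rcases lt_or_gt_of_ne hy with hneg | hpos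
  · rw [← norm_neg]
    refine hφ.neg.norm_le_of_eventually_ge hK ?_
    filter_upwards [h, hφ.continuousAt.eventually_lt_const hneg] with z hz hz'
    rwa [_root_.abs_of_neg hneg, _root_.abs_of_neg hz'] at hz
  · refine hφ.norm_le_of_eventually_ge hK ?_
    filter_upwards [h, hφ.continuousAt.eventually_const_lt hpos] with z hz hz'
    rwa [_root_.abs_of_pos hpos, _root_.abs_of_pos hz'] at hz

theorem sub_mul_pow_le_sub_pow {h δ : ℝ} (hh : 0 < h) (hδ : δ ≤ h) (m : ℕ) :
    h ^ (m + 1) - (m + 1) * h ^ m * δ ≤ (h - δ) ^ (m + 1) := by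
  have h1 : -2 ≤ -(δ / h) := by
    have : δ / h ≤ 1 := (div_le_one hh).2 hδ
    linarith
  have h2 := one_add_mul_le_pow h1 (m + 1)
  have h3 : h - δ = h * (1 + -(δ / h)) := by field_simp; ring
  rw [h3, mul_pow]
  have h4 : h ^ (m + 1) - (m + 1) * h ^ m * δ = h ^ (m + 1) * (1 + (m + 1 : ℕ) * -(δ / h)) := by
    push_cast
    field_simp
    ring
  rw [h4]
  gcongr

/-- A gradient inequality implies a bound on the distance to the zero set. -/
theorem exists_zero_near_of_gradient_inequality [ProperSpace E] (f : E → ℝ)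
    (hf0 : f 0 = 0) (hfd : ∀ᶠ x in 𝓝 0, DifferentiableAt ℝ f x) (m : ℕ) (C : ℝ)
    (hL : ∀ᶠ x in 𝓝 0, |f x| ^ m ≤ C * ‖fderiv ℝ f x‖ ^ (m + 1)) :
    ∃ A : ℝ, 0 ≤ A ∧ ∀ᶠ x in 𝓝 0, ∃ z, f z = 0 ∧ ‖x - z‖ ≤ ‖x‖ ∧
      ‖x - z‖ ^ (m + 1) ≤ A * |f x| := by
  obtain ⟨r, hr, hball⟩ := Metric.eventually_nhds_iff_ball.1 (hfd.and hL)
  set K := |C| + 1 with hK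
  have hK1 : 1 ≤ K := by have := abs_nonneg C; linarith
  set c : ℝ := 1 / ((m + 1) * (2 * K)) with hc
  have hc0 : 0 < c := by positivity
  have hcK : ((m + 1) * c) ^ (m + 1) * K < 1 := by
    have h1 : (m + 1) * c = 1 / (2 * K) := by rw [hc]; field_simp
    rw [h1, div_pow, one_pow, div_mul_eq_mul_div, one_mul, div_lt_one (by positivity)]
    have h2 : (2 * K) ^ 1 ≤ (2 * K) ^ (m + 1) :=
      pow_le_pow_right₀ (by linarith) (by omega)
    linarith
  set h : E → ℝ := fun y => |f y| ^ ((m + 1 : ℕ) : ℝ)⁻¹ with hh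
  have hhm : ∀ y, h y ^ (m + 1) = |f y| := fun y =>
    Real.rpow_inv_natCast_pow (abs_nonneg _) (by omega)
  have hh0 : ∀ y, 0 ≤ h y := fun y => Real.rpow_nonneg (abs_nonneg _) _
  have hhz : ∀ y, f y = 0 → h y = 0 := fun y hy => by
    have := hhm y
    rw [hy, abs_zero] at this
    exact pow_eq_zero_iff (by omega) |>.1 this
  have hcont : ContinuousOn h (Metric.closedBall 0 (r / 2)) := by
    intro y hy
    have hy' : y ∈ Metric.ball (0 : E) r := by
      rw [mem_ball_zero_iff]; rw [mem_closedBall_zero_iff] at hy; linarith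
    have h1 : ContinuousAt f y := (hball y hy').1.continuousAt
    exact (h1.abs.rpow_const (Or.inr (by positivity))).continuousWithinAt
  refine ⟨(1 / c) ^ (m + 1), by positivity, ?_⟩
  refine Metric.eventually_nhds_iff_ball.2 ⟨r / 4, by positivity, fun x hx => ?_⟩
  rw [mem_ball_zero_iff] at hx
  have hxK : x ∈ Metric.closedBall (0 : E) (r / 2) := by
    rw [mem_closedBall_zero_iff]; linarith
  obtain ⟨y, hyK, hy⟩ := (isCompact_closedBall (0 : E) (r / 2)).exists_isMinOn ⟨x, hxK⟩
    (hcont.add (by fun_prop : ContinuousOn (fun y => c * ‖x - y‖) _))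
  have hy0 := hy (Metric.mem_closedBall_self (by positivity) : (0 : E) ∈ _)
  have hyx := hy hxK
  simp only [Set.mem_ofPred_eq, Pi.add_apply, sub_zero, sub_self, norm_zero, mul_zero, add_zero,
    hhz 0 hf0, zero_add] at hy0 hyx
  have hxy : ‖x - y‖ ≤ ‖x‖ := by
    have := hh0 y
    exact le_of_mul_le_mul_left (by linarith) hc0
  have hyn : ‖y‖ < r / 2 := by
    have : ‖y‖ ≤ ‖x‖ + ‖x - y‖ := by
      calc ‖y‖ = ‖x - (x - y)‖ := by rw [sub_sub_cancel]
        _ ≤ _ := norm_sub_le _ _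
    linarith
  refine ⟨y, ?_, hxy, ?_⟩
  · by_contra hfy
    have hhy : 0 < h y := by
      refine (hh0 y).lt_of_ne fun h0 => hfy ?_
      have := hhm y
      rw [← h0, zero_pow (by omega)] at this
      exact abs_eq_zero.1 this.symm
    have hyr : y ∈ Metric.ball (0 : E) r := by rw [mem_ball_zero_iff]; linarith
    obtain ⟨hdiff, hLy⟩ := hball y hyr
    have hnear : ∀ᶠ z in 𝓝 y, c * ‖z - y‖ < h y := by
      have : ContinuousAt (fun z => c * ‖z - y‖) y := by fun_prop
      exact this.eventually_lt_const (by simpa using hhy)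
    have hin : ∀ᶠ z in 𝓝 y, ‖z‖ < r / 2 := continuous_norm.continuousAt.eventually_lt_const hyn
    have hD : ‖fderiv ℝ f y‖ ≤ (m + 1) * c * h y ^ m := by
      refine hdiff.hasFDerivAt.norm_le_of_eventually_abs_ge (by positivity) hfy ?_
      filter_upwards [hnear, hin] with z hz1 hz2
      have hz := hy (show z ∈ Metric.closedBall (0 : E) (r / 2) by
        rw [mem_closedBall_zero_iff]; exact hz2.le)
      simp only [Set.mem_ofPred_eq, Pi.add_apply] at hz
      have htri : ‖x - z‖ ≤ ‖x - y‖ + ‖z - y‖ := by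
        rw [show x - z = (x - y) - (z - y) by abel]; exact norm_sub_le _ _
      have h1 : h y - c * ‖z - y‖ ≤ h z := by nlinarith
      have h2 : (h y - c * ‖z - y‖) ^ (m + 1) ≤ h z ^ (m + 1) :=
        pow_le_pow_left₀ (by linarith) h1 _
      have h3 := sub_mul_pow_le_sub_pow hhy hz1.le m
      rw [← hhm z, ← hhm y]
      linarith
    have hD2 : ‖fderiv ℝ f y‖ ^ (m + 1) ≤ ((m + 1) * c) ^ (m + 1) * |f y| ^ m := by
      calc _ ≤ ((m + 1) * c * h y ^ m) ^ (m + 1) := by gcongr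
        _ = ((m + 1) * c) ^ (m + 1) * (h y ^ (m + 1)) ^ m := by
          rw [mul_pow, ← pow_mul, ← pow_mul, mul_comm m]
        _ = _ := by rw [hhm]
    have hfm : 0 < |f y| ^ m := pow_pos (abs_pos.2 hfy) m
    have h5 : |f y| ^ m ≤ K * ‖fderiv ℝ f y‖ ^ (m + 1) := by
      refine hLy.trans (mul_le_mul_of_nonneg_right ?_ (by positivity))
      have := le_abs_self C
      linarith
    have h6 : |f y| ^ m ≤ ((m + 1) * c) ^ (m + 1) * K * |f y| ^ m := by
      calc _ ≤ K * ‖fderiv ℝ f y‖ ^ (m + 1) := h5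
        _ ≤ K * (((m + 1) * c) ^ (m + 1) * |f y| ^ m) := by gcongr
        _ = _ := by ring
    nlinarith
  · have h7 : ‖x - y‖ ≤ 1 / c * h x := by
      have := hh0 y
      rw [div_mul_eq_mul_div, one_mul, le_div_iff₀ hc0]
      linarith
    calc ‖x - y‖ ^ (m + 1) ≤ (1 / c * h x) ^ (m + 1) := by gcongr
      _ = _ := by rw [mul_pow, hhm]

end Descent

section Flatness

variable {E : Type*} [NormedAddCommGroup E] [NormedSpace ℝ E]

theorem ContDiffAt.exists_norm_iteratedFDeriv_le_of_flat {q : E → ℝ} {k : ℕ}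
    (hq : ContDiffAt ℝ k q 0) (Z : Set E) (h0 : (0 : E) ∈ Z)
    (hZ : ∀ᶠ a in 𝓝 0, a ∈ Z → ∀ i ≤ k, iteratedFDeriv ℝ i q a = 0) (ε : ℝ) (hε : 0 < ε) :
    ∃ r, 0 < r ∧ ∀ x ∈ Metric.ball (0 : E) r, ∀ z ∈ Metric.ball (0 : E) r, z ∈ Z →
      ∀ j i, i + j = k → ‖iteratedFDeriv ℝ i q x‖ ≤ ε * ‖x - z‖ ^ j := by
  have hsmall : ∀ᶠ x in 𝓝 0, ‖iteratedFDeriv ℝ k q x‖ < ε := by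
    have h1 : ContinuousAt (iteratedFDeriv ℝ k q) 0 :=
      (hq.iteratedFDeriv_right (m := 0) (by simp)).continuousAt
    refine h1.norm.eventually_lt_const ?_
    simpa only [hZ.self_of_nhds h0 k le_rfl, norm_zero] using hε
  obtain ⟨r, hr, hball⟩ := Metric.eventually_nhds_iff_ball.1
    ((hq.eventually (by simp)).and (hZ.and hsmall))
  refine ⟨r, hr, fun x hx z hz hzZ j => ?_⟩
  induction j generalizing x with
  | zero =>
    intro i hi
    obtain rfl : i = k := by omega
    simpa using (hball x hx).2.2.le
  | succ j ih =>
    intro i hi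
    have hsub : segment ℝ z x ⊆ Metric.ball (0 : E) r :=
      (convex_ball (0 : E) r).segment_subset hz hx
    have hdiff : ∀ y ∈ segment ℝ z x, DifferentiableAt ℝ (iteratedFDeriv ℝ i q) y := by
      intro y hy
      have hle : ((1 : ℕ) : WithTop ℕ∞) + (i : ℕ) ≤ (k : ℕ) := by
        norm_cast; omega
      exact (ContDiffAt.iteratedFDeriv_right (hball y (hsub hy)).1 hle).differentiableAt (by simp)
    have hbound : ∀ y ∈ segment ℝ z x,
        ‖fderiv ℝ (iteratedFDeriv ℝ i q) y‖ ≤ ε * ‖x - z‖ ^ j := by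
      intro y hy
      rw [norm_fderiv_iteratedFDeriv]
      refine (ih y (hsub hy) (i + 1) (by omega)).trans ?_
      have := norm_sub_le_of_mem_segment hy
      gcongr
    have h1 := (convex_segment z x).norm_image_sub_le_of_norm_fderiv_le hdiff hbound
      (left_mem_segment ℝ z x) (right_mem_segment ℝ z x)
    rw [(hball z hz).2.1 hzZ i (by omega), sub_zero] at h1
    rwa [pow_succ, ← mul_assoc]

theorem exists_norm_sub_pow_le_norm_fderiv [ProperSpace E] (f : E → ℝ)
    (hf0 : f 0 = 0) (hfd : ∀ᶠ x in 𝓝 0, DifferentiableAt ℝ f x) (m : ℕ) (C : ℝ)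
    (hL : ∀ᶠ x in 𝓝 0, |f x| ^ m ≤ C * ‖fderiv ℝ f x‖ ^ (m + 1)) :
    ∃ A : ℝ, 0 < A ∧ ∀ᶠ x in 𝓝 0, ∃ z, f z = 0 ∧ ‖x - z‖ ≤ ‖x‖ ∧
      ‖x - z‖ ^ m ≤ A * ‖fderiv ℝ f x‖ := by
  obtain ⟨A, hA0, hA⟩ := exists_zero_near_of_gradient_inequality f hf0 hfd m C hL
  refine ⟨A ^ m * |C| + 1, by positivity, ?_⟩
  filter_upwards [hA, hL] with x hx hx'
  obtain ⟨z, hz, hzx, hd⟩ := hx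
  refine ⟨z, hz, hzx, ?_⟩
  have hA1 : 1 ≤ A ^ m * |C| + 1 := by
    have : 0 ≤ A ^ m * |C| := by positivity
    linarith
  refine le_of_pow_le_pow_left₀ (n := m + 1) (by omega) (by positivity) ?_
  calc (‖x - z‖ ^ m) ^ (m + 1) = (‖x - z‖ ^ (m + 1)) ^ m := by
        rw [← pow_mul, ← pow_mul, mul_comm]
    _ ≤ (A * |f x|) ^ m := by gcongr
    _ = A ^ m * |f x| ^ m := mul_pow _ _ _
    _ ≤ A ^ m * (|C| * ‖fderiv ℝ f x‖ ^ (m + 1)) := by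
        gcongr
        exact hx'.trans (mul_le_mul_of_nonneg_right (le_abs_self C) (by positivity))
    _ = A ^ m * |C| * ‖fderiv ℝ f x‖ ^ (m + 1) := by ring
    _ ≤ (A ^ m * |C| + 1) ^ (m + 1) * ‖fderiv ℝ f x‖ ^ (m + 1) := by
        gcongr
        calc A ^ m * |C| ≤ (A ^ m * |C| + 1) ^ 1 := by linarith
          _ ≤ _ := pow_le_pow_right₀ hA1 (by omega)
    _ = _ := by rw [mul_pow]

theorem eventually_abs_le_mul_norm_pow_of_flat {q : E → ℝ} {k m : ℕ} (hm : 2 * m ≤ k)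
    (hm1 : 1 ≤ m) {f : E → ℝ} (hf0 : f 0 = 0) {A : ℝ} (hA : 0 < A)
    (hfA : ∀ᶠ x in 𝓝 0, ∃ z, f z = 0 ∧ ‖x - z‖ ≤ ‖x‖ ∧ ‖x - z‖ ^ m ≤ A * ‖fderiv ℝ f x‖)
    (hq : ContDiffAt ℝ k q 0)
    (hZ : ∀ᶠ a in 𝓝 0, f a = 0 → ∀ i ≤ k, iteratedFDeriv ℝ i q a = 0) (ε : ℝ) (hε : 0 < ε) :
    ∀ᶠ x in 𝓝 0, |q x| ≤ ε * ‖fderiv ℝ f x‖ ^ 2 ∧ ‖fderiv ℝ q x‖ ≤ ε * ‖fderiv ℝ f x‖ := by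
  set δ := min (ε / A ^ 2) (ε / A) with hδ
  have hδ0 : 0 < δ := by positivity
  obtain ⟨r, hr, h⟩ := hq.exists_norm_iteratedFDeriv_le_of_flat {a | f a = 0} hf0 hZ δ hδ0
  have hnear : ∀ᶠ x in 𝓝 (0 : E), ‖x‖ < min (r / 2) 1 :=
    continuous_norm.continuousAt.eventually_lt_const (by simp only [norm_zero]; positivity)
  filter_upwards [hfA, hnear] with x hx hxr
  obtain ⟨z, hz, hzx, hd⟩ := hx
  have hx1 : ‖x‖ < r / 2 := hxr.trans_le (min_le_left _ _)
  have hx2 : ‖x‖ ≤ 1 := hxr.le.trans (min_le_right _ _)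
  have hxb : x ∈ Metric.ball (0 : E) r := by rw [mem_ball_zero_iff]; linarith
  have hzb : z ∈ Metric.ball (0 : E) r := by
    rw [mem_ball_zero_iff]
    calc ‖z‖ = ‖x - (x - z)‖ := by rw [sub_sub_cancel]
      _ ≤ ‖x‖ + ‖x - z‖ := norm_sub_le _ _
      _ < r := by linarith
  have h1 := h x hxb z hzb hz k 0 (by omega)
  have h2 := h x hxb z hzb hz (k - 1) 1 (by omega)
  rw [norm_iteratedFDeriv_zero, Real.norm_eq_abs] at h1
  rw [norm_iteratedFDeriv_one] at h2
  have hle1 : ‖x - z‖ ≤ 1 := hzx.trans hx2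
  constructor
  · calc |q x| ≤ δ * ‖x - z‖ ^ k := h1
      _ ≤ δ * ‖x - z‖ ^ (2 * m) :=
          mul_le_mul_of_nonneg_left (pow_le_pow_of_le_one (norm_nonneg _) hle1 hm) hδ0.le
      _ = δ * (‖x - z‖ ^ m) ^ 2 := by rw [mul_comm 2 m, pow_mul]
      _ ≤ ε / A ^ 2 * (A * ‖fderiv ℝ f x‖) ^ 2 := by
          gcongr
          exact min_le_left _ _
      _ = _ := by field_simp
  · calc ‖fderiv ℝ q x‖ ≤ δ * ‖x - z‖ ^ (k - 1) := h2
      _ ≤ δ * ‖x - z‖ ^ m :=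
          mul_le_mul_of_nonneg_left
            (pow_le_pow_of_le_one (norm_nonneg _) hle1 (by omega)) hδ0.le
      _ ≤ ε / A * (A * ‖fderiv ℝ f x‖) := by
          gcongr
          exact min_le_right _ _
      _ = _ := by field_simp

theorem eventually_iteratedFDeriv_sub_eq_zero {f g : E → ℝ} {k : ℕ} (hf : ContDiffAt ℝ k f 0)
    (hg : ContDiffAt ℝ k g 0) {Z : E → Prop}
    (h : ∀ᶠ a in 𝓝 0, Z a → ∀ i ≤ k, iteratedFDeriv ℝ i f a = iteratedFDeriv ℝ i g a) :
    ∀ᶠ a in 𝓝 0, Z a → ∀ i ≤ k, iteratedFDeriv ℝ i (fun x => g x - f x) a = 0 := by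
  filter_upwards [h, hf.eventually (by simp), hg.eventually (by simp)] with a ha hfa hga hz i hi
  have hi' : (i : WithTop ℕ∞) ≤ (k : ℕ) := by exact_mod_cast hi
  have := iteratedFDeriv_sub_apply (hga.of_le hi') (hfa.of_le hi')
  change iteratedFDeriv ℝ i (g - f) a = 0
  rw [this, ha hz i hi, sub_self]

theorem eventually_sub_small_of_realizations [ProperSpace E] {f f₁ f₂ : E → ℝ} {k m : ℕ}
    (hm : 2 * m ≤ k) (hm1 : 1 ≤ m) (hf0 : f 0 = 0) {C : ℝ}
    (hL : ∀ᶠ x in 𝓝 0, |f x| ^ m ≤ C * ‖fderiv ℝ f x‖ ^ (m + 1))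
    (hf : ContDiffAt ℝ k f 0) (hf₁ : ContDiffAt ℝ k f₁ 0) (hf₂ : ContDiffAt ℝ k f₂ 0)
    (h₁ : ∀ᶠ a in 𝓝 0, f a = 0 → ∀ i ≤ k, iteratedFDeriv ℝ i f a = iteratedFDeriv ℝ i f₁ a)
    (h₂ : ∀ᶠ a in 𝓝 0, f a = 0 → ∀ i ≤ k, iteratedFDeriv ℝ i f a = iteratedFDeriv ℝ i f₂ a)
    (ε : ℝ) (hε : 0 < ε) :
    ∀ᶠ x in 𝓝 0, |f₂ x - f₁ x| ≤ ε * ‖fderiv ℝ f₁ x‖ ^ 2 ∧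
      ‖fderiv ℝ (fun x => f₂ x - f₁ x) x‖ ≤ ε * ‖fderiv ℝ f₁ x‖ := by
  have hdiff : ∀ {g : E → ℝ}, ContDiffAt ℝ k g 0 → ∀ᶠ x in 𝓝 0, DifferentiableAt ℝ g x :=
    fun hg => (hg.eventually (by simp)).mono fun x hx =>
      hx.differentiableAt (by norm_cast; omega)
  obtain ⟨A, hA, hfA⟩ := exists_norm_sub_pow_le_norm_fderiv f hf0 (hdiff hf) m C hL
  have h12 : ∀ᶠ a in 𝓝 0, f a = 0 → ∀ i ≤ k,
      iteratedFDeriv ℝ i f₁ a = iteratedFDeriv ℝ i f₂ a := by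
    filter_upwards [h₁, h₂] with a ha hb hz i hi
    rw [← ha hz i hi, hb hz i hi]
  have e1 := eventually_abs_le_mul_norm_pow_of_flat hm hm1 hf0 hA hfA (hf₁.sub hf)
    (eventually_iteratedFDeriv_sub_eq_zero hf hf₁ h₁) (1 / 2) (by norm_num)
  have e2 := eventually_abs_le_mul_norm_pow_of_flat hm hm1 hf0 hA hfA (hf₂.sub hf₁)
    (eventually_iteratedFDeriv_sub_eq_zero hf₁ hf₂ h12) (ε / 4) (by positivity)
  filter_upwards [e1, e2, hdiff hf, hdiff hf₁] with x hx1 hx2 hdf hdf1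
  have h3 : fderiv ℝ (fun x => f₁ x - f x) x = fderiv ℝ f₁ x - fderiv ℝ f x :=
    fderiv_sub hdf1 hdf
  have h4 : ‖fderiv ℝ f x‖ ≤ 2 * ‖fderiv ℝ f₁ x‖ := by
    have h5 := hx1.2
    rw [h3] at h5
    have h6 : ‖fderiv ℝ f x‖ ≤ ‖fderiv ℝ f₁ x‖ + ‖fderiv ℝ f₁ x - fderiv ℝ f x‖ := by
      calc _ = ‖fderiv ℝ f₁ x - (fderiv ℝ f₁ x - fderiv ℝ f x)‖ := by rw [sub_sub_cancel]
        _ ≤ _ := norm_sub_le _ _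
    linarith
  constructor
  · calc _ ≤ ε / 4 * ‖fderiv ℝ f x‖ ^ 2 := hx2.1
      _ ≤ ε / 4 * (2 * ‖fderiv ℝ f₁ x‖) ^ 2 := by gcongr
      _ = _ := by ring
  · calc _ ≤ ε / 4 * ‖fderiv ℝ f x‖ := hx2.2
      _ ≤ ε / 4 * (2 * ‖fderiv ℝ f₁ x‖) := by gcongr
      _ ≤ _ := by nlinarith [norm_nonneg (fderiv ℝ f₁ x)]

end Flatness

section GradientFlowLine

variable {E : Type*} [NormedAddCommGroup E] [InnerProductSpace ℝ E]
  {F : E → ℝ} {G : E → E} {K : Set E} {C τ : ℝ}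

theorem hasDerivAt_comp_add_smul (x v : E) (t : ℝ)
    (h : HasFDerivAt F (innerSL ℝ (G (x + t • v))) (x + t • v)) :
    HasDerivAt (fun t : ℝ => F (x + t • v)) (inner ℝ (G (x + t • v)) v) t := by
  have h1 : HasDerivAt (fun t : ℝ => x + t • v) v t := by
    simpa using ((hasDerivAt_id t).smul_const v).const_add x
  have h2 := h.comp_hasDerivAt t h1
  rwa [innerSL_apply_apply] at h2

theorem norm_gradient_line_sub_le (hG : ∀ x ∈ K, ∀ y ∈ K, ‖G x - G y‖ ≤ C * ‖x - y‖)
    (hC : 0 < C) {x : E} (hx : ∀ t : ℝ, |t| ≤ τ → x + t • G x ∈ K) {t : ℝ} (ht : |t| ≤ τ)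
    (hCτ : C * τ ≤ 1 / 2) : ‖G (x + t • G x) - G x‖ ≤ ‖G x‖ / 2 := by
  have hxK : x ∈ K := by simpa using hx 0 (by simpa using (abs_nonneg t).trans ht)
  have h1 := hG _ (hx t ht) _ hxK
  rw [add_sub_cancel_left, norm_smul, Real.norm_eq_abs, ← mul_assoc] at h1
  have h2 : C * |t| ≤ 1 / 2 := (mul_le_mul_of_nonneg_left ht hC.le).trans hCτ
  nlinarith [norm_nonneg (G x)]

theorem mul_sub_le_sub_along_gradient
    (hF : ∀ x ∈ K, HasFDerivAt F (innerSL ℝ (G x)) x)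
    (hG : ∀ x ∈ K, ∀ y ∈ K, ‖G x - G y‖ ≤ C * ‖x - y‖)
    (hC : 0 < C) (hCτ : C * τ ≤ 1 / 2) {x : E} (hx : ∀ t : ℝ, |t| ≤ τ → x + t • G x ∈ K)
    {s t : ℝ} (hs : |s| ≤ τ) (ht : |t| ≤ τ) (hst : s ≤ t) :
    ‖G x‖ ^ 2 / 2 * (t - s) ≤ F (x + t • G x) - F (x + s • G x) := by
  have hd : ∀ u ∈ Set.Icc (-τ) τ, HasDerivAt (fun t : ℝ => F (x + t • G x))
      (inner ℝ (G (x + u • G x)) (G x)) u :=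
    fun u hu => hasDerivAt_comp_add_smul x (G x) u (hF _ (hx u (abs_le.2 hu)))
  refine (convex_Icc (-τ) τ).mul_sub_le_image_sub_of_le_deriv
    (fun u hu => (hd u hu).continuousAt.continuousWithinAt)
    (fun u hu => (hd u (interior_subset hu)).differentiableAt.differentiableWithinAt)
    (fun u hu => ?_) s (abs_le.1 hs) t (abs_le.1 ht) hst
  have hu' := interior_subset hu
  rw [(hd u hu').deriv]
  have h1 := norm_gradient_line_sub_le hG hC hx (abs_le.2 hu') hCτ
  have h2 := abs_real_inner_le_norm (G (x + u • G x) - G x) (G x)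
  rw [inner_sub_left, real_inner_self_eq_norm_sq] at h2
  have h3 := (abs_le.1 h2).1
  nlinarith [norm_nonneg (G x)]

theorem half_mul_abs_sub_le_along_gradient
    (hF : ∀ x ∈ K, HasFDerivAt F (innerSL ℝ (G x)) x)
    (hG : ∀ x ∈ K, ∀ y ∈ K, ‖G x - G y‖ ≤ C * ‖x - y‖)
    (hC : 0 < C) (hCτ : C * τ ≤ 1 / 2) {x : E} (hx : ∀ t : ℝ, |t| ≤ τ → x + t • G x ∈ K)
    {s t : ℝ} (hs : |s| ≤ τ) (ht : |t| ≤ τ) :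
    ‖G x‖ ^ 2 / 2 * |t - s| ≤ |F (x + t • G x) - F (x + s • G x)| := by
  rcases le_total s t with h | h
  · rw [abs_of_nonneg (sub_nonneg.2 h)]
    exact (mul_sub_le_sub_along_gradient hF hG hC hCτ hx hs ht h).trans (le_abs_self _)
  · rw [abs_sub_comm t, abs_sub_comm (F _), abs_of_nonneg (sub_nonneg.2 h)]
    exact (mul_sub_le_sub_along_gradient hF hG hC hCτ hx ht hs h).trans (le_abs_self _)

theorem exists_step_along_gradient
    (hF : ∀ x ∈ K, HasFDerivAt F (innerSL ℝ (G x)) x)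
    (hG : ∀ x ∈ K, ∀ y ∈ K, ‖G x - G y‖ ≤ C * ‖x - y‖)
    (hC : 0 < C) (hCτ : C * τ ≤ 1 / 2) (hτ : 0 ≤ τ) {x : E}
    (hx : ∀ t : ℝ, |t| ≤ τ → x + t • G x ∈ K) {b : ℝ} (hb : |b| ≤ τ / 2 * ‖G x‖ ^ 2) :
    ∃ s : ℝ, |s| ≤ τ ∧ F (x + s • G x) = F x + b ∧ (b = 0 → s = 0) := by
  by_cases hb0 : b = 0
  · exact ⟨0, by simpa using hτ, by simp [hb0], fun _ => rfl⟩
  have hcont : ContinuousOn (fun t : ℝ => F (x + t • G x)) (Set.Icc (-τ) τ) := fun u hu =>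
    (hasDerivAt_comp_add_smul x (G x) u
      (hF _ (hx u (abs_le.2 hu)))).continuousAt.continuousWithinAt
  have h0 : |(0 : ℝ)| ≤ τ := by simpa using hτ
  have h1 := mul_sub_le_sub_along_gradient hF hG hC hCτ hx h0 (abs_of_nonneg hτ).le hτ
  have h2 := mul_sub_le_sub_along_gradient hF hG hC hCτ hx
    (by rw [abs_neg, abs_of_nonneg hτ]) h0 (neg_nonpos.2 hτ)
  simp only [zero_smul, add_zero] at h1 h2
  have h3 := abs_le.1 hb
  obtain ⟨s, hs, hsF⟩ := intermediate_value_Icc (by linarith) hcont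
    (show F x + b ∈ Set.Icc _ _ from ⟨by linarith, by linarith⟩)
  exact ⟨s, abs_le.2 hs, hsF, fun h => absurd h hb0⟩

theorem abs_increment_sub_le
    (hF : ∀ x ∈ K, HasFDerivAt F (innerSL ℝ (G x)) x)
    (hG : ∀ x ∈ K, ∀ y ∈ K, ‖G x - G y‖ ≤ C * ‖x - y‖)
    (hC : 0 < C) (hCτ : C * τ ≤ 1 / 2) {x y : E}
    (hx : ∀ t : ℝ, |t| ≤ τ → x + t • G x ∈ K) (hy : ∀ t : ℝ, |t| ≤ τ → y + t • G y ∈ K)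
    (hxy : C * ‖x - y‖ ≤ ‖G x‖ / 4) {s : ℝ} (hs : |s| ≤ τ) :
    |(F (x + s • G x) - F x) - (F (y + s • G y) - F y)| ≤ 4 * C * ‖G x‖ * ‖x - y‖ * τ := by
  have hτ : 0 ≤ τ := (abs_nonneg s).trans hs
  have h0 : |(0 : ℝ)| ≤ τ := by simpa using hτ
  have hxK : x ∈ K := by simpa using hx 0 h0
  have hyK : y ∈ K := by simpa using hy 0 h0
  have hd : ∀ u ∈ Set.Icc (-τ) τ,
      HasDerivWithinAt (fun t : ℝ => F (x + t • G x) - F (y + t • G y))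
      (inner ℝ (G (x + u • G x)) (G x) - inner ℝ (G (y + u • G y)) (G y))
      (Set.Icc (-τ) τ) u := fun u hu =>
    ((hasDerivAt_comp_add_smul x (G x) u (hF _ (hx u (abs_le.2 hu)))).sub
      (hasDerivAt_comp_add_smul y (G y) u (hF _ (hy u (abs_le.2 hu))))).hasDerivWithinAt
  have hb : ∀ u ∈ Set.Icc (-τ) τ,
      ‖inner ℝ (G (x + u • G x)) (G x) - inner ℝ (G (y + u • G y)) (G y)‖ ≤
        4 * C * ‖G x‖ * ‖x - y‖ := by
    intro u hu
    have hu' := abs_le.2 hu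
    have hxy' := hG x hxK y hyK
    have e1 : inner ℝ (G (x + u • G x)) (G x) - inner ℝ (G (y + u • G y)) (G y) =
        inner ℝ (G (x + u • G x) - G (y + u • G y)) (G x) +
          inner ℝ (G (y + u • G y)) (G x - G y) := by
      rw [inner_sub_left, inner_sub_right]; ring
    have e2 : ‖G (x + u • G x) - G (y + u • G y)‖ ≤ 3 / 2 * (C * ‖x - y‖) := by
      have e3 : x + u • G x - (y + u • G y) = (x - y) + u • (G x - G y) := by
        rw [smul_sub]; abel
      have e4 : ‖(x - y) + u • (G x - G y)‖ ≤ ‖x - y‖ + |u| * ‖G x - G y‖ := by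
        simpa [norm_smul] using norm_add_le (x - y) (u • (G x - G y))
      have e5 := hG _ (hx u hu') _ (hy u hu')
      rw [e3] at e5
      have e6 : |u| * ‖G x - G y‖ ≤ ‖x - y‖ / 2 := by
        calc |u| * ‖G x - G y‖ ≤ τ * (C * ‖x - y‖) := by gcongr
          _ = C * τ * ‖x - y‖ := by ring
          _ ≤ 1 / 2 * ‖x - y‖ := by gcongr
          _ = _ := by ring
      nlinarith [mul_le_mul_of_nonneg_left (e4.trans (add_le_add_right e6 _)) hC.le]
    have e7 : ‖G (y + u • G y)‖ ≤ 2 * ‖G x‖ := by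
      have h1 := norm_gradient_line_sub_le hG hC hy hu' hCτ
      have h2 : ‖G (y + u • G y)‖ ≤ ‖G (y + u • G y) - G y‖ + ‖G y‖ := by
        simpa using norm_add_le (G (y + u • G y) - G y) (G y)
      have h3 : ‖G y‖ ≤ ‖G x‖ + ‖G x - G y‖ := norm_le_norm_add_norm_sub _ _
      linarith [norm_nonneg (G x)]
    rw [e1, Real.norm_eq_abs]
    calc _ ≤ ‖G (x + u • G x) - G (y + u • G y)‖ * ‖G x‖ +
          ‖G (y + u • G y)‖ * ‖G x - G y‖ :=
          (abs_add_le _ _).trans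
            (add_le_add (abs_real_inner_le_norm _ _) (abs_real_inner_le_norm _ _))
      _ ≤ 3 / 2 * (C * ‖x - y‖) * ‖G x‖ + 2 * ‖G x‖ * (C * ‖x - y‖) := by gcongr
      _ ≤ _ := by
        have : 0 ≤ C * ‖G x‖ * ‖x - y‖ := by positivity
        linarith
  have h1 := (convex_Icc (-τ) τ).norm_image_sub_le_of_norm_hasDerivWithin_le hd hb
    (abs_le.1 h0) (abs_le.1 hs)
  simp only [zero_smul, add_zero, sub_zero, Real.norm_eq_abs] at h1
  calc _ = |F (x + s • G x) - F (y + s • G y) - (F x - F y)| := by congr 1; ring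
    _ ≤ _ := h1
    _ ≤ _ := by gcongr

end GradientFlowLine

section GradientPerturbation

variable {E : Type*} [NormedAddCommGroup E] [InnerProductSpace ℝ E]

theorem norm_step_sub_le {F q s : E → ℝ} {G : E → E} {K S : Set E} {C τ : ℝ}
    (hF : ∀ x ∈ K, HasFDerivAt F (innerSL ℝ (G x)) x)
    (hG : ∀ x ∈ K, ∀ y ∈ K, ‖G x - G y‖ ≤ C * ‖x - y‖)
    (hC : 0 < C) (hCτ : C * τ ≤ 1 / 2) (hτ : 0 ≤ τ) (hS : Convex ℝ S)
    (hSK : ∀ x ∈ S, ∀ t : ℝ, |t| ≤ τ → x + t • G x ∈ K)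
    (hq : ∀ x ∈ S, DifferentiableAt ℝ q x ∧ ‖fderiv ℝ q x‖ ≤ τ / 2 * ‖G x‖)
    (hs : ∀ x ∈ S, |s x| ≤ τ ∧ F (x + s x • G x) = F x + q x)
    {x y : E} (hx : x ∈ S) (hy : y ∈ S) :
    ‖s x • G x - s y • G y‖ ≤ τ * (2 + 9 * C) * ‖x - y‖ := by
  have h0 : |(0 : ℝ)| ≤ τ := by simpa using hτ
  have hK : ∀ z ∈ S, z ∈ K := fun z hz => by simpa using hSK z hz 0 h0
  have hGxy := hG x (hK x hx) y (hK y hy)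
  have hpos : 0 ≤ τ * ‖x - y‖ := by positivity
  rcases le_or_gt (C * ‖x - y‖) (‖G x‖ / 4) with hclose | hfar
  · have hdec : s x • G x - s y • G y = (s x - s y) • G x + s y • (G x - G y) := by
      rw [sub_smul, smul_sub]; abel
    have h2 : ‖s y • (G x - G y)‖ ≤ τ * (C * ‖x - y‖) := by
      rw [norm_smul, Real.norm_eq_abs]
      have := (hs y hy).1
      gcongr
    have hqxy : |q x - q y| ≤ τ / 2 * (5 / 4 * ‖G x‖) * ‖x - y‖ := by
      rw [abs_sub_comm, ← Real.norm_eq_abs, norm_sub_rev x y]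
      refine (convex_segment x y).norm_image_sub_le_of_norm_fderiv_le (𝕜 := ℝ)
        (fun z hz => (hq z (hS.segment_subset hx hy hz)).1) (fun z hz => ?_)
        (left_mem_segment ℝ x y) (right_mem_segment ℝ x y)
      have hzS := hS.segment_subset hx hy hz
      refine (hq z hzS).2.trans (mul_le_mul_of_nonneg_left ?_ (by positivity))
      have e1 := hG z (hK z hzS) x (hK x hx)
      have e2 : ‖z - x‖ ≤ ‖x - y‖ := by
        rw [norm_sub_rev x y]; exact norm_sub_le_of_mem_segment hz
      have e3 : ‖G z‖ ≤ ‖G x‖ + ‖G z - G x‖ := by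
        rw [norm_sub_rev]; exact norm_le_norm_add_norm_sub _ _
      have e4 := mul_le_mul_of_nonneg_left e2 hC.le
      linarith
    have h3 := abs_increment_sub_le hF hG hC hCτ (hSK x hx) (hSK y hy) hclose (hs y hy).1
    have h4 := half_mul_abs_sub_le_along_gradient hF hG hC hCτ (hSK x hx)
      (hs y hy).1 (hs x hx).1
    have h5 : |F (x + s x • G x) - F (x + s y • G x)| ≤
        |q x - q y| + |(F (x + s y • G x) - F x) - (F (y + s y • G y) - F y)| := by
      rw [(hs x hx).2, (hs y hy).2]
      calc _ = |(q x - q y) - ((F (x + s y • G x) - F x) - (F y + q y - F y))| := by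
            congr 1; ring
        _ ≤ _ := abs_sub _ _
    have h1 : ‖(s x - s y) • G x‖ ≤ τ * (2 + 8 * C) * ‖x - y‖ := by
      rw [norm_smul, Real.norm_eq_abs]
      rcases (norm_nonneg (G x)).eq_or_lt with hg | hg
      · rw [← hg, mul_zero]; positivity
      · refine le_of_mul_le_mul_left ?_ hg
        have h6 : 0 ≤ ‖G x‖ * (τ * ‖x - y‖) := by positivity
        nlinarith
    rw [hdec]
    calc _ ≤ _ := norm_add_le _ _
      _ ≤ _ := add_le_add h1 h2
      _ = _ := by ring
  · have h1 : ‖G y‖ ≤ ‖G x‖ + ‖G x - G y‖ := norm_le_norm_add_norm_sub _ _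
    calc _ ≤ ‖s x • G x‖ + ‖s y • G y‖ := norm_sub_le _ _
      _ ≤ τ * ‖G x‖ + τ * ‖G y‖ := by
        rw [norm_smul, norm_smul, Real.norm_eq_abs, Real.norm_eq_abs]
        have := (hs x hx).1
        have := (hs y hy).1
        gcongr
      _ ≤ τ * (4 * (C * ‖x - y‖)) + τ * (5 * (C * ‖x - y‖)) := by gcongr <;> linarith
      _ ≤ _ := by nlinarith

theorem exists_openPartialHomeomorph_of_approximatesLinearOn_id [CompleteSpace E] {φ : E → E}
    {S : Set E} (hS : IsOpen S) (h : ∀ x ∈ S, ∀ y ∈ S, ‖φ x - φ y - (x - y)‖ ≤ 1 / 2 * ‖x - y‖) :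
    ∃ e : OpenPartialHomeomorph E E, e.source = S ∧ ⇑e = φ := by
  have happ : ApproximatesLinearOn φ
      ((ContinuousLinearEquiv.refl ℝ E : E ≃L[ℝ] E) : E →L[ℝ] E) S (1 / 2) := by
    intro x hx y hy
    simpa using h x hx y hy
  refine ⟨happ.toOpenPartialHomeomorph φ S ?_ hS, rfl, rfl⟩
  rcases subsingleton_or_nontrivial E with hE | hE
  · exact Or.inl hE
  · right
    have : ‖(((ContinuousLinearEquiv.refl ℝ E).symm : E ≃L[ℝ] E) : E →L[ℝ] E)‖₊ = 1 := by
      ext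
      exact ContinuousLinearMap.norm_id
    rw [this, inv_one]
    exact_mod_cast (by norm_num : (1 / 2 : ℝ) < 1)

theorem exists_openPartialHomeomorph_comp_eq [CompleteSpace E] {f₁ f₂ : E → ℝ}
    (hf₁ : ContDiffAt ℝ 2 f₁ 0) (hf₂ : ContDiffAt ℝ 2 f₂ 0) (h0 : f₁ 0 = f₂ 0)
    (hsmall : ∀ ε : ℝ, 0 < ε → ∀ᶠ x in 𝓝 0, |f₂ x - f₁ x| ≤ ε * ‖fderiv ℝ f₁ x‖ ^ 2 ∧
      ‖fderiv ℝ (fun x => f₂ x - f₁ x) x‖ ≤ ε * ‖fderiv ℝ f₁ x‖) :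
    ∃ e : OpenPartialHomeomorph E E, (0 : E) ∈ e.source ∧ e 0 = 0 ∧
      ∀ x ∈ e.source, f₁ (e x) = f₂ x := by
  set G : E → E := gradient f₁ with hGdef
  have hGnorm : ∀ x, ‖G x‖ = ‖fderiv ℝ f₁ x‖ := fun x => LinearIsometryEquiv.norm_map _ _
  have hFev : ∀ᶠ x in 𝓝 (0 : E), HasFDerivAt f₁ (innerSL ℝ (G x)) x := by
    filter_upwards [hf₁.eventually (by simp)] with x hx
    exact (hx.differentiableAt (by simp)).hasGradientAt.hasFDerivAt
  obtain ⟨C₀, V, hV, hLip⟩ : ∃ C₀, ∃ V ∈ 𝓝 (0 : E), LipschitzOnWith C₀ (fderiv ℝ f₁) V :=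
    (hf₁.fderiv_right (m := 1) (by norm_num)).exists_lipschitzOnWith
  obtain ⟨R, hR, hball⟩ := Metric.eventually_nhds_iff_ball.1 (hFev.and hV)
  set C : ℝ := C₀ + 1 with hCdef
  have hC : 0 < C := by positivity
  have hG : ∀ x ∈ Metric.ball (0 : E) R, ∀ y ∈ Metric.ball (0 : E) R,
      ‖G x - G y‖ ≤ C * ‖x - y‖ := by
    intro x hx y hy
    have h1 : ‖G x - G y‖ = ‖fderiv ℝ f₁ x - fderiv ℝ f₁ y‖ := by
      rw [hGdef, gradient, gradient, ← map_sub, LinearIsometryEquiv.norm_map]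
    rw [h1]
    refine (hLip.norm_sub_le (hball x hx).2 (hball y hy).2).trans ?_
    rw [hCdef]
    gcongr
    linarith
  set M : ℝ := ‖G 0‖ + C * R with hM
  have hM0 : 0 < M := by positivity
  set τ : ℝ := min (1 / (2 * (2 + 9 * C))) (R / (2 * M)) with hτdef
  have hτ : 0 < τ := by positivity
  have hτ1 : τ * (2 + 9 * C) ≤ 1 / 2 := by
    have h1 : τ ≤ 1 / (2 * (2 + 9 * C)) := min_le_left _ _
    rw [le_div_iff₀ (by positivity)] at h1
    linarith
  have hτ2 : τ * M ≤ R / 2 := by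
    have h1 : τ ≤ R / (2 * M) := min_le_right _ _
    rw [le_div_iff₀ (by positivity)] at h1
    linarith
  have hCτ : C * τ ≤ 1 / 2 := by nlinarith
  have hqd : ∀ᶠ x in 𝓝 (0 : E), DifferentiableAt ℝ (fun x => f₂ x - f₁ x) x := by
    filter_upwards [(hf₂.sub hf₁).eventually (by simp)] with x hx
    exact hx.differentiableAt (by simp)
  obtain ⟨r, hr, hr'⟩ := Metric.eventually_nhds_iff_ball.1
    (hqd.and (hsmall (τ / 2) (by positivity)))
  set S := Metric.ball (0 : E) (min r (R / 2)) with hSdef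
  have hSr : ∀ x ∈ S, x ∈ Metric.ball (0 : E) r := fun x hx =>
    Metric.ball_subset_ball (min_le_left _ _) hx
  have h0S : (0 : E) ∈ S := Metric.mem_ball_self (by positivity)
  have hSK : ∀ x ∈ S, ∀ t : ℝ, |t| ≤ τ → x + t • G x ∈ Metric.ball (0 : E) R := by
    intro x hx t ht
    have hxR : ‖x‖ < R / 2 := by
      have := Metric.ball_subset_ball (min_le_right r (R / 2)) hx
      rwa [mem_ball_zero_iff] at this
    have hGx : ‖G x‖ ≤ M := by
      have h1 := hG x (mem_ball_zero_iff.2 (by linarith)) 0 (Metric.mem_ball_self hR)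
      have h2 : ‖G x‖ ≤ ‖G 0‖ + ‖G x - G 0‖ := by
        rw [norm_sub_rev]; exact norm_le_norm_add_norm_sub _ _
      rw [sub_zero] at h1
      nlinarith
    rw [mem_ball_zero_iff]
    calc ‖x + t • G x‖ ≤ ‖x‖ + |t| * ‖G x‖ := by
          simpa [norm_smul] using norm_add_le x (t • G x)
      _ ≤ ‖x‖ + τ * M := by gcongr
      _ < R := by linarith
  have hstep : ∀ x, ∃ s : ℝ, x ∈ S → |s| ≤ τ ∧
      f₁ (x + s • G x) = f₁ x + (f₂ x - f₁ x) ∧ (f₂ x - f₁ x = 0 → s = 0) := by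
    intro x
    by_cases hx : x ∈ S
    · obtain ⟨s, hs⟩ := exists_step_along_gradient (fun x hx => (hball x hx).1) hG hC hCτ hτ.le
        (hSK x hx) (b := f₂ x - f₁ x) (by rw [hGnorm]; exact (hr' x (hSr x hx)).2.1)
      exact ⟨s, fun _ => hs⟩
    · exact ⟨0, fun h => absurd h hx⟩
  choose s hs using hstep
  obtain ⟨e, heS, heφ⟩ := exists_openPartialHomeomorph_of_approximatesLinearOn_id
    (φ := fun x => x + s x • G x) (S := S) Metric.isOpen_ball (fun x hx y hy => by
      have h1 := norm_step_sub_le (fun x hx => (hball x hx).1) hG hC hCτ hτ.le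
        (convex_ball (0 : E) _) hSK
        (fun x hx => ⟨(hr' x (hSr x hx)).1, by
          rw [hGnorm]; exact (hr' x (hSr x hx)).2.2⟩)
        (fun x hx => ⟨(hs x hx).1, (hs x hx).2.1⟩) hx hy
      have h2 : x + s x • G x - (y + s y • G y) - (x - y) = s x • G x - s y • G y := by abel
      rw [h2]
      exact h1.trans (mul_le_mul_of_nonneg_right hτ1 (norm_nonneg _)))
  refine ⟨e, heS ▸ h0S, ?_, fun x hx => ?_⟩
  · rw [heφ]
    simp [(hs 0 h0S).2.2 (by rw [h0, sub_self])]
  · rw [heφ]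
    rw [heS] at hx
    have := (hs x hx).2.1
    simp only [this, add_sub_cancel]

end GradientPerturbation

theorem stmt_18 (n : ℕ) (U : Set (EuclideanSpace ℝ (Fin n))) (hUopen : IsOpen U)
    (hUconn : IsConnected U) (h0U : (0 : EuclideanSpace ℝ (Fin n)) ∈ U)
    (f : EuclideanSpace ℝ (Fin n) → ℝ) (hf : AnalyticOnNhd ℝ f U)
    (hfne : ∃ x ∈ U, f x ≠ 0) (hf0 : f 0 = 0)
    (P : MvPolynomial (Fin (n + 1)) ℝ) (hP : P ≠ 0)
    (hPf : ∀ x ∈ U, MvPolynomial.eval (Fin.snoc (fun i => x i) (f x)) P = 0)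
    (hPy : ∀ x ∈ U,
      MvPolynomial.eval (Fin.snoc (fun i => x i) (f x))
        (MvPolynomial.pderiv (Fin.last n) P) ≠ 0)
    (d : ℕ) (hd : d = P.totalDegree)
    (Z : Set (EuclideanSpace ℝ (Fin n))) (hZ : Z = {x ∈ U | f x = 0})
    (k : ℕ) (hk : k = d * (3 * d - 2) ^ n + 1)
    (U₁ U₂ : Set (EuclideanSpace ℝ (Fin n)))
    (hU₁ : IsOpen U₁) (h0U₁ : (0 : EuclideanSpace ℝ (Fin n)) ∈ U₁)
    (hU₂ : IsOpen U₂) (h0U₂ : (0 : EuclideanSpace ℝ (Fin n)) ∈ U₂)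
    (f₁ f₂ : EuclideanSpace ℝ (Fin n) → ℝ)
    (hf₁ : ContDiffOn ℝ k f₁ U₁) (hf₂ : ContDiffOn ℝ k f₂ U₂)
    (hreal₁ : ∃ W ∈ nhds (0 : EuclideanSpace ℝ (Fin n)), W ⊆ U₁ ∧
      ∀ a ∈ Z ∩ W, ∀ i ≤ k, iteratedFDeriv ℝ i f a = iteratedFDeriv ℝ i f₁ a)
    (hreal₂ : ∃ W ∈ nhds (0 : EuclideanSpace ℝ (Fin n)), W ⊆ U₂ ∧
      ∀ a ∈ Z ∩ W, ∀ i ≤ k, iteratedFDeriv ℝ i f a = iteratedFDeriv ℝ i f₂ a) :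
    ∃ Ω₁ Ω₂ : Set (EuclideanSpace ℝ (Fin n)), IsOpen Ω₁ ∧ IsOpen Ω₂ ∧
      (0 : EuclideanSpace ℝ (Fin n)) ∈ Ω₁ ∧ (0 : EuclideanSpace ℝ (Fin n)) ∈ Ω₂ ∧
      Ω₁ ⊆ U₂ ∧ Ω₂ ⊆ U₁ ∧
      ∃ φ : Ω₁ ≃ₜ Ω₂, ∀ x : Ω₁, f₁ ((φ x : Ω₂) : EuclideanSpace ℝ (Fin n)) =
        f₂ (x : EuclideanSpace ℝ (Fin n)) := by
  subst hZ hk hd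
  have hn : 1 ≤ n := by
    obtain ⟨x, -, hx⟩ := hfne
    rcases Nat.eq_zero_or_pos n with rfl | h
    · exact absurd (by rw [Subsingleton.elim x 0, hf0]) hx
    · exact h
  have hUnhds := hUopen.mem_nhds h0U
  have hPy0 : MvPolynomial.eval 0 (MvPolynomial.pderiv (Fin.last n) P) ≠ 0 := by
    have h := hPy 0 h0U
    rw [hf0] at h
    rwa [← MvPolynomial.snoc_zero_zero]
  obtain ⟨N, C, hN, hL⟩ := MvPolynomial.exists_effective_gradient_inequality_of_implicit f P hn
    (by filter_upwards [hUnhds] with x hx using (hf x hx).differentiableAt) hf0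
    (by filter_upwards [hUnhds] with x hx using hPf x hx) hPy0
  set k := P.totalDegree * (3 * P.totalDegree - 2) ^ n + 1
  have hf₁' := hf₁.contDiffAt (hU₁.mem_nhds h0U₁)
  have hf₂' := hf₂.contDiffAt (hU₂.mem_nhds h0U₂)
  obtain ⟨W₁, hW₁, -, hreal₁⟩ := hreal₁
  obtain ⟨W₂, hW₂, -, hreal₂⟩ := hreal₂
  have hsmall := eventually_sub_small_of_realizations (m := 2 * N + 1) (by omega) (by omega)
    hf0 hL (hf 0 h0U).contDiffAt hf₁' hf₂'
    (by filter_upwards [hUnhds, hW₁] with a ha hw hz using hreal₁ a ⟨⟨ha, hz⟩, hw⟩)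
    (by filter_upwards [hUnhds, hW₂] with a ha hw hz using hreal₂ a ⟨⟨ha, hz⟩, hw⟩)
  have h0 : f₁ 0 = f₂ 0 := by
    have h1 := congrArg (fun g => g 0)
      (hreal₁ 0 ⟨⟨h0U, hf0⟩, mem_of_mem_nhds hW₁⟩ 0 (Nat.zero_le _))
    have h2 := congrArg (fun g => g 0)
      (hreal₂ 0 ⟨⟨h0U, hf0⟩, mem_of_mem_nhds hW₂⟩ 0 (Nat.zero_le _))
    simp only [iteratedFDeriv_zero_apply] at h1 h2
    rw [← h1, h2]
  have h2k : (2 : WithTop ℕ∞) ≤ (k : ℕ) := by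
    exact_mod_cast (by omega : 2 ≤ k)
  obtain ⟨e, he0, he00, he⟩ := exists_openPartialHomeomorph_comp_eq (hf₁'.of_le h2k)
    (hf₂'.of_le h2k) h0 hsmall
  have hV : IsOpen (e.source ∩ (U₂ ∩ e ⁻¹' U₁)) := by
    have := (e.isOpen_inter_preimage hU₁).inter hU₂
    rwa [Set.inter_assoc, Set.inter_comm _ U₂] at this
  set e' := e.restrOpen _ hV
  have hsrc : e'.source ⊆ e.source ∩ (U₂ ∩ e ⁻¹' U₁) := by
    rw [e.restrOpen_source]
    exact Set.inter_subset_right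
  have h0' : (0 : EuclideanSpace ℝ (Fin n)) ∈ e'.source := by
    rw [e.restrOpen_source]
    exact ⟨he0, he0, h0U₂, by simpa [he00] using h0U₁⟩
  refine ⟨e'.source, e'.target, e'.open_source, e'.open_target, h0', ?_,
    fun x hx => (hsrc hx).2.1, fun y hy => ?_, e'.toHomeomorphSourceTarget,
    fun x => he x (hsrc x.2).1⟩
  · have := e'.map_source h0'
    rwa [show e' 0 = 0 from he00] at this
  · have := (hsrc (e'.map_target hy)).2.2
    rw [← e'.right_inv hy]
    exact this
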